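/- Let U, V be domains in ℝ², each different from ℝ², and let f : ∂_H U → ∂_H V be an isometry of the Hausdorff boundaries in the relative metrics. Let the ordered triple x,y,z determine a boundary angle for U, and let x', y', z' be the supports of the f-images of the elements of ∂_H U generated by x, y, z via the boundary intervals ]x,y[ and ]y,z[. Then x', y', z' determine a boundary angle for V, and moreover |x' − y'| = |x − y|, |z' − y'| = |z − y|, and |x' − z'| = |x − z|. -/

import Mathlib

open Set Metric Filter

noncomputable section

/-- Euclidean `n`-space. -/
abbrev Euc (n : ℕ) := EuclideanSpace ℝ (Fin n)

/-- A domain: a nonempty open connected subset of Euclidean space. -/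
def IsEucDomain {n : ℕ} (U : Set (Euc n)) : Prop := IsOpen U ∧ IsConnected U

/-- Intrinsic extended distance inside `S`: the infimum of the lengths (total
variations) of continuous paths joining `x` and `y` within `S`. -/
def intrinsicDist {n : ℕ} (S : Set (Euc n)) (x y : Euc n) : ENNReal :=
  ⨅ (γ : ℝ → Euc n) (_ : ContinuousOn γ (Icc (0:ℝ) 1)) (_ : γ 0 = x) (_ : γ 1 = y)
    (_ : MapsTo γ (Icc (0:ℝ) 1) S), eVariationOn γ (Icc (0:ℝ) 1)

/-- A Cauchy sequence (in the intrinsic metric) of points of `U` that does not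
converge (in the intrinsic metric) to a point of `U`; such sequences represent
elements of the Hausdorff boundary of `U`. -/
structure HBSeq {n : ℕ} (U : Set (Euc n)) where
  seq : ℕ → Euc n
  mem : ∀ k, seq k ∈ U
  cauchy : ∀ ε : ENNReal, 0 < ε → ∃ N : ℕ, ∀ j ≥ N, ∀ k ≥ N,
    intrinsicDist U (seq j) (seq k) < ε
  notConv : ¬ ∃ u ∈ U, Tendsto (fun k => intrinsicDist U (seq k) u) atTop (nhds 0)

/-- Two Cauchy sequences represent the same Hausdorff-boundary element iff the
intrinsic distance between corresponding terms tends to `0`. -/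
def HBEquiv {n : ℕ} (U : Set (Euc n)) (s t : HBSeq U) : Prop :=
  Tendsto (fun k => intrinsicDist U (s.seq k) (t.seq k)) atTop (nhds 0)

/-- The Hausdorff boundary of `U`: points of the completion of `(U, ρ_U)` not
corresponding to points of `U`. -/
def HausdorffBoundary {n : ℕ} (U : Set (Euc n)) : Type := Quot (HBEquiv U)

/-- The relative metric on the Hausdorff boundary (the completion metric). -/
def hbDist {n : ℕ} {U : Set (Euc n)} (a b : HausdorffBoundary U) : ENNReal :=
  limsup (fun k => intrinsicDist U ((Quot.out a).seq k) ((Quot.out b).seq k)) atTop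

/-- The support of a Hausdorff-boundary element: the Euclidean limit of a
representing Cauchy sequence. -/
def hbSupport {n : ℕ} {U : Set (Euc n)} (a : HausdorffBoundary U) : Euc n :=
  limUnder atTop (Quot.out a).seq

/-- A (bijective) isometry of Hausdorff boundaries in the relative metrics. -/
def IsHBIsometry {n : ℕ} {U V : Set (Euc n)}
    (f : HausdorffBoundary U → HausdorffBoundary V) : Prop :=
  Function.Bijective f ∧ ∀ a b : HausdorffBoundary U, hbDist (f a) (f b) = hbDist a b

/-- `U` is uniquely determined in the class `𝒰` by the relative metric of its
Hausdorff boundary: any member of `𝒰` with Hausdorff boundary isometric (in the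
relative metrics) to that of `U` is the image of `U` under a Euclidean isometry. -/
def UniquelyDeterminedIn {n : ℕ} (𝒰 : Set (Set (Euc n))) (U : Set (Euc n)) : Prop :=
  ∀ V ∈ 𝒰, (∃ f : HausdorffBoundary U → HausdorffBoundary V, IsHBIsometry f) →
    ∃ J : Euc n ≃ᵢ Euc n, J '' U = V

/-- `]x,y[` is a boundary interval for `U`. -/
def IsBoundaryInterval {n : ℕ} (U : Set (Euc n)) (x y : Euc n) : Prop :=
  x ≠ y ∧ x ∈ frontier U ∧ y ∈ frontier U ∧ openSegment ℝ x y ⊆ U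

/-- The Hausdorff-boundary element `a` is generated by the boundary interval
`]x,y[` at its endpoint `x`: it is represented by a Cauchy sequence of points of
`]x,y[` converging (in the Euclidean metric) to `x`. -/
def GeneratesEndpoint {n : ℕ} (U : Set (Euc n)) (x y : Euc n)
    (a : HausdorffBoundary U) : Prop :=
  ∃ s : HBSeq U, Quot.mk (HBEquiv U) s = a ∧ (∀ k, s.seq k ∈ openSegment ℝ x y) ∧
    Tendsto s.seq atTop (nhds x)

/-- The plane angle `∠(x,y,z) = {y + t(x−y) + s(z−y) : t ≥ 0, s ≥ 0}`. -/
def planeAngle (x y z : Euc 2) : Set (Euc 2) :=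
  {p | ∃ t s : ℝ, 0 ≤ t ∧ 0 ≤ s ∧ p = y + t • (x - y) + s • (z - y)}

/-- The ordered triple `x, y, z` determines a boundary angle for `U`. -/
def IsBoundaryAngle (U : Set (Euc 2)) (x y z : Euc 2) : Prop :=
  ¬ Collinear ℝ ({x, y, z} : Set (Euc 2)) ∧
    x ∈ frontier U ∧ y ∈ frontier U ∧ z ∈ frontier U ∧
    openSegment ℝ x y ⊆ U ∧ openSegment ℝ y z ⊆ U ∧
    ∃ r : ℝ, 0 < r ∧ (Metric.ball y r ∩ planeAngle x y z) \ {y} ⊆ U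

theorem intrinsicDist_le_eVariationOn {n : ℕ} {S : Set (Euc n)} {γ : ℝ → Euc n} {a b : ℝ}
    (hab : a ≤ b) (hγ : ContinuousOn γ (Icc a b)) (hS : MapsTo γ (Icc a b) S) :
    intrinsicDist S (γ a) (γ b) ≤ eVariationOn γ (Icc a b) := by
  set φ : ℝ → ℝ := fun t => a + (b - a) * t with hφ
  have hmaps : MapsTo φ (Icc 0 1) (Icc a b) := by
    rintro t ⟨h0, h1⟩
    constructor <;> simp only [hφ] <;> nlinarith
  have hmono : MonotoneOn φ (Icc 0 1) := by
    intro s _ t _ hst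
    simp only [hφ]
    nlinarith
  refine le_trans ?_ (eVariationOn.comp_le_of_monotoneOn γ φ hmono hmaps)
  refine iInf_le_of_le (γ ∘ φ) (iInf_le_of_le ?_ (iInf_le_of_le ?_ (iInf_le_of_le ?_
    (iInf_le_of_le ?_ le_rfl))))
  · exact hγ.comp (by fun_prop) hmaps
  · simp [hφ]
  · simp [hφ]
  · exact hS.comp hmaps

theorem exists_path_of_intrinsicDist_lt {n : ℕ} {S : Set (Euc n)} {x y : Euc n} {L : ENNReal}
    (h : intrinsicDist S x y < L) :
    ∃ γ : ℝ → Euc n, ContinuousOn γ (Icc (0:ℝ) 1) ∧ γ 0 = x ∧ γ 1 = y ∧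
      MapsTo γ (Icc (0:ℝ) 1) S ∧ eVariationOn γ (Icc (0:ℝ) 1) < L := by
  simp only [intrinsicDist, iInf_lt_iff] at h
  obtain ⟨γ, h1, h2, h3, h4, h5⟩ := h
  exact ⟨γ, h1, h2, h3, h4, h5⟩

theorem edist_le_intrinsicDist {n : ℕ} (S : Set (Euc n)) (x y : Euc n) :
    edist x y ≤ intrinsicDist S x y := by
  simp only [intrinsicDist, le_iInf_iff]
  rintro γ _ rfl rfl _
  exact eVariationOn.edist_le γ (by simp) (by simp)

theorem intrinsicDist_self {n : ℕ} {S : Set (Euc n)} {x : Euc n} (hx : x ∈ S) :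
    intrinsicDist S x x = 0 := by
  have := intrinsicDist_le_eVariationOn (S := S) (γ := fun _ => x) zero_le_one
    continuousOn_const (fun _ _ => hx)
  rw [eVariationOn.constant_on (by
    rintro _ ⟨_, _, rfl⟩ _ ⟨_, _, rfl⟩; rfl)] at this
  exact le_antisymm this bot_le

theorem intrinsicDist_comm_le {n : ℕ} (S : Set (Euc n)) (x y : Euc n) :
    intrinsicDist S x y ≤ intrinsicDist S y x := by
  conv_rhs => rw [intrinsicDist]
  simp only [le_iInf_iff]
  rintro γ hγ rfl rfl hS
  have hmaps : MapsTo (fun t : ℝ => 1 - t) (Icc 0 1) (Icc 0 1) := by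
    rintro t ⟨h0, h1⟩
    constructor <;> simp <;> linarith
  have h := intrinsicDist_le_eVariationOn (S := S) (γ := γ ∘ fun t : ℝ => 1 - t) zero_le_one
    (hγ.comp (by fun_prop) hmaps) (hS.comp hmaps)
  simp only [Function.comp, sub_zero, sub_self] at h
  refine h.trans ?_
  exact eVariationOn.comp_le_of_antitoneOn γ (fun t : ℝ => 1 - t)
    (fun s _ t _ hst => by simp only []; linarith) hmaps

theorem intrinsicDist_comm {n : ℕ} (S : Set (Euc n)) (x y : Euc n) :
    intrinsicDist S x y = intrinsicDist S y x :=
  le_antisymm (intrinsicDist_comm_le S x y) (intrinsicDist_comm_le S y x)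

theorem intrinsicDist_triangle {n : ℕ} (S : Set (Euc n)) (x y z : Euc n) :
    intrinsicDist S x z ≤ intrinsicDist S x y + intrinsicDist S y z := by
  refine le_of_forall_gt_imp_ge_of_dense fun L hL => ?_
  obtain ⟨L1, L2, h1, h2, h12⟩ : ∃ L1 L2, intrinsicDist S x y < L1 ∧
      intrinsicDist S y z < L2 ∧ L1 + L2 ≤ L := by
    have hL' : intrinsicDist S x y + intrinsicDist S y z ≠ ⊤ := (hL.trans_le le_top).ne
    obtain ⟨M, hM1, hM2⟩ := exists_between hL
    have hx : intrinsicDist S x y ≠ ⊤ := fun h => hL' (by simp [h])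
    have hy : intrinsicDist S y z ≠ ⊤ := fun h => hL' (by simp [h])
    obtain ⟨ε, hε, hε'⟩ := ENNReal.lt_iff_exists_add_pos_lt.1 hL
    have hε2 : (0 : ENNReal) < ε / 2 := ENNReal.half_pos (by simpa using hε.ne')
    refine ⟨_, _, ENNReal.lt_add_right hx hε2.ne', ENNReal.lt_add_right hy hε2.ne', ?_⟩
    calc _ = intrinsicDist S x y + intrinsicDist S y z + ((ε : ENNReal) / 2 + ε / 2) := by ring
      _ = intrinsicDist S x y + intrinsicDist S y z + ε := by rw [ENNReal.add_halves]
      _ ≤ L := hε'.le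
  obtain ⟨γ, hγ, rfl, rfl, hS, hl⟩ := exists_path_of_intrinsicDist_lt h1
  obtain ⟨δ, hδ, hδ0, rfl, hT, hm⟩ := exists_path_of_intrinsicDist_lt h2
  set c : ℝ → Euc n := fun t => if t ≤ 1 then γ t else δ (t - 1) with hc
  have hmaps : MapsTo (fun t : ℝ => t - 1) (Icc 1 2) (Icc 0 1) := by
    rintro t ⟨h0, h1⟩
    constructor <;> simp only [] <;> linarith
  have e1 : EqOn c γ (Icc 0 1) := fun t ht => by simp [hc, ht.2]
  have e2 : EqOn c (δ ∘ fun t => t - 1) (Icc 1 2) := fun t ht => by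
    rcases eq_or_lt_of_le ht.1 with h | h
    · simp [hc, ← h, hδ0]
    · simp [hc, not_le.2 h]
  have c1 : ContinuousOn c (Icc 0 1) := hγ.congr e1
  have c2 : ContinuousOn c (Icc 1 2) := (hδ.comp (by fun_prop) hmaps).congr e2
  have hun : Icc (0:ℝ) 1 ∪ Icc 1 2 = Icc 0 2 := Icc_union_Icc_eq_Icc (by norm_num) (by norm_num)
  have c3 : ContinuousOn c (Icc 0 2) := by
    rw [← hun]; exact c1.union_of_isClosed c2 isClosed_Icc isClosed_Icc
  have m3 : MapsTo c (Icc 0 2) S := by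
    rw [← hun]
    refine MapsTo.union (hS.congr e1.symm) ((hT.comp hmaps).congr e2.symm)
  have := intrinsicDist_le_eVariationOn (by norm_num : (0:ℝ) ≤ 2) c3 m3
  have hv : eVariationOn c (Icc 0 2) ≤ eVariationOn γ (Icc 0 1) + eVariationOn δ (Icc 0 1) := by
    rw [← hun, eVariationOn.union (x := 1) c (isGreatest_Icc (by norm_num)) (isLeast_Icc (by norm_num)),
      eVariationOn.congr e1, eVariationOn.congr e2]
    gcongr
    exact eVariationOn.comp_le_of_monotoneOn δ _ (fun s _ t _ hst => sub_le_sub_right hst 1) hmaps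
  have h0 : c 0 = γ 0 := by simp [hc]
  have h2' : c 2 = δ 1 := by norm_num [hc]
  rw [h0, h2'] at this
  exact (this.trans (hv.trans (add_le_add hl.le hm.le))).trans h12

theorem intrinsicDist_le_edist {n : ℕ} {S : Set (Euc n)} {x y : Euc n}
    (h : segment ℝ x y ⊆ S) : intrinsicDist S x y ≤ edist x y := by
  have hseg : MapsTo (AffineMap.lineMap x y : ℝ → Euc n) (Icc (0:ℝ) 1) S := fun t ht =>
    h (by rw [segment_eq_image_lineMap]; exact ⟨t, ht, rfl⟩)
  have := intrinsicDist_le_eVariationOn zero_le_one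
    (AffineMap.lineMap_continuous (R := ℝ) (p := x) (q := y)).continuousOn hseg
  rw [AffineMap.lineMap_apply_zero, AffineMap.lineMap_apply_one] at this
  refine this.trans ?_
  have hl : LipschitzOnWith (nndist x y) (AffineMap.lineMap x y : ℝ → Euc n) univ :=
    (lipschitzWith_lineMap x y).lipschitzOnWith
  have h1 := hl.comp_eVariationOn_le (g := (id : ℝ → ℝ)) (s := Icc (0:ℝ) 1) (fun _ _ => mem_univ _)
  have h2 : eVariationOn (id : ℝ → ℝ) (Icc 0 1) ≤ 1 := by
    have := (monotone_id (α := ℝ)).monotoneOn (Icc (0:ℝ) 1) |>.eVariationOn_eq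
      (a := 0) (b := 1) (by simp) (by simp)
    rw [inter_self] at this
    simp [this]
  calc _ ≤ (nndist x y : ENNReal) * eVariationOn id (Icc (0:ℝ) 1) := h1
    _ ≤ nndist x y * 1 := by gcongr
    _ = edist x y := by rw [mul_one, edist_nndist]

theorem intrinsicDist_lt_top {n : ℕ} {U : Set (Euc n)} (hU : IsEucDomain U) {x y : Euc n}
    (hx : x ∈ U) (hy : y ∈ U) : intrinsicDist U x y < ⊤ := by
  set A := {z | z ∈ U ∧ intrinsicDist U x z < ⊤} with hA
  have key : ∀ z ∈ U, ∃ r > 0, ball z r ⊆ U ∧ ∀ w ∈ ball z r,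
      intrinsicDist U z w < ⊤ := by
    intro z hz
    obtain ⟨r, hr, hb⟩ := Metric.isOpen_iff.1 hU.1 z hz
    refine ⟨r, hr, hb, fun w hw => ?_⟩
    exact (intrinsicDist_le_edist (((convex_ball z r).segment_subset
      (mem_ball_self hr) hw).trans hb)).trans_lt (edist_lt_top _ _)
  have hAo : IsOpen A := by
    rw [Metric.isOpen_iff]
    rintro z ⟨hz, hz'⟩
    obtain ⟨r, hr, hb, h⟩ := key z hz
    exact ⟨r, hr, fun w hw => ⟨hb hw, (intrinsicDist_triangle U x z w).trans_lt
      (ENNReal.add_lt_top.2 ⟨hz', h w hw⟩)⟩⟩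
  have hBo : IsOpen (U \ A) := by
    rw [Metric.isOpen_iff]
    rintro z ⟨hz, hz'⟩
    obtain ⟨r, hr, hb, h⟩ := key z hz
    refine ⟨r, hr, fun w hw => ⟨hb hw, fun hw' => hz' ⟨hz, ?_⟩⟩⟩
    refine (intrinsicDist_triangle U x w z).trans_lt (ENNReal.add_lt_top.2 ⟨hw'.2, ?_⟩)
    rw [intrinsicDist_comm]
    exact h w hw
  by_contra hcon
  have := hU.2.isPreconnected A (U \ A) hAo hBo
    (fun z hz => by by_cases h : z ∈ A; exacts [Or.inl h, Or.inr ⟨hz, h⟩])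
    ⟨x, hx, hx, by rw [intrinsicDist_self hx]; simp⟩ ⟨y, hy, hy, fun h => hcon h.2⟩
  obtain ⟨w, _, h1, h2⟩ := this
  exact h2.2 h1

/-- A domain together with the completion of its intrinsic metric. -/
structure Dom (X : Type) [MetricSpace X] where
  U : Set (Euc 2)
  isOpen : IsOpen U
  p : X → Euc 2
  pt : Euc 2 → X
  p_pt : ∀ P ∈ U, p (pt P) = P
  p_lip : ∀ a b, dist (p a) (p b) ≤ dist a b
  pt_seg : ∀ P Q, segment ℝ P Q ⊆ U → dist (pt P) (pt Q) ≤ dist P Q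
  path : ∀ P ∈ U, ∀ Q ∈ U, ∀ L, dist (pt P) (pt Q) < L → ∃ γ : ℝ → Euc 2,
    ContinuousOn γ (Icc 0 1) ∧ γ 0 = P ∧ γ 1 = Q ∧ ∀ t ∈ Icc (0:ℝ) 1, γ t ∈ U ∧
      dist (pt P) (pt (γ t)) + dist (pt (γ t)) (pt Q) < L
  dense : ∀ a, ∀ ε > 0, ∃ P ∈ U, dist a (pt P) < ε

/-- The points of `U` with the intrinsic metric. -/
def IPt {n : ℕ} (U : Set (Euc n)) (_ : IsEucDomain U) : Type := U

instance {n : ℕ} (U : Set (Euc n)) (hU : IsEucDomain U) : MetricSpace (IPt U hU) where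
  dist a b := (intrinsicDist U a.1 b.1).toReal
  dist_self a := by simp [intrinsicDist_self a.2]
  dist_comm a b := by rw [intrinsicDist_comm]
  dist_triangle a b c := by
    rw [← ENNReal.toReal_add (intrinsicDist_lt_top hU a.2 b.2).ne
      (intrinsicDist_lt_top hU b.2 c.2).ne]
    exact ENNReal.toReal_mono (ENNReal.add_lt_top.2 ⟨intrinsicDist_lt_top hU a.2 b.2,
      intrinsicDist_lt_top hU b.2 c.2⟩).ne (intrinsicDist_triangle U _ _ _)
  eq_of_dist_eq_zero {a b} h := by
    have h1 : intrinsicDist U a.1 b.1 = 0 :=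
      ((ENNReal.toReal_eq_zero_iff _).1 h).resolve_right (intrinsicDist_lt_top hU a.2 b.2).ne
    have h2 := edist_le_intrinsicDist U a.1 b.1
    rw [h1] at h2
    exact Subtype.ext (edist_le_zero.1 h2)

/-- A point of `U` as a point of the intrinsic metric space. -/
def IPt.mk {n : ℕ} {U : Set (Euc n)} (hU : IsEucDomain U) (P : Euc n) (h : P ∈ U) : IPt U hU :=
  ⟨P, h⟩

/-- The completion of `U` in the intrinsic metric. -/
abbrev IComp {n : ℕ} (U : Set (Euc n)) (hU : IsEucDomain U) : Type :=
  UniformSpace.Completion (IPt U hU)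

def toComp {n : ℕ} {U : Set (Euc n)} (hU : IsEucDomain U) (P : Euc n) : IComp U hU :=
  open Classical in
  if h : P ∈ U then (IPt.mk hU P h : IComp U hU)
  else (IPt.mk hU hU.2.nonempty.choose hU.2.nonempty.choose_spec : IComp U hU)

theorem toComp_of_mem {n : ℕ} {U : Set (Euc n)} (hU : IsEucDomain U) {P : Euc n} (h : P ∈ U) :
    toComp hU P = (IPt.mk hU P h : IComp U hU) := dif_pos h

theorem dist_toComp {n : ℕ} {U : Set (Euc n)} (hU : IsEucDomain U) {P Q : Euc n} (h : P ∈ U)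
    (h' : Q ∈ U) : dist (toComp hU P) (toComp hU Q) = (intrinsicDist U P Q).toReal := by
  rw [toComp_of_mem hU h, toComp_of_mem hU h', UniformSpace.Completion.dist_eq]
  rfl

theorem edist_toComp {n : ℕ} {U : Set (Euc n)} (hU : IsEucDomain U) {P Q : Euc n} (h : P ∈ U)
    (h' : Q ∈ U) : edist (toComp hU P) (toComp hU Q) = intrinsicDist U P Q := by
  rw [edist_dist, dist_toComp hU h h', ENNReal.ofReal_toReal (intrinsicDist_lt_top hU h h').ne]

def compSupport {n : ℕ} {U : Set (Euc n)} (hU : IsEucDomain U) : IComp U hU → Euc n :=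
  UniformSpace.Completion.extension (fun a : IPt U hU => (a.1 : Euc n))

theorem lipschitzWith_val {n : ℕ} {U : Set (Euc n)} (hU : IsEucDomain U) :
    LipschitzWith 1 (fun a : IPt U hU => (a.1 : Euc n)) := by
  refine LipschitzWith.of_dist_le_mul fun a b => ?_
  simp only [NNReal.coe_one, one_mul]
  change dist a.1 b.1 ≤ (intrinsicDist U a.1 b.1).toReal
  rw [dist_edist]
  exact ENNReal.toReal_mono (intrinsicDist_lt_top hU a.2 b.2).ne (edist_le_intrinsicDist U _ _)

def domOf {U : Set (Euc 2)} (hU : IsEucDomain U) : Dom (IComp U hU) where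
  U := U
  isOpen := hU.1
  p := compSupport hU
  pt := toComp hU
  p_pt P hP := by
    rw [toComp_of_mem hU hP, compSupport,
      UniformSpace.Completion.extension_coe (lipschitzWith_val hU).uniformContinuous]
    rfl
  p_lip a b := by
    have := (lipschitzWith_val hU).completion_extension.dist_le_mul a b
    simpa [compSupport] using this
  pt_seg P Q h := by
    have hP := h (left_mem_segment ℝ P Q)
    have hQ := h (right_mem_segment ℝ P Q)
    rw [dist_toComp hU hP hQ, dist_edist]
    exact ENNReal.toReal_mono (edist_ne_top _ _) (intrinsicDist_le_edist h)
  path P hP Q hQ L hL := by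
    rw [dist_toComp hU hP hQ] at hL
    have hL' : intrinsicDist U P Q < ENNReal.ofReal L :=
      (ENNReal.lt_ofReal_iff_toReal_lt (intrinsicDist_lt_top hU hP hQ).ne).2 hL
    obtain ⟨γ, hγ, rfl, rfl, hS, hl⟩ := exists_path_of_intrinsicDist_lt hL'
    refine ⟨γ, hγ, rfl, rfl, fun t ht => ⟨hS ht, ?_⟩⟩
    rw [dist_toComp hU hP (hS ht), dist_toComp hU (hS ht) hQ,
      ← ENNReal.toReal_add (intrinsicDist_lt_top hU hP (hS ht)).ne
      (intrinsicDist_lt_top hU (hS ht) hQ).ne]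
    refine (ENNReal.lt_ofReal_iff_toReal_lt (ENNReal.add_lt_top.2
      ⟨intrinsicDist_lt_top hU hP (hS ht), intrinsicDist_lt_top hU (hS ht) hQ⟩).ne).1 ?_
    refine lt_of_le_of_lt ?_ hl
    have s1 : Icc (0:ℝ) t ⊆ Icc 0 1 := Icc_subset_Icc le_rfl ht.2
    have s2 : Icc t 1 ⊆ Icc (0:ℝ) 1 := Icc_subset_Icc ht.1 le_rfl
    have hu : Icc (0:ℝ) 1 = Icc 0 t ∪ Icc t 1 := (Icc_union_Icc_eq_Icc ht.1 ht.2).symm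
    rw [hu, eVariationOn.union (x := t) γ (isGreatest_Icc ht.1) (isLeast_Icc ht.2)]
    exact add_le_add (intrinsicDist_le_eVariationOn ht.1 (hγ.mono s1) (hS.mono_left s1))
      (intrinsicDist_le_eVariationOn ht.2 (hγ.mono s2) (hS.mono_left s2))
  dense a ε hε := by
    obtain ⟨P, h1⟩ := (UniformSpace.Completion.denseRange_coe (α := IPt U hU)).exists_mem_open
      isOpen_ball ⟨a, mem_ball_self hε⟩
    refine ⟨P.1, P.2, ?_⟩
    rw [toComp_of_mem hU P.2, dist_comm]
    exact h1

section Dom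
variable {X : Type} [MetricSpace X] (A : Dom X)

theorem Dom.eq_pt {a : X} (h : A.p a ∈ A.U) : a = A.pt (A.p a) := by
  obtain ⟨r, hr, hb⟩ := Metric.isOpen_iff.1 A.isOpen _ h
  refine dist_le_zero.1 (le_of_forall_pos_le_add fun ε hε => ?_)
  obtain ⟨P, hP, hd⟩ := A.dense a (min r (ε / 2)) (by positivity)
  have h1 : dist (A.p a) P < min r (ε / 2) := by
    have := A.p_lip a (A.pt P)
    rw [A.p_pt P hP] at this
    exact this.trans_lt hd
  have h2 : dist (A.pt P) (A.pt (A.p a)) ≤ dist P (A.p a) := A.pt_seg _ _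
    (((convex_ball _ r).segment_subset (by rw [mem_ball, dist_comm]; exact h1.trans_le (min_le_left _ _))
      (mem_ball_self hr)).trans hb)
  have h3 := dist_triangle a (A.pt P) (A.pt (A.p a))
  rw [dist_comm P] at h2
  have := min_le_right r (ε / 2)
  linarith

/-- The boundary points of the completion. -/
def Dom.Bd : Set X := {a | A.p a ∉ A.U}

end Dom

section Link
variable {U : Set (Euc 2)} (hU : IsEucDomain U)

theorem HBSeq.cauchySeq (s : HBSeq U) : CauchySeq fun k => toComp hU (s.seq k) := by
  refine EMetric.cauchySeq_iff.2 fun ε hε => ?_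
  obtain ⟨N, hN⟩ := s.cauchy ε hε
  refine ⟨N, fun j hj k hk => ?_⟩
  rw [edist_toComp hU (s.mem _) (s.mem _)]
  exact hN j hj k hk

/-- The limit of a representing sequence in the completion. -/
def HBSeq.lim (s : HBSeq U) : IComp U hU :=
  (cauchySeq_tendsto_of_complete (s.cauchySeq hU)).choose

theorem HBSeq.tendsto_lim (s : HBSeq U) :
    Tendsto (fun k => toComp hU (s.seq k)) atTop (nhds (s.lim hU)) :=
  (cauchySeq_tendsto_of_complete (s.cauchySeq hU)).choose_spec

theorem HBSeq.tendsto_intrinsicDist (s t : HBSeq U) :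
    Tendsto (fun k => intrinsicDist U (s.seq k) (t.seq k)) atTop
      (nhds (edist (s.lim hU) (t.lim hU))) := by
  refine ((s.tendsto_lim hU).edist (t.tendsto_lim hU)).congr fun k => ?_
  rw [edist_toComp hU (s.mem _) (t.mem _)]

theorem hbEquiv_iff (s t : HBSeq U) : HBEquiv U s t ↔ s.lim hU = t.lim hU := by
  have h := HBSeq.tendsto_intrinsicDist hU s t
  constructor
  · intro h'
    exact edist_eq_zero.1 (tendsto_nhds_unique h h')
  · intro h'
    rw [h', edist_self] at h
    exact h

/-- The embedding of the Hausdorff boundary in the completion. -/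
def hbComp : HausdorffBoundary U → IComp U hU :=
  Quot.lift (HBSeq.lim hU) fun _ _ h => (hbEquiv_iff hU _ _).1 h

theorem hbComp_out (a : HausdorffBoundary U) : (Quot.out a).lim hU = hbComp hU a := by
  exact congrArg (hbComp hU) (Quot.out_eq a)

theorem hbComp_injective : Function.Injective (hbComp hU) := by
  intro a b
  induction a using Quot.ind with | _ s =>
  induction b using Quot.ind with | _ t =>
  intro h
  exact Quot.sound ((hbEquiv_iff hU _ _).2 h)

theorem hbDist_eq (a b : HausdorffBoundary U) : hbDist a b = edist (hbComp hU a) (hbComp hU b) := by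
  rw [← hbComp_out, ← hbComp_out]
  exact (HBSeq.tendsto_intrinsicDist hU _ _).limsup_eq

theorem HBSeq.tendsto_seq (s : HBSeq U) :
    Tendsto s.seq atTop (nhds ((domOf hU).p (s.lim hU))) := by
  have hc : Continuous (domOf hU).p :=
    (LipschitzWith.of_dist_le_mul (K := 1) (by simpa using (domOf hU).p_lip)).continuous
  refine ((hc.tendsto _).comp (s.tendsto_lim hU)).congr fun k => ?_
  exact (domOf hU).p_pt _ (s.mem k)

theorem hbSupport_eq (a : HausdorffBoundary U) : hbSupport a = (domOf hU).p (hbComp hU a) := by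
  rw [← hbComp_out]
  exact (HBSeq.tendsto_seq hU _).limUnder_eq

theorem HBSeq.lim_mem (s : HBSeq U) : s.lim hU ∈ (domOf hU).Bd := by
  intro h
  have h1 := (domOf hU).eq_pt h
  refine s.notConv ⟨_, h, ?_⟩
  have h2 := s.tendsto_lim hU
  have h3 := h2.edist (tendsto_const_nhds (x := s.lim hU))
  rw [edist_self] at h3
  refine h3.congr fun k => ?_
  exact (congrArg (edist _) h1).trans (edist_toComp hU (s.mem _) h)

theorem hbComp_mem (a : HausdorffBoundary U) : hbComp hU a ∈ (domOf hU).Bd := by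
  rw [← hbComp_out]
  exact HBSeq.lim_mem hU _

theorem exists_hbComp {a : IComp U hU} (ha : a ∈ (domOf hU).Bd) : ∃ b, hbComp hU b = a := by
  choose P hP hd using fun k : ℕ => (domOf hU).dense a (1 / (k + 1)) (by positivity)
  have ht : Tendsto (fun k => toComp hU (P k)) atTop (nhds a) := by
    rw [tendsto_iff_dist_tendsto_zero]
    refine squeeze_zero (fun _ => dist_nonneg) (fun k => ?_) tendsto_one_div_add_atTop_nhds_zero_nat
    rw [dist_comm]
    exact (hd k).le
  have hcau := ht.cauchySeq
  let s : HBSeq U :=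
    { seq := P
      mem := hP
      cauchy := by
        intro ε hε
        obtain ⟨N, hN⟩ := EMetric.cauchySeq_iff.1 hcau ε hε
        refine ⟨N, fun j hj k hk => ?_⟩
        rw [← edist_toComp hU (hP _) (hP _)]
        exact hN j hj k hk
      notConv := by
        rintro ⟨u, hu, hlim⟩
        have h1 : Tendsto (fun k => toComp hU (P k)) atTop (nhds (toComp hU u)) := by
          rw [tendsto_iff_edist_tendsto_0]
          refine hlim.congr fun k => ?_
          rw [edist_toComp hU (hP _) hu]
        have h2 := tendsto_nhds_unique ht h1
        apply ha
        have h3 : (domOf hU).p (toComp hU u) = u := (domOf hU).p_pt u hu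
        change (domOf hU).p a ∈ U
        rw [h2, h3]
        exact hu }
  exact ⟨Quot.mk _ s, tendsto_nhds_unique (s.tendsto_lim hU) ht⟩

theorem GeneratesEndpoint.dist_eq {x y : Euc 2} {a : HausdorffBoundary U}
    (h : GeneratesEndpoint U x y a) (hxy : openSegment ℝ x y ⊆ U) {P : Euc 2}
    (hP : P ∈ openSegment ℝ x y) : dist (hbComp hU a) (toComp hU P) = dist x P := by
  obtain ⟨s, rfl, hs, hlim⟩ := h
  have h1 := (s.tendsto_lim hU).dist (tendsto_const_nhds (x := toComp hU P))
  have h2 := hlim.dist (tendsto_const_nhds (x := P))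
  refine tendsto_nhds_unique h1 (h2.congr fun k => ?_)
  have hseg : segment ℝ (s.seq k) P ⊆ U :=
    ((convex_openSegment x y).segment_subset (hs k) hP).trans hxy
  refine le_antisymm ?_ ((domOf hU).pt_seg _ _ hseg)
  have := (domOf hU).p_lip (toComp hU (s.seq k)) (toComp hU P)
  rwa [show (domOf hU).p (toComp hU (s.seq k)) = s.seq k from (domOf hU).p_pt _ (s.mem k),
    show (domOf hU).p (toComp hU P) = P from (domOf hU).p_pt _ (hxy hP)] at this

theorem GeneratesEndpoint.support_eq {x y : Euc 2} {a : HausdorffBoundary U}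
    (h : GeneratesEndpoint U x y a) : (domOf hU).p (hbComp hU a) = x := by
  obtain ⟨s, rfl, hs, hlim⟩ := h
  exact tendsto_nhds_unique (s.tendsto_seq hU) hlim

end Link

/-- The point of the line through `P` and `w` with parameter `s`. -/
abbrev lin (P w : Euc 2) (s : ℝ) : Euc 2 := AffineMap.lineMap P w s

namespace Dom
variable {X : Type} [MetricSpace X] (A : Dom X)

theorem continuous_p : Continuous A.p :=
  (LipschitzWith.of_dist_le_mul (K := 1) (by simpa using A.p_lip)).continuous

theorem dist_p_le {a : X} {P : Euc 2} (hP : P ∈ A.U) : dist (A.p a) P ≤ dist a (A.pt P) := by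
  simpa [A.p_pt P hP] using A.p_lip a (A.pt P)

theorem dist_le_pt {P Q : Euc 2} (hP : P ∈ A.U) (hQ : Q ∈ A.U) :
    dist P Q ≤ dist (A.pt P) (A.pt Q) := by
  simpa [A.p_pt P hP] using A.dist_p_le (a := A.pt P) hQ

theorem dist_pt {P Q : Euc 2} (h : segment ℝ P Q ⊆ A.U) : dist (A.pt P) (A.pt Q) = dist P Q :=
  le_antisymm (A.pt_seg P Q h) (A.dist_le_pt (h (left_mem_segment _ _ _)) (h (right_mem_segment _ _ _)))

theorem continuousOn_pt : ContinuousOn A.pt A.U := by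
  intro P hP
  obtain ⟨r, hr, hb⟩ := Metric.isOpen_iff.1 A.isOpen P hP
  refine ContinuousAt.continuousWithinAt ?_
  rw [Metric.continuousAt_iff]
  intro ε hε
  refine ⟨min r ε, by positivity, fun Q hQ => ?_⟩
  have hQr : Q ∈ ball P r := hQ.trans_le (min_le_left _ _)
  exact (A.pt_seg _ _ (((convex_ball P r).segment_subset hQr (mem_ball_self hr)).trans hb)).trans_lt
    (hQ.trans_le (min_le_right _ _))

/-- A nearly shortest path from `a` to `b` meets every hypersurface separating them. -/
theorem exists_crossing {a b : X} {φ : X → ℝ} (hφ : Continuous φ) (ha : φ a < 0) (hb : 0 < φ b)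
    {L : ℝ} (hL : dist a b < L) :
    ∃ q ∈ A.U, φ (A.pt q) = 0 ∧ dist a (A.pt q) + dist (A.pt q) b < L := by
  set ε := (L - dist a b) / 5 with hε
  have hε0 : 0 < ε := by rw [hε]; linarith
  obtain ⟨r1, hr1, h1⟩ := Metric.isOpen_iff.1 (isOpen_lt hφ continuous_const) a ha
  obtain ⟨r2, hr2, h2⟩ := Metric.isOpen_iff.1 (isOpen_lt continuous_const hφ) b hb
  obtain ⟨P, hP, hPd⟩ := A.dense a (min r1 ε) (by positivity)
  obtain ⟨Q, hQ, hQd⟩ := A.dense b (min r2 ε) (by positivity)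
  have hφP : φ (A.pt P) < 0 := h1 (by rw [mem_ball, dist_comm]; exact hPd.trans_le (min_le_left _ _))
  have hφQ : 0 < φ (A.pt Q) := h2 (by rw [mem_ball, dist_comm]; exact hQd.trans_le (min_le_left _ _))
  have hP' := hPd.trans_le (min_le_right _ _)
  have hQ' := hQd.trans_le (min_le_right _ _)
  have hPQ : dist (A.pt P) (A.pt Q) < L - 2 * ε := by
    have := dist_triangle4 (A.pt P) a b (A.pt Q)
    rw [dist_comm _ a] at this
    linarith
  obtain ⟨γ, hγ, rfl, rfl, h⟩ := A.path P hP Q hQ _ hPQ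
  have hc : ContinuousOn (fun t => φ (A.pt (γ t))) (Icc (0:ℝ) 1) :=
    hφ.comp_continuousOn (A.continuousOn_pt.comp hγ fun t ht => (h t ht).1)
  obtain ⟨t, ht, hφt⟩ := intermediate_value_Icc zero_le_one hc
    (show (0:ℝ) ∈ Icc _ _ from ⟨hφP.le, hφQ.le⟩)
  refine ⟨γ t, (h t ht).1, hφt, ?_⟩
  have := (h t ht).2
  have t1 := dist_triangle a (A.pt (γ 0)) (A.pt (γ t))
  have t2 := dist_triangle (A.pt (γ t)) (A.pt (γ 1)) b
  rw [dist_comm (A.pt (γ 1)) b] at t2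
  linarith

/-- The elements `a`, `b` are joined by a boundary interval. -/
def Sees (a b : X) : Prop :=
  A.p a ≠ A.p b ∧ ∀ R ∈ openSegment ℝ (A.p a) (A.p b),
    R ∈ A.U ∧ dist a (A.pt R) = dist (A.p a) R ∧ dist b (A.pt R) = dist (A.p b) R

variable {A}

theorem Sees.symm {a b : X} (h : A.Sees a b) : A.Sees b a :=
  ⟨h.1.symm, fun R hR => by
    rw [openSegment_symm] at hR
    obtain ⟨h1, h2, h3⟩ := h.2 R hR
    exact ⟨h1, h3, h2⟩⟩

theorem _root_.midpoint_mem_openSegment' (P Q : Euc 2) : midpoint ℝ P Q ∈ openSegment ℝ P Q := by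
  rw [openSegment_eq_image_lineMap]
  exact ⟨1/2, by constructor <;> norm_num, by simp [midpoint]⟩

theorem Sees.dist_eq {a b : X} (h : A.Sees a b) : dist a b = dist (A.p a) (A.p b) := by
  refine le_antisymm ?_ (A.p_lip a b)
  obtain ⟨_, h2, h3⟩ := h.2 _ (midpoint_mem_openSegment' _ _)
  have h4 := dist_triangle a (A.pt (midpoint ℝ (A.p a) (A.p b))) b
  rw [dist_comm (A.pt _) b, h2, h3] at h4
  simp only [dist_left_midpoint, dist_right_midpoint, Real.norm_ofNat] at h4
  linarith

theorem dist_lineMap_nonneg {E : Type*} [NormedAddCommGroup E] [NormedSpace ℝ E] (P w : E)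
    {s t : ℝ} (h : s ≤ t) :
    dist (AffineMap.lineMap P w t) (AffineMap.lineMap P w s) = (t - s) * dist P w := by
  rw [dist_lineMap_lineMap, Real.dist_eq, abs_of_nonneg (by linarith)]

theorem segment_lineMap (P w : Euc 2) {s t : ℝ} {R : Euc 2} (hst : s ≤ t)
    (h : R ∈ segment ℝ (lin P w s) (lin P w t)) :
    ∃ σ ∈ Icc s t, R = lin P w σ := by
  rw [segment_eq_image_lineMap] at h
  obtain ⟨τ, hτ, rfl⟩ := h
  refine ⟨s + τ * (t - s), ⟨?_, ?_⟩, ?_⟩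
  · nlinarith [hτ.1]
  · nlinarith [hτ.2]
  · simp only [lin, AffineMap.lineMap_apply_module']
    module

variable (A) in
/-- A segment inside the domain that ends outside it determines an element at its end. -/
theorem exists_end [CompleteSpace X] {P w : Euc 2} {s : ℝ} (hs : 0 < s)
    (h : ∀ σ ∈ Ico 0 s, lin P w σ ∈ A.U)
    (hw : lin P w s ∉ A.U) :
    ∃ u ∈ A.Bd, A.p u = lin P w s ∧
      ∀ σ ∈ Ico 0 s, dist u (A.pt (lin P w σ)) = (s - σ) * dist P w := by
  set g : ℝ → Euc 2 := lin P w with hg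
  have hd : ∀ σ ∈ Ico 0 s, ∀ τ ∈ Ico 0 s, dist (A.pt (g σ)) (A.pt (g τ)) = |σ - τ| * dist P w := by
    intro σ hσ τ hτ
    rw [A.dist_pt, hg, dist_lineMap_lineMap, Real.dist_eq]
    intro R hR
    rcases le_total σ τ with hle | hle
    · obtain ⟨ρ, hρ, rfl⟩ := segment_lineMap P w hle hR
      exact h ρ ⟨hσ.1.trans hρ.1, hρ.2.trans_lt hτ.2⟩
    · rw [segment_symm] at hR
      obtain ⟨ρ, hρ, rfl⟩ := segment_lineMap P w hle hR
      exact h ρ ⟨hτ.1.trans hρ.1, hρ.2.trans_lt hσ.2⟩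
  set σk : ℕ → ℝ := fun k => s - s * (1 / ((k:ℝ) + 1)) with hσk
  have hlim0 : Tendsto σk atTop (nhds s) := by
    have := (tendsto_one_div_add_atTop_nhds_zero_nat (𝕜 := ℝ)).const_mul s
    have := this.const_sub s
    simpa [hσk] using this
  have hmem : ∀ k, σk k ∈ Ico 0 s := by
    intro k
    have h1 : 0 < 1 / ((k:ℝ) + 1) := by positivity
    have h2 : 1 / ((k:ℝ) + 1) ≤ 1 := by
      rw [div_le_one (by positivity)]; linarith [(Nat.cast_nonneg k : (0:ℝ) ≤ k)]
    constructor <;> simp only [hσk] <;> nlinarith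
  have hcs : CauchySeq fun k => A.pt (g (σk k)) := by
    refine Metric.cauchySeq_iff'.2 fun ε hε => ?_
    have hM : 0 < dist P w + 1 := by positivity
    obtain ⟨N, hN⟩ := Metric.cauchySeq_iff'.1 hlim0.cauchySeq (ε / (dist P w + 1)) (by positivity)
    refine ⟨N, fun k hk => ?_⟩
    rw [hd _ (hmem k) _ (hmem N), ← Real.dist_eq]
    have := hN k hk
    rw [lt_div_iff₀ hM] at this
    nlinarith [dist_nonneg (x := σk k) (y := σk N)]
  obtain ⟨u, hu⟩ := cauchySeq_tendsto_of_complete hcs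
  have hpu : A.p u = g s := by
    refine tendsto_nhds_unique ((A.continuous_p.tendsto u).comp hu) ?_
    have hgc : Continuous g := AffineMap.lineMap_continuous
    exact ((hgc.tendsto s).comp hlim0).congr fun k => (A.p_pt _ (h _ (hmem k))).symm
  refine ⟨u, by change A.p u ∉ A.U; rwa [hpu], hpu, fun σ hσ => ?_⟩
  refine tendsto_nhds_unique (hu.dist tendsto_const_nhds) ?_
  have h1 : Tendsto (fun k => |σk k - σ| * dist P w) atTop (nhds (|s - σ| * dist P w)) :=
    ((hlim0.sub_const σ).abs).mul_const _
  rw [abs_of_pos (by linarith [hσ.2])] at h1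
  exact h1.congr fun k => (hd _ (hmem k) _ hσ).symm

variable (A) in
theorem exists_first_exit [CompleteSpace X] {P w : Euc 2} (hP : P ∈ A.U) (hw : w ∉ A.U) :
    ∃ u ∈ A.Bd, ∃ s ∈ Ioc (0:ℝ) 1, A.p u = lin P w s ∧
      ∀ σ ∈ Ico 0 s, lin P w σ ∈ A.U ∧
        dist u (A.pt (lin P w σ)) = (s - σ) * dist P w := by
  set g : ℝ → Euc 2 := lin P w with hg
  have hgc : Continuous g := AffineMap.lineMap_continuous
  set S := {t | t ∈ Icc (0:ℝ) 1 ∧ g t ∉ A.U} with hS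
  have hcl : IsCompact S := by
    refine isCompact_Icc.inter_right (s := Icc (0:ℝ) 1) (t := {t | g t ∉ A.U}) ?_
    exact (A.isOpen.preimage hgc).isClosed_compl
  have hne : S.Nonempty := ⟨1, ⟨by simp, by simpa [hg] using hw⟩⟩
  have hin := hcl.sInf_mem hne
  have h0 : 0 < sInf S := lt_of_le_of_ne hin.1.1 fun h => hin.2 (by rw [← h]; simpa [hg] using hP)
  have hU : ∀ σ ∈ Ico 0 (sInf S), g σ ∈ A.U := by
    intro σ hσ
    by_contra hc
    have : sInf S ≤ σ := csInf_le hcl.bddBelow ⟨⟨hσ.1, hσ.2.le.trans hin.1.2⟩, hc⟩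
    linarith [hσ.2]
  obtain ⟨u, hu, hpu, hd⟩ := A.exists_end h0 hU hin.2
  exact ⟨u, hu, _, ⟨h0, hin.1.2⟩, hpu, fun σ hσ => ⟨hU σ hσ, hd σ hσ⟩⟩

end Dom

namespace Dom
variable {X : Type} [MetricSpace X] {A : Dom X}

variable (A) in
theorem dist_sphere_le {c : X} (hc : c ∈ A.Bd) {w e : Euc 2} {r : ℝ} (hr : 0 < r)
    (hb : closedBall w r ⊆ A.U) (he : ‖e‖ = r)
    (h : dist c (A.pt (w - e)) = dist c (A.pt w) + r) :
    dist c (A.pt (w + e)) ≤ dist c (A.pt w) - r := by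
  have hw : w ∈ A.U := hb (mem_closedBall_self hr.le)
  have key : ∀ ε, 0 < ε → dist c (A.pt (w + e)) ≤ dist c (A.pt w) - r + (ε + √(4 * r * ε)) := by
    intro ε hε
    have hcw : r < dist (A.p c) w := by
      by_contra! h'
      exact hc (hb h')
    obtain ⟨q, hq, hφ, hd⟩ := A.exists_crossing (a := c) (b := A.pt w)
      (φ := fun x => r - dist (A.p x) w) (by have := A.continuous_p; fun_prop) (by simp; exact hcw)
      (by simp [A.p_pt w hw, hr]) (L := dist c (A.pt w) + ε) (by linarith)
    rw [A.p_pt q hq] at hφ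
    have hqw : dist q w = r := by linarith
    have seg : ∀ P ∈ closedBall w r, ∀ Q ∈ closedBall w r, dist (A.pt P) (A.pt Q) = dist P Q :=
      fun P hP Q hQ => A.dist_pt (((convex_closedBall w r).segment_subset hP hQ).trans hb)
    have m0 := mem_closedBall_self (x := w) hr.le
    have mq : q ∈ closedBall w r := by simp [hqw]
    have m1 : w - e ∈ closedBall w r := by simp [he]
    have m2 : w + e ∈ closedBall w r := by simp [dist_eq_norm, he]
    rw [seg q mq w m0, hqw] at hd
    have h1 := dist_triangle c (A.pt q) (A.pt (w - e))
    rw [seg q mq _ m1, h] at h1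
    have h2 : 2 * r - ε ≤ dist q (w - e) := by linarith
    have h3 := dist_triangle c (A.pt q) (A.pt (w + e))
    rw [seg q mq _ m2] at h3
    have h4 : dist q (w + e) ≤ √(4 * r * ε) := by
      apply Real.le_sqrt_of_sq_le
      have hpar := parallelogram_law_with_norm ℝ (q - w) e
      have e1 : dist q (w + e) = ‖q - w - e‖ := by rw [dist_eq_norm]; congr 1; abel
      have e2 : dist q (w - e) = ‖q - w + e‖ := by rw [dist_eq_norm]; congr 1; abel
      rw [← e1, ← e2, ← dist_eq_norm, hqw, he] at hpar
      rcases le_total 0 (2 * r - ε) with hle | hle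
      · nlinarith
      · have := dist_nonneg (x := q) (y := w - e)
        nlinarith
    linarith
  have hlim : Tendsto (fun ε : ℝ => dist c (A.pt w) - r + (ε + √(4 * r * ε))) (nhdsWithin 0 (Ioi 0))
      (nhds (dist c (A.pt w) - r)) := by
    have : Continuous fun ε : ℝ => dist c (A.pt w) - r + (ε + √(4 * r * ε)) := by fun_prop
    have := (this.tendsto 0).mono_left (nhdsWithin_le_nhds (s := Ioi 0))
    simpa using this
  exact ge_of_tendsto hlim (by filter_upwards [self_mem_nhdsWithin] with ε hε using key ε hε)

variable (A) in
/-- A final piece of a shortest path to an element extends straight until it leaves the domain. -/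
theorem exists_extension [CompleteSpace X] {c : X} (hc : c ∈ A.Bd) {v P : Euc 2} (hvP : v ≠ P)
    (hseg : segment ℝ v P ⊆ A.U) (h : dist c (A.pt v) = dist c (A.pt P) + dist v P) :
    ∃ u ∈ A.Bd, ∃ s, 1 < s ∧ A.p u = lin v P s ∧
      (∀ σ ∈ Ico 0 s, lin v P σ ∈ A.U ∧ dist u (A.pt (lin v P σ)) = (s - σ) * dist v P) ∧
      dist c u ≤ dist c (A.pt v) - s * dist v P := by
  have hl : 0 < dist v P := dist_pos.2 hvP
  set l := dist v P with hldef
  set g := lin v P with hg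
  have hgc : Continuous g := AffineMap.lineMap_continuous
  have hg1 : g 1 = P := by simp [hg]
  have hg0 : g 0 = v := by simp [hg]
  have hU1 : ∀ σ ∈ Icc (0:ℝ) 1, g σ ∈ A.U := fun σ hσ =>
    hseg (by rw [segment_eq_image_lineMap]; exact ⟨σ, hσ, rfl⟩)
  set S := {s | 1 ≤ s ∧ ∀ σ ∈ Icc 0 s, g σ ∈ A.U ∧ dist c (A.pt (g σ)) = dist c (A.pt v) - σ * l}
    with hS
  have sg : ∀ s, (∀ σ ∈ Icc 0 s, g σ ∈ A.U) → ∀ σ ∈ Icc 0 s, ∀ τ ∈ Icc σ s,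
      dist (A.pt (g τ)) (A.pt (g σ)) = (τ - σ) * l := by
    intro s hs σ hσ τ hτ
    rw [A.dist_pt, hg, lin, lin, dist_lineMap_nonneg _ _ hτ.1]
    intro R hR
    rw [segment_symm] at hR
    obtain ⟨ρ, hρ, rfl⟩ := segment_lineMap v P hτ.1 hR
    exact hs ρ ⟨hσ.1.trans hρ.1, hρ.2.trans hτ.2⟩
  have h1S : (1:ℝ) ∈ S := by
    refine ⟨le_rfl, fun σ hσ => ⟨hU1 σ hσ, ?_⟩⟩
    have e1 := sg 1 hU1 σ hσ 1 ⟨hσ.2, le_rfl⟩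
    have e2 := sg 1 hU1 0 ⟨le_rfl, zero_le_one⟩ σ hσ
    rw [hg1] at e1
    rw [hg0] at e2
    have t1 := dist_triangle c (A.pt P) (A.pt (g σ))
    have t2 := dist_triangle c (A.pt (g σ)) (A.pt v)
    linarith
  have hbd : ∀ s ∈ S, s ≤ dist c (A.pt v) / l := by
    intro s hs
    have h0 := (hs.2 s ⟨zero_le_one.trans hs.1, le_rfl⟩).2
    have := dist_nonneg (x := c) (y := A.pt (g s))
    rw [le_div_iff₀ hl]
    linarith
  have hbdd : BddAbove S := ⟨_, hbd⟩
  set s := sSup S with hs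
  have hs1 : 1 ≤ s := le_csSup hbdd h1S
  have hlt : ∀ σ ∈ Ico 0 s, g σ ∈ A.U ∧ dist c (A.pt (g σ)) = dist c (A.pt v) - σ * l := by
    intro σ hσ
    obtain ⟨t, ht, hσt⟩ := exists_lt_of_lt_csSup ⟨1, h1S⟩ hσ.2
    exact ht.2 σ ⟨hσ.1, hσt.le⟩
  have hsmem : g s ∉ A.U := by
    intro hw
    have hds : dist c (A.pt (g s)) = dist c (A.pt v) - s * l := by
      have c1 : ContinuousWithinAt (fun σ => dist c (A.pt (g σ))) (Ico 0 s) s :=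
        continuousWithinAt_const.dist
          (((A.continuousOn_pt.continuousAt (A.isOpen.mem_nhds hw)).comp hgc.continuousAt).continuousWithinAt)
      have c2 : ContinuousWithinAt (fun σ => dist c (A.pt v) - σ * l) (Ico 0 s) s := by fun_prop
      have hne : (nhdsWithin s (Ico 0 s)).NeBot := by
        rw [← mem_closure_iff_nhdsWithin_neBot, closure_Ico (by linarith : (0:ℝ) ≠ s)]
        exact ⟨by linarith, le_rfl⟩
      refine tendsto_nhds_unique c1 (c2.tendsto.congr' ?_)
      filter_upwards [self_mem_nhdsWithin] with σ hσ using (hlt σ hσ).2.symm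
    have hall : ∀ σ ∈ Icc 0 s, g σ ∈ A.U ∧ dist c (A.pt (g σ)) = dist c (A.pt v) - σ * l := by
      intro σ hσ
      rcases eq_or_lt_of_le hσ.2 with rfl | hlt'
      · exact ⟨hw, hds⟩
      · exact hlt σ ⟨hσ.1, hlt'⟩
    obtain ⟨r0, hr0, hb0⟩ := Metric.nhds_basis_closedBall.mem_iff.1 (A.isOpen.mem_nhds hw)
    have step : ∀ ρ, 0 < ρ → ρ ≤ min r0 l → g (s + ρ / l) ∈ A.U ∧
        dist c (A.pt (g (s + ρ / l))) ≤ dist c (A.pt v) - (s + ρ / l) * l := by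
      intro ρ hρ hρ'
      have hρ1 : ρ / l ≤ 1 := by rw [div_le_one hl]; exact hρ'.trans (min_le_right _ _)
      have hρ0 : 0 < ρ / l := by positivity
      have hbρ : closedBall (g s) ρ ⊆ A.U :=
        (closedBall_subset_closedBall (hρ'.trans (min_le_left _ _))).trans hb0
      have ge : g (s + ρ / l) = g s + (ρ / l) • (P - v) := by
        simp only [hg, AffineMap.lineMap_apply_module']; module
      have ge' : g (s - ρ / l) = g s - (ρ / l) • (P - v) := by
        simp only [hg, AffineMap.lineMap_apply_module']; module
      have hn : ‖(ρ / l) • (P - v)‖ = ρ := by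
        rw [norm_smul, ← dist_eq_norm, dist_comm P v, ← hldef, Real.norm_of_nonneg hρ0.le]
        field_simp
      have := A.dist_sphere_le hc hρ hbρ hn (by
        rw [← ge', hds, (hlt (s - ρ / l) ⟨by linarith, by linarith⟩).2]
        field_simp
        ring)
      rw [← ge, hds] at this
      refine ⟨?_, ?_⟩
      · rw [ge]; exact hbρ (by simp [dist_eq_norm, hn])
      · rw [add_mul, div_mul_cancel₀ _ hl.ne']; linarith
    set m := min r0 l with hm
    have hm0 : 0 < m := by positivity
    have : s + m / l ∈ S := by
      have hUall : ∀ σ ∈ Icc 0 (s + m / l), g σ ∈ A.U := by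
        intro σ hσ
        rcases le_or_gt σ s with hle | hgt
        · exact (hall σ ⟨hσ.1, hle⟩).1
        · have := (step ((σ - s) * l) (by nlinarith) (by
            have := hσ.2
            rw [← sub_le_iff_le_add', le_div_iff₀ hl] at this
            exact this)).1
          rwa [mul_div_cancel_right₀ _ hl.ne', add_sub_cancel] at this
      refine ⟨by have : 0 < m / l := by positivity
                 linarith, fun σ hσ => ⟨hUall σ hσ, ?_⟩⟩
      rcases le_or_gt σ s with hle | hgt
      · exact (hall σ ⟨hσ.1, hle⟩).2
      · have h1 := (step ((σ - s) * l) (by nlinarith) (by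
            have := hσ.2
            rw [← sub_le_iff_le_add', le_div_iff₀ hl] at this
            exact this)).2
        rw [mul_div_cancel_right₀ _ hl.ne', add_sub_cancel] at h1
        have h2 := sg _ hUall 0 ⟨le_rfl, hσ.1.trans hσ.2⟩ σ hσ
        have h3 := dist_triangle c (A.pt (g σ)) (A.pt v)
        rw [hg0] at h2
        linarith
    have h4 := le_csSup hbdd this
    have : 0 < m / l := by positivity
    linarith
  have hs1' : 1 < s := lt_of_le_of_ne hs1 fun h => hsmem (by rw [← h]; exact hU1 1 ⟨by simp, le_rfl⟩)
  obtain ⟨u, hu, hpu, hud⟩ := A.exists_end (s := s) (P := v) (w := P) (by linarith)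
    (fun σ hσ => (hlt σ hσ).1) hsmem
  refine ⟨u, hu, s, hs1', hpu, fun σ hσ => ⟨(hlt σ hσ).1, hud σ hσ⟩, ?_⟩
  have key : ∀ σ ∈ Ico 0 s, dist c u ≤ dist c (A.pt v) - s * l + 2 * (s - σ) * l := by
    intro σ hσ
    have t := dist_triangle c (A.pt (g σ)) u
    rw [dist_comm (A.pt _) u, hud σ hσ, (hlt σ hσ).2] at t
    linarith
  refine le_of_forall_pos_le_add fun ε hε => ?_
  have hε' : 0 < min (ε / (2 * l)) s := lt_min (by positivity) (by linarith)
  have := key (s - min (ε / (2 * l)) s) ⟨by linarith [min_le_right (ε / (2 * l)) s], by linarith⟩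
  have h5 : min (ε / (2 * l)) s * (2 * l) ≤ ε := by
    rw [← le_div_iff₀ (by positivity)]; exact min_le_left _ _
  nlinarith

end Dom

namespace Dom
variable {X : Type} [MetricSpace X] {A : Dom X}

variable (A) in
/-- The elements close to lying between `a` and `b` are close to `a` or to `b`. -/
def Star (a b : X) : Prop :=
  ∀ δ > 0, ∃ ε > 0, ∀ c ∈ A.Bd, dist a c + dist c b ≤ dist a b + ε → dist a c < δ ∨ dist c b < δ

theorem Sees.star {a b : X} (h : A.Sees a b) : A.Star a b := by
  intro δ hδ
  by_contra! hcon
  choose c hc hd h1 h2 using fun k : ℕ => hcon (1 / (k + 1)) (by positivity)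
  have hlim0 := tendsto_one_div_add_atTop_nhds_zero_nat (𝕜 := ℝ)
  have hbdd : ∀ k, A.p (c k) ∈ closedBall (A.p a) (dist a b + 1) := by
    intro k
    have h3 : 1 / ((k:ℝ) + 1) ≤ 1 := by
      rw [div_le_one (by positivity)]; linarith [(Nat.cast_nonneg k : (0:ℝ) ≤ k)]
    have h4 := A.p_lip (c k) a
    rw [dist_comm (c k) a] at h4
    rw [mem_closedBall]
    linarith [hd k, dist_nonneg (x := c k) (y := b)]
  obtain ⟨w, _, φ, hφ, hlim⟩ := (isCompact_closedBall (A.p a) (dist a b + 1)).tendsto_subseq hbdd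
  have hlim1 := hlim0.comp hφ.tendsto_atTop
  have hsum : dist (A.p a) w + dist w (A.p b) ≤ dist (A.p a) (A.p b) := by
    have l1 := (tendsto_const_nhds (x := A.p a)).dist hlim |>.add (hlim.dist (tendsto_const_nhds (x := A.p b)))
    have l2 := hlim1.const_add (dist a b)
    rw [add_zero, h.dist_eq] at l2
    refine le_of_tendsto_of_tendsto' l1 l2 fun k => ?_
    have := hd (φ k)
    have e1 := A.p_lip a (c (φ k))
    have e2 := A.p_lip (c (φ k)) b
    rw [h.dist_eq] at this
    simp only [Function.comp]
    linarith
  have hseg : w ∈ segment ℝ (A.p a) (A.p b) :=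
    dist_add_dist_eq_iff.1 (le_antisymm hsum (dist_triangle _ _ _)) |>.mem_segment
  have hwU : w ∉ A.U := by
    have : IsClosed (A.U)ᶜ := A.isOpen.isClosed_compl
    exact this.mem_of_tendsto hlim (Eventually.of_forall fun k => hc (φ k))
  rcases eq_or_ne w (A.p a) with rfl | hwa
  · have l1 := (hlim.dist (tendsto_const_nhds (x := A.p b)))
    have l2 := (hlim1.const_add (dist a b)).sub l1
    rw [h.dist_eq, add_zero, sub_self] at l2
    have : δ ≤ 0 := ge_of_tendsto' l2 fun k => by
      have := hd (φ k)
      have e2 := A.p_lip (c (φ k)) b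
      have := h1 (φ k)
      rw [h.dist_eq] at *
      simp only [Function.comp]
      linarith
    linarith
  · rcases eq_or_ne w (A.p b) with rfl | hwb
    · have l1 := (hlim.dist (tendsto_const_nhds (x := A.p a)))
      have l2 := (hlim1.const_add (dist a b)).sub l1
      rw [h.dist_eq, add_zero, dist_comm, sub_self] at l2
      have : δ ≤ 0 := ge_of_tendsto' l2 fun k => by
        have := hd (φ k)
        have e2 := A.p_lip (c (φ k)) a
        have := h2 (φ k)
        rw [dist_comm (c _) a] at e2
        rw [h.dist_eq, dist_comm (A.p a)] at *
        simp only [Function.comp]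
        linarith
      linarith
    · exact hwU (h.2 w (mem_openSegment_of_ne_left_right hwa.symm hwb.symm hseg)).1

theorem Star.sees [CompleteSpace X] {a b : X} (h : A.Star a b) (ha : a ∈ A.Bd) (hb : b ∈ A.Bd)
    (hab : a ≠ b) : A.Sees a b := by
  set d := dist a b with hd
  have hd0 : 0 < d := dist_pos.2 hab
  have between : ∀ c ∈ A.Bd, dist a c + dist c b ≤ d → c = a ∨ c = b := by
    intro c hc hcd
    by_contra! hne
    have p1 : 0 < dist a c := dist_pos.2 hne.1.symm
    have p2 : 0 < dist c b := dist_pos.2 hne.2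
    obtain ⟨ε, hε, h'⟩ := h (min (dist a c) (dist c b)) (lt_min p1 p2)
    rcases h' c hc (by linarith) with h' | h'
    · exact absurd h' (not_lt.2 (min_le_left _ _))
    · exact absurd h' (not_lt.2 (min_le_right _ _))
  have hlim0 := tendsto_one_div_add_atTop_nhds_zero_nat (𝕜 := ℝ)
  -- a midpoint
  obtain ⟨P, hP, haP, hbP⟩ : ∃ P ∈ A.U, dist a (A.pt P) = d / 2 ∧ dist b (A.pt P) = d / 2 := by
    choose q hq hφ hqd using fun k : ℕ => A.exists_crossing (a := a) (b := b)
      (φ := fun x => dist a x - d / 2) (by fun_prop) (by simp; linarith) (by simp; linarith)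
      (L := d + 1 / (k + 1)) (by linarith [show (0:ℝ) < 1 / (k + 1) by positivity])
    have hqa : ∀ k, dist a (A.pt (q k)) = d / 2 := fun k => by linarith [hφ k]
    have hbdd : ∀ k, q k ∈ closedBall (A.p a) (d / 2) := by
      intro k
      rw [mem_closedBall, dist_comm, ← hqa k]
      exact A.dist_p_le (hq k)
    obtain ⟨w, _, φ, hφ', hlim⟩ := (isCompact_closedBall (A.p a) (d / 2)).tendsto_subseq hbdd
    have hlim1 := hlim0.comp hφ'.tendsto_atTop
    by_cases hw : w ∈ A.U
    · have hpt : Tendsto (fun k => A.pt (q (φ k))) atTop (nhds (A.pt w)) :=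
        ((A.continuousOn_pt.continuousAt (A.isOpen.mem_nhds hw)).tendsto).comp hlim
      have e1 : dist a (A.pt w) = d / 2 :=
        tendsto_nhds_unique ((tendsto_const_nhds (x := a)).dist hpt)
          (tendsto_const_nhds.congr fun k => (hqa (φ k)).symm)
      have e2 : dist (A.pt w) b ≤ d / 2 := by
        have l2 := hlim1.const_add (d / 2)
        rw [add_zero] at l2
        refine le_of_tendsto_of_tendsto' (hpt.dist (tendsto_const_nhds (x := b))) l2 fun k => ?_
        have := hqd (φ k)
        rw [hqa] at this
        simp only [Function.comp]
        linarith
      refine ⟨w, hw, e1, ?_⟩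
      have := dist_triangle a (A.pt w) b
      rw [dist_comm b]
      linarith
    · exfalso
      obtain ⟨ε, hε, h'⟩ := h (d / 4) (by linarith)
      have l3 := (hlim.dist (tendsto_const_nhds (x := w))).const_mul 2 |>.add hlim1
      rw [dist_self, mul_zero, add_zero] at l3
      obtain ⟨k, hk⟩ := (l3.eventually (gt_mem_nhds (show 0 < min ε (d / 4) by positivity))).exists
      simp only [Function.comp] at hk
      obtain ⟨c, hc, s, hs, hpc, hcd⟩ := A.exists_first_exit (hq (φ k)) hw
      have hc0 := (hcd 0 ⟨le_rfl, hs.1⟩).2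
      simp only [lin, AffineMap.lineMap_apply_zero, sub_zero] at hc0
      have hs1 := hs.2
      have hqw := dist_nonneg (x := q (φ k)) (y := w)
      have hcq : dist c (A.pt (q (φ k))) ≤ dist (q (φ k)) w := by nlinarith
      have t1 := dist_triangle a (A.pt (q (φ k))) c
      have t2 := dist_triangle c (A.pt (q (φ k))) b
      have t3 := dist_triangle a c (A.pt (q (φ k)))
      have t4 := dist_triangle a c b
      have := hqd (φ k)
      have h1 := hqa (φ k)
      rw [dist_comm (A.pt _) c] at t1
      have m1 := min_le_left ε (d / 4)
      have m2 := min_le_right ε (d / 4)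
      have hp : (0:ℝ) < 1 / ((φ k : ℝ) + 1) := by positivity
      have t5 := dist_triangle a (A.pt (q (φ k))) b
      have t6 := dist_triangle (A.pt (q (φ k))) c b
      rw [dist_comm (A.pt _) c] at t6
      rcases h' c hc (by linarith) with h' | h' <;> linarith
  -- a point next to the midpoint
  obtain ⟨r, hr, hbr⟩ := Metric.nhds_basis_closedBall.mem_iff.1 (A.isOpen.mem_nhds hP)
  obtain ⟨v, hv, hbv⟩ : ∃ v ∈ sphere P r, dist b (A.pt v) ≤ d / 2 - r := by
    have hc1 : r < dist (A.p b) P := by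
      by_contra! h'
      exact hb (hbr h')
    choose q hq hφ hqd using fun k : ℕ => A.exists_crossing (a := b) (b := A.pt P)
      (φ := fun x => r - dist (A.p x) P) (by have := A.continuous_p; fun_prop) (by simp; exact hc1)
      (by simp [A.p_pt P hP, hr]) (L := d / 2 + 1 / (k + 1))
      (by linarith [show (0:ℝ) < 1 / (k + 1) by positivity])
    have hqs : ∀ k, q k ∈ sphere P r := by
      intro k
      have := hφ k
      rw [A.p_pt _ (hq k)] at this
      rw [mem_sphere]; linarith
    obtain ⟨w, hw, φ, hφ', hlim⟩ := (isCompact_sphere P r).tendsto_subseq hqs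
    have hlim1 := hlim0.comp hφ'.tendsto_atTop
    have hwU : w ∈ A.U := hbr (sphere_subset_closedBall hw)
    have hpt : Tendsto (fun k => A.pt (q (φ k))) atTop (nhds (A.pt w)) :=
      ((A.continuousOn_pt.continuousAt (A.isOpen.mem_nhds hwU)).tendsto).comp hlim
    refine ⟨w, hw, ?_⟩
    have l2 := hlim1.const_add (d / 2 - r)
    rw [add_zero] at l2
    refine le_of_tendsto_of_tendsto' ((tendsto_const_nhds (x := b)).dist hpt) l2 fun k => ?_
    have := hqd (φ k)
    rw [A.dist_pt (((convex_closedBall P r).segment_subset (sphere_subset_closedBall (hqs _))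
      (mem_closedBall_self hr.le)).trans hbr), mem_sphere.1 (hqs _)] at this
    simp only [Function.comp]
    linarith
  have hvP : dist v P = r := hv
  have hne : v ≠ P := by
    rintro rfl
    rw [dist_self] at hvP
    linarith
  have hseg : segment ℝ v P ⊆ A.U := ((convex_closedBall P r).segment_subset
    (sphere_subset_closedBall hv) (mem_closedBall_self hr.le)).trans hbr
  have hseg' : segment ℝ P v ⊆ A.U := by rwa [segment_symm]
  have hDvP : dist (A.pt v) (A.pt P) = r := by rw [A.dist_pt hseg, hvP]
  have hav : dist a (A.pt v) = d / 2 + r := by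
    have t1 := dist_triangle a (A.pt v) b
    have t2 := dist_triangle a (A.pt P) (A.pt v)
    rw [dist_comm (A.pt v) b] at t1
    rw [dist_comm (A.pt P)] at t2
    linarith
  have hbv' : dist b (A.pt v) = d / 2 - r := by
    have t1 := dist_triangle a (A.pt v) b
    rw [dist_comm (A.pt v) b] at t1
    linarith
  obtain ⟨u, hu, s, hs1, hpu, hus, hau⟩ := A.exists_extension ha hne hseg (by
    rw [hav, haP, hvP])
  obtain ⟨u', hu', s', hs1', hpu', hus', hau'⟩ := A.exists_extension hb hne.symm hseg' (by
    rw [hbP, hbv', dist_comm P v, hvP]; ring)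
  rw [hvP] at hus hau
  rw [dist_comm P v, hvP] at hus' hau'
  have hu0 := (hus 0 ⟨le_rfl, by linarith⟩).2
  have hu0' := (hus' 0 ⟨le_rfl, by linarith⟩).2
  simp only [lin, AffineMap.lineMap_apply_zero, sub_zero] at hu0 hu0'
  have hua : u = a := by
    have t := dist_triangle u (A.pt v) b
    rw [dist_comm (A.pt v) b] at t
    refine (between u hu (by linarith)).resolve_right ?_
    rintro rfl
    nlinarith
  have hub : u' = b := by
    have t := dist_triangle a (A.pt P) u'
    rw [dist_comm (A.pt P) u'] at t
    rw [dist_comm b u'] at hau'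
    refine (between u' hu' (by linarith)).resolve_left ?_
    rintro rfl
    rw [dist_comm u' b] at hau'
    have : dist u' b = d := rfl
    rw [dist_comm] at this
    nlinarith
  subst hua hub
  have hg' : ∀ σ, lin P v (1 - σ) = lin v P σ := fun σ => AffineMap.lineMap_apply_one_sub P v σ
  have hpu'' : A.p u' = lin v P (1 - s') := by rw [hpu', ← hg']; congr 1; ring
  have hgU : ∀ σ, 1 - s' < σ → σ < s → lin v P σ ∈ A.U := by
    intro σ h1 h2
    rcases le_or_gt 0 σ with h0 | h0
    · exact (hus σ ⟨h0, h2⟩).1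
    · rw [← hg']; exact (hus' _ ⟨by linarith, by linarith⟩).1
  have hgd : ∀ σ τ, 1 - s' < σ → σ ≤ τ → τ < s →
      dist (A.pt (lin v P τ)) (A.pt (lin v P σ)) = (τ - σ) * r := by
    intro σ τ h1 h2 h3
    rw [dist_comm, A.dist_pt, dist_comm, lin, lin, dist_lineMap_nonneg _ _ h2, hvP]
    intro R hR
    obtain ⟨ρ, hρ, rfl⟩ := segment_lineMap v P h2 hR
    exact hgU ρ (h1.trans_le hρ.1) (hρ.2.trans_lt h3)
  have hss : 1 - s' < s := by linarith
  have hdd : ∀ {σ τ}, σ ≤ τ → dist (lin v P τ) (lin v P σ) = (τ - σ) * r := fun h => by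
    rw [lin, lin, dist_lineMap_nonneg _ _ h, hvP]
  refine ⟨?_, ?_⟩
  · rw [← dist_pos, hpu, hpu'', hdd hss.le]
    nlinarith
  · intro R hR
    have hR' : R ∈ segment ℝ (lin v P (1 - s')) (lin v P s) := by
      rw [← hpu, ← hpu'', segment_symm]; exact openSegment_subset_segment _ _ _ hR
    obtain ⟨σ, hσ, rfl⟩ := segment_lineMap v P hss.le hR'
    have hpne : A.p u ≠ A.p u' := by
      rw [← dist_pos, hpu, hpu'', hdd hss.le]
      nlinarith
    have hσ1 : 1 - s' < σ := lt_of_le_of_ne hσ.1 (by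
      rintro rfl
      rw [← hpu''] at hR
      exact hpne (right_mem_openSegment_iff.1 hR))
    have hσ2 : σ < s := lt_of_le_of_ne hσ.2 (by
      rintro rfl
      rw [← hpu] at hR
      exact hpne (left_mem_openSegment_iff.1 hR))
    have hRU := hgU σ hσ1 hσ2
    refine ⟨hRU, le_antisymm ?_ (A.dist_p_le hRU), le_antisymm ?_ (A.dist_p_le hRU)⟩
    · have m0 : max σ 0 < s := max_lt hσ2 (by linarith)
      have e1 := (hus (max σ 0) ⟨le_max_right _ _, m0⟩).2
      have e2 := hgd σ (max σ 0) hσ1 (le_max_left _ _) m0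
      have t := dist_triangle u (A.pt (lin v P (max σ 0))) (A.pt (lin v P σ))
      rw [hpu, hdd hσ2.le]
      linarith
    · have m0 : 1 - s' < min σ 1 := lt_min hσ1 (by linarith)
      have e1 := (hus' (1 - min σ 1) ⟨by linarith [min_le_right σ 1], by linarith⟩).2
      rw [hg'] at e1
      have e2 := hgd (min σ 1) σ m0 (min_le_left _ _) hσ2
      have t := dist_triangle u' (A.pt (lin v P (min σ 1))) (A.pt (lin v P σ))
      rw [dist_comm (A.pt (lin v P σ))] at e2
      rw [hpu'', dist_comm (lin v P (1 - s')), hdd hσ1.le]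
      linarith

end Dom

namespace Dom
variable {X : Type} [MetricSpace X] {A : Dom X}

/-- Two elements seen from the same element in the same place coincide. -/
theorem Sees.unique {y u u' : X} (h : A.Sees y u) (h' : A.Sees y u') (hp : A.p u = A.p u') :
    u = u' := by
  refine dist_le_zero.1 (le_of_forall_pos_le_add fun ε hε => ?_)
  have hl : 0 < dist (A.p u) (A.p y) := dist_pos.2 h.1.symm
  set t := min (1 / 2) (ε / (2 * dist (A.p u) (A.p y))) with ht
  have ht0 : 0 < t := by positivity
  have ht1 : t < 1 := (min_le_left _ _).trans_lt (by norm_num)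
  have hR : lin (A.p u) (A.p y) t ∈ openSegment ℝ (A.p y) (A.p u) := by
    rw [openSegment_symm, openSegment_eq_image_lineMap]
    exact ⟨t, ⟨ht0, ht1⟩, rfl⟩
  obtain ⟨_, _, h3⟩ := h.2 _ hR
  obtain ⟨_, _, h3'⟩ := h'.2 _ (hp ▸ hR)
  have hd : dist (A.p u) (lin (A.p u) (A.p y) t) = t * dist (A.p u) (A.p y) := by
    rw [lin, dist_left_lineMap, Real.norm_of_nonneg ht0.le]
  rw [← hp, hd] at h3'
  rw [hd] at h3
  have := dist_triangle_right u u' (A.pt (lin (A.p u) (A.p y) t))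
  have h4 : t * (2 * dist (A.p u) (A.p y)) ≤ ε := by
    rw [← le_div_iff₀ (by positivity)]; exact min_le_right _ _
  linarith

variable (A) in
/-- A nondegenerate sector at the element `y`, free of boundary near its vertex. -/
structure Angle (x y z : X) : Prop where
  hx : x ∈ A.Bd
  hy : y ∈ A.Bd
  hz : z ∈ A.Bd
  sx : A.Sees y x
  sz : A.Sees y z
  li : ∀ s t : ℝ, s • (A.p x - A.p y) + t • (A.p z - A.p y) = 0 → s = 0 ∧ t = 0
  clean : ∃ r : ℝ, 0 < r ∧ ∀ α β : ℝ, 0 ≤ α → 0 ≤ β → 0 < α + β → α + β ≤ r →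
    A.p y + (α • (A.p x - A.p y) + β • (A.p z - A.p y)) ∈ A.U

theorem Angle.symm {x y z : X} (h : A.Angle x y z) : A.Angle z y x where
  hx := h.hz
  hy := h.hy
  hz := h.hx
  sx := h.sz
  sz := h.sx
  li s t hst := (h.li t s (by rw [add_comm]; exact hst)).symm
  clean := by
    obtain ⟨r, hr, hc⟩ := h.clean
    exact ⟨r, hr, fun α β ha hb h1 h2 => by
      rw [add_comm (α • _)]; exact hc β α hb ha (by linarith) (by linarith)⟩

/-- Points of a clean sector are at Euclidean distance from its vertex. -/
theorem Angle.dist_eq {x y z : X} (h : A.Angle x y z) {α β : ℝ} (hα : 0 ≤ α) (hβ : 0 ≤ β)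
    (hαβ : 0 < α + β)
    (hU : ∀ s : ℝ, 0 < s → s ≤ 1 → A.p y + s • (α • (A.p x - A.p y) + β • (A.p z - A.p y)) ∈ A.U)
    {s : ℝ} (hs : 0 < s) (hs1 : s ≤ 1) :
    dist y (A.pt (A.p y + s • (α • (A.p x - A.p y) + β • (A.p z - A.p y)))) =
      dist (A.p y) (A.p y + s • (α • (A.p x - A.p y) + β • (A.p z - A.p y))) := by
  obtain ⟨r, hr, hc⟩ := h.clean
  set a := A.p x - A.p y with ha
  set b := A.p z - A.p y with hb
  set e := α • a + β • b with he
  refine le_antisymm ?_ (A.dist_p_le (hU s hs hs1))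
  refine le_of_forall_pos_le_add fun ε hε => ?_
  have seg : ∀ σ, 0 < σ → σ ≤ s → dist (A.pt (A.p y + σ • e)) (A.pt (A.p y + s • e)) ≤
      (s - σ) * ‖e‖ := by
    intro σ h0 h1
    refine (A.pt_seg _ _ ?_).trans ?_
    · intro R hR
      rw [segment_eq_image_lineMap] at hR
      obtain ⟨τ, hτ, rfl⟩ := hR
      have : AffineMap.lineMap (A.p y + σ • e) (A.p y + s • e) τ = A.p y + (σ + τ * (s - σ)) • e := by
        rw [AffineMap.lineMap_apply_module']; module
      rw [this]
      exact hU _ (by nlinarith [hτ.1]) (by nlinarith [hτ.2])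
    · rw [dist_add_left, dist_eq_norm, ← sub_smul, norm_smul, Real.norm_eq_abs, abs_sub_comm,
        abs_of_nonneg (by linarith)]
  have hK : 0 < 2 * (‖a‖ + ‖e‖) + 1 := by positivity
  set κ := min (min s (1 / 2)) (min (r / (1 + α + β)) (ε / (2 * (‖a‖ + ‖e‖) + 1))) with hκ
  have h1 : 0 < 1 + α + β := by linarith
  have hκ0 : 0 < κ := by positivity
  have k1 : κ ≤ s := (min_le_left _ _).trans (min_le_left _ _)
  have k2 : κ ≤ 1 / 2 := (min_le_left _ _).trans (min_le_right _ _)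
  have k3 : κ * (1 + α + β) ≤ r := by
    rw [← le_div_iff₀ h1]; exact (min_le_right _ _).trans (min_le_left _ _)
  have k4 : κ * (2 * (‖a‖ + ‖e‖) + 1) ≤ ε := by
    rw [← le_div_iff₀ hK]; exact (min_le_right _ _).trans (min_le_right _ _)
  have d1 : dist y (A.pt (A.p y + κ • a)) = κ * ‖a‖ := by
    have hm : A.p y + κ • a ∈ openSegment ℝ (A.p y) (A.p x) := by
      rw [openSegment_eq_image_lineMap]
      exact ⟨κ, ⟨hκ0, by linarith⟩, by rw [AffineMap.lineMap_apply_module', add_comm]⟩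
    rw [(h.sx.2 _ hm).2.1, dist_self_add_right, norm_smul, Real.norm_of_nonneg hκ0.le]
  have d2 : dist (A.pt (A.p y + κ • a)) (A.pt (A.p y + κ • e)) ≤ κ * (‖a‖ + ‖e‖) := by
    refine (A.pt_seg _ _ ?_).trans ?_
    · intro R hR
      rw [segment_eq_image_lineMap] at hR
      obtain ⟨τ, hτ, rfl⟩ := hR
      have : AffineMap.lineMap (A.p y + κ • a) (A.p y + κ • e) τ =
          A.p y + ((κ * ((1 - τ) + τ * α)) • a + (κ * (τ * β)) • b) := by
        rw [AffineMap.lineMap_apply_module', he]; module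
      rw [this]
      have t0 := hτ.1
      have t1 : 0 ≤ 1 - τ := by linarith [hτ.2]
      refine hc _ _ (by positivity) (by positivity) ?_ ?_
      · rw [← mul_add]
        refine mul_pos hκ0 ?_
        rcases eq_or_lt_of_le t0 with rfl | t0
        · norm_num
        · nlinarith
      · rw [← mul_add]
        refine le_trans (mul_le_mul_of_nonneg_left ?_ hκ0.le) k3
        nlinarith [hτ.2, mul_nonneg t1 (add_nonneg hα hβ)]
    · rw [dist_add_left, dist_eq_norm, ← smul_sub, norm_smul, Real.norm_of_nonneg hκ0.le]
      exact mul_le_mul_of_nonneg_left (norm_sub_le _ _) hκ0.le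
  have d3 := seg κ hκ0 k1
  have t := dist_triangle4 y (A.pt (A.p y + κ • a)) (A.pt (A.p y + κ • e)) (A.pt (A.p y + s • e))
  rw [dist_self_add_right, norm_smul, Real.norm_of_nonneg hs.le]
  have := norm_nonneg e
  nlinarith

/-- The first boundary point in a direction of a clean sector carries an element seen from the
vertex. -/
theorem Angle.exists_elem [CompleteSpace X] {x y z : X} (h : A.Angle x y z) {α β : ℝ} (hα : 0 ≤ α)
    (hβ : 0 ≤ β) (hαβ : 0 < α + β)
    (hU : ∀ s : ℝ, 0 < s → s < 1 → A.p y + s • (α • (A.p x - A.p y) + β • (A.p z - A.p y)) ∈ A.U)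
    (hP : A.p y + (α • (A.p x - A.p y) + β • (A.p z - A.p y)) ∉ A.U) :
    ∃ u ∈ A.Bd, A.p u = A.p y + (α • (A.p x - A.p y) + β • (A.p z - A.p y)) ∧ A.Sees y u := by
  set e := α • (A.p x - A.p y) + β • (A.p z - A.p y) with he
  have hgl : ∀ σ, lin (A.p y + (1/2 : ℝ) • e) (A.p y + e) σ = A.p y + (1/2 + σ / 2) • e := fun σ => by
    rw [lin, AffineMap.lineMap_apply_module']; module
  obtain ⟨u, hu, hpu, hd⟩ := A.exists_end (P := A.p y + (1/2 : ℝ) • e) (w := A.p y + e) (s := 1)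
    one_pos (fun σ hσ => by
      rw [hgl]; exact hU _ (by linarith [hσ.1]) (by linarith [hσ.2]))
    (by rw [hgl]; norm_num; exact hP)
  have hpu' : A.p u = A.p y + e := by rw [hpu, hgl]; norm_num
  have he0 : e ≠ 0 := fun h0 => by
    obtain ⟨h1, h2⟩ := h.li _ _ h0
    linarith
  refine ⟨u, hu, hpu', by rw [hpu']; simpa using he0, fun R hR => ?_⟩
  rw [openSegment_eq_image_lineMap] at hR
  obtain ⟨s, hs, rfl⟩ := hR
  have hR : AffineMap.lineMap (A.p y) (A.p u) s = A.p y + s • e := by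
    rw [AffineMap.lineMap_apply_module', hpu']; module
  rw [hR]
  have hsU := hU s hs.1 hs.2
  have hnorm : dist (A.p y + (1/2 : ℝ) • e) (A.p y + e) = 1/2 * ‖e‖ := by
    rw [dist_add_left, dist_eq_norm]
    rw [show (1/2 : ℝ) • e - e = (-(1/2) : ℝ) • e by module, norm_smul]
    norm_num
  refine ⟨hsU, ?_, ?_⟩
  · have := h.dist_eq (α := s * α) (β := s * β) (mul_nonneg hs.1.le hα) (mul_nonneg hs.1.le hβ)
      (by nlinarith [hs.1]) (fun t ht ht1 => by
        have : t • ((s * α) • (A.p x - A.p y) + (s * β) • (A.p z - A.p y)) = (t * s) • e := by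
          rw [he]; module
        rw [this]
        exact hU _ (mul_pos ht hs.1) (by nlinarith [hs.1, hs.2])) one_pos le_rfl
    have e1 : (1:ℝ) • ((s * α) • (A.p x - A.p y) + (s * β) • (A.p z - A.p y)) = s • e := by
      rw [he]; module
    rwa [e1] at this
  · refine le_antisymm ?_ (A.dist_p_le hsU)
    have hσ : 2 * max s (1/2) - 1 ∈ Ico (0:ℝ) 1 :=
      ⟨by linarith [le_max_right s (1/2)], by linarith [max_lt hs.2 (by norm_num : (1:ℝ)/2 < 1)]⟩
    have d1 := hd _ hσ
    rw [hgl, hnorm] at d1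
    have e2 : (1/2 + (2 * max s (1/2) - 1) / 2 : ℝ) = max s (1/2) := by ring
    rw [e2] at d1
    have d2 : dist (A.pt (A.p y + max s (1/2) • e)) (A.pt (A.p y + s • e)) ≤
        (max s (1/2) - s) * ‖e‖ := by
      refine (A.pt_seg _ _ ?_).trans ?_
      · intro R hR
        rw [segment_eq_image_lineMap] at hR
        obtain ⟨τ, hτ, rfl⟩ := hR
        have m1 := le_max_left s (1/2)
        have m2 : max s (1/2) < 1 := max_lt hs.2 (by norm_num)
        have : AffineMap.lineMap (A.p y + max s (1/2) • e) (A.p y + s • e) τ =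
            A.p y + (s + (1 - τ) * (max s (1/2) - s)) • e := by
          rw [AffineMap.lineMap_apply_module']; module
        rw [this]
        exact hU _ (by nlinarith [hτ.2, hs.1]) (by nlinarith [hτ.1, hτ.2])
      · rw [dist_add_left, dist_eq_norm, ← sub_smul, norm_smul, Real.norm_of_nonneg
          (by linarith [le_max_left s (1/2)])]
    have t := dist_triangle u (A.pt (A.p y + max s (1/2) • e)) (A.pt (A.p y + s • e))
    rw [hpu', dist_add_left, dist_eq_norm, show e - s • e = (1 - s) • e by module, norm_smul,
      Real.norm_of_nonneg (by linarith [hs.2])]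
    nlinarith

end Dom

/-- An isometry of the boundaries. -/
structure BdIso {X Y : Type} [MetricSpace X] [MetricSpace Y] (A : Dom X) (B : Dom Y) where
  F : X → Y
  G : Y → X
  F_mem : ∀ a ∈ A.Bd, F a ∈ B.Bd
  G_mem : ∀ b ∈ B.Bd, G b ∈ A.Bd
  GF : ∀ a ∈ A.Bd, G (F a) = a
  FG : ∀ b ∈ B.Bd, F (G b) = b
  dist_F : ∀ a ∈ A.Bd, ∀ b ∈ A.Bd, dist (F a) (F b) = dist a b

namespace BdIso
variable {X Y : Type} [MetricSpace X] [MetricSpace Y] {A : Dom X} {B : Dom Y}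

/-- The inverse isometry. -/
def symm (I : BdIso A B) : BdIso B A where
  F := I.G
  G := I.F
  F_mem := I.G_mem
  G_mem := I.F_mem
  GF := I.FG
  FG := I.GF
  dist_F a ha b hb := by
    rw [← I.dist_F _ (I.G_mem a ha) _ (I.G_mem b hb), I.FG a ha, I.FG b hb]

theorem sees [CompleteSpace Y] (I : BdIso A B) {a b : X} (ha : a ∈ A.Bd) (hb : b ∈ A.Bd)
    (h : A.Sees a b) : B.Sees (I.F a) (I.F b) := by
  have hab : a ≠ b := fun h' => h.1 (by rw [h'])
  have hs : B.Star (I.F a) (I.F b) := by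
    intro δ hδ
    obtain ⟨ε, hε, h'⟩ := h.star δ hδ
    refine ⟨ε, hε, fun c hc hcd => ?_⟩
    have hG := I.G_mem c hc
    have e1 := I.dist_F a ha _ hG
    have e2 := I.dist_F _ hG b hb
    have e3 := I.dist_F a ha b hb
    rw [I.FG c hc] at e1 e2
    rw [e1, e2, e3] at hcd
    rw [e1, e2]
    exact h' _ hG hcd
  refine hs.sees (I.F_mem a ha) (I.F_mem b hb) fun h' => hab ?_
  rw [← I.GF a ha, ← I.GF b hb, h']

theorem dist_p [CompleteSpace Y] (I : BdIso A B) {a b : X} (ha : a ∈ A.Bd) (hb : b ∈ A.Bd)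
    (h : A.Sees a b) : dist (B.p (I.F a)) (B.p (I.F b)) = dist (A.p a) (A.p b) := by
  rw [← (I.sees ha hb h).dist_eq, I.dist_F a ha b hb, h.dist_eq]

end BdIso

/-- Obstacles in a triangle, in affine coordinates at the clean vertex. -/
structure Obst (S : Set (ℝ × ℝ)) : Prop where
  compact : IsCompact S
  nonneg₁ : ∀ q ∈ S, 0 ≤ q.1
  nonneg₂ : ∀ q ∈ S, 0 ≤ q.2
  sum_le : ∀ q ∈ S, q.1 + q.2 ≤ 1
  le_sum : ∃ r : ℝ, 0 < r ∧ ∀ q ∈ S, r ≤ q.1 + q.2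
  mem₁ : ((1, 0) : ℝ × ℝ) ∈ S
  mem₂ : ((0, 1) : ℝ × ℝ) ∈ S
  axis₁ : ∀ q ∈ S, q.2 = 0 → q.1 = 1
  axis₂ : ∀ q ∈ S, q.1 = 0 → q.2 = 1

/-- The linear functionals that are at least `1` on the obstacles. -/
def suppFun (S : Set (ℝ × ℝ)) : Set (ℝ × ℝ) := {l | ∀ q ∈ S, 1 ≤ q.1 * l.1 + q.2 * l.2}

/-- The gauge of the hull of the obstacles in direction `τ`. -/
def hullW (S : Set (ℝ × ℝ)) (τ : ℝ) : ℝ := sInf ((fun l : ℝ × ℝ => (1 - τ) * l.1 + τ * l.2) '' suppFun S)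

/-- The point of direction `τ` and gauge `w`. -/
def dirPt (τ w : ℝ) : ℝ × ℝ := ((1 - τ) / w, τ / w)

/-- The directions in which the hull meets the obstacles. -/
def hullE (S : Set (ℝ × ℝ)) : Set ℝ := {τ | τ ∈ Icc (0:ℝ) 1 ∧ dirPt τ (hullW S τ) ∈ S}

namespace Obst
variable {S : Set (ℝ × ℝ)}

theorem swap (h : Obst S) : Obst (Prod.swap ⁻¹' S) where
  compact := by
    rw [← image_swap_eq_preimage_swap]
    exact h.compact.image continuous_swap
  nonneg₁ q hq := h.nonneg₂ _ hq
  nonneg₂ q hq := h.nonneg₁ _ hq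
  sum_le q hq := by have := h.sum_le _ hq; simp at this; linarith
  le_sum := by
    obtain ⟨r, hr, h'⟩ := h.le_sum
    exact ⟨r, hr, fun q hq => by have := h' _ hq; simp at this; linarith⟩
  mem₁ := h.mem₂
  mem₂ := h.mem₁
  axis₁ q hq := h.axis₂ _ hq
  axis₂ q hq := h.axis₁ _ hq

theorem suppFun_swap (l : ℝ × ℝ) : l ∈ suppFun (Prod.swap ⁻¹' S) ↔ l.swap ∈ suppFun S := by
  constructor
  · intro h q hq
    have := h q.swap (by simpa using hq)
    simp at this ⊢
    linarith
  · intro h q hq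
    have := h q.swap (by simpa using hq)
    simp at this ⊢
    linarith

theorem hullW_swap (τ : ℝ) : hullW (Prod.swap ⁻¹' S) τ = hullW S (1 - τ) := by
  unfold hullW
  congr 1
  ext c
  constructor
  · rintro ⟨l, hl, rfl⟩
    exact ⟨l.swap, (suppFun_swap l).1 hl, by simp; ring⟩
  · rintro ⟨l, hl, rfl⟩
    exact ⟨l.swap, (suppFun_swap _).2 (by simpa using hl), by simp; ring⟩

theorem one_le₁ (h : Obst S) {l : ℝ × ℝ} (hl : l ∈ suppFun S) : 1 ≤ l.1 := by
  simpa using hl _ h.mem₁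

theorem one_le₂ (h : Obst S) {l : ℝ × ℝ} (hl : l ∈ suppFun S) : 1 ≤ l.2 := by
  simpa using hl _ h.mem₂

theorem one_le (h : Obst S) {l : ℝ × ℝ} (hl : l ∈ suppFun S) {τ : ℝ} (hτ : τ ∈ Icc (0:ℝ) 1) :
    1 ≤ (1 - τ) * l.1 + τ * l.2 := by
  nlinarith [h.one_le₁ hl, h.one_le₂ hl, hτ.1, hτ.2]

theorem exists_const (h : Obst S) : ∃ M : ℝ, 1 ≤ M ∧ ((M, M) : ℝ × ℝ) ∈ suppFun S := by
  obtain ⟨r, hr, h'⟩ := h.le_sum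
  have hmem : ((1 / r, 1 / r) : ℝ × ℝ) ∈ suppFun S := fun q hq => by
    have := h' q hq
    simp only
    rw [← add_mul, mul_one_div, le_div_iff₀ hr]
    linarith
  exact ⟨1 / r, h.one_le₁ hmem, hmem⟩

theorem hullW_le (h : Obst S) {l : ℝ × ℝ} (hl : l ∈ suppFun S) {τ : ℝ} (hτ : τ ∈ Icc (0:ℝ) 1) :
    hullW S τ ≤ (1 - τ) * l.1 + τ * l.2 :=
  csInf_le ⟨1, by rintro _ ⟨l, hl, rfl⟩; exact h.one_le hl hτ⟩ ⟨l, hl, rfl⟩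

theorem le_hullW (h : Obst S) {τ c : ℝ} (hc : ∀ l ∈ suppFun S, c ≤ (1 - τ) * l.1 + τ * l.2) :
    c ≤ hullW S τ := by
  obtain ⟨M, _, hM⟩ := h.exists_const
  refine le_csInf ⟨_, _, hM, rfl⟩ ?_
  rintro _ ⟨l, hl, rfl⟩
  exact hc l hl

theorem one_le_hullW (h : Obst S) {τ : ℝ} (hτ : τ ∈ Icc (0:ℝ) 1) : 1 ≤ hullW S τ :=
  h.le_hullW fun _ hl => h.one_le hl hτ

theorem concaveOn (h : Obst S) : ConcaveOn ℝ (Icc 0 1) (hullW S) := by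
  refine ⟨convex_Icc 0 1, fun s hs t ht a b ha hb hab => h.le_hullW fun l hl => ?_⟩
  have h1 := h.hullW_le hl hs
  have h2 := h.hullW_le hl ht
  simp only [smul_eq_mul]
  have e : (1 - (a * s + b * t)) * l.1 + (a * s + b * t) * l.2 =
      a * ((1 - s) * l.1 + s * l.2) + b * ((1 - t) * l.1 + t * l.2) := by
    linear_combination l.1 * (- hab)
  rw [e]
  gcongr

theorem isClosed_suppFun : IsClosed (suppFun S) := by
  have : suppFun S = ⋂ q ∈ S, {l : ℝ × ℝ | 1 ≤ q.1 * l.1 + q.2 * l.2} := by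
    ext l; simp [suppFun]
  rw [this]
  exact isClosed_biInter fun q _ => isClosed_le (by fun_prop) (by fun_prop)

theorem exists_supp (h : Obst S) {τ : ℝ} (hτ : τ ∈ Ioo (0:ℝ) 1) :
    ∃ l ∈ suppFun S, hullW S τ = (1 - τ) * l.1 + τ * l.2 := by
  obtain ⟨M, hM1, hM⟩ := h.exists_const
  have h1 : 0 < 1 - τ := by linarith [hτ.2]
  have h0 := hτ.1
  set K := suppFun S ∩ Icc ((1, 1) : ℝ × ℝ) (M / (1 - τ), M / τ) with hK
  have hKc : IsCompact K := isCompact_Icc.inter_left isClosed_suppFun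
  have hMK : ((M, M) : ℝ × ℝ) ∈ K := by
    refine ⟨hM, ⟨hM1, hM1⟩, ?_, ?_⟩
    · change M ≤ M / (1 - τ)
      rw [le_div_iff₀ h1]; nlinarith
    · change M ≤ M / τ
      rw [le_div_iff₀ h0]; nlinarith [hτ.2]
  obtain ⟨l, hl, hmin⟩ := hKc.exists_isMinOn ⟨_, hMK⟩
    (f := fun l : ℝ × ℝ => (1 - τ) * l.1 + τ * l.2) (by fun_prop)
  refine ⟨l, hl.1, le_antisymm (h.hullW_le hl.1 ⟨h0.le, hτ.2.le⟩) (h.le_hullW fun k hk => ?_)⟩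
  by_cases hkK : k ∈ K
  · exact hmin hkK
  · have hm := hmin hMK
    simp only [mem_ofPred_eq] at hm
    have k1 := h.one_le₁ hk
    have k2 := h.one_le₂ hk
    by_contra! hlt
    refine hkK ⟨hk, ⟨k1, k2⟩, ?_, ?_⟩
    · change k.1 ≤ M / (1 - τ)
      rw [le_div_iff₀ h1]; nlinarith
    · change k.2 ≤ M / τ
      rw [le_div_iff₀ h0]; nlinarith

theorem hullW_end₀ (h : Obst S) {κ : ℝ} (hκ : 0 < κ) :
    ∃ δ > 0, ∀ τ ∈ Icc (0:ℝ) 1, τ < δ → hullW S τ ≤ 1 + κ := by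
  obtain ⟨N, hN0, hN⟩ : ∃ N : ℝ, 0 < N ∧ ((1 + κ / 2, N) : ℝ × ℝ) ∈ suppFun S := by
    set K := S ∩ {q | q.1 * (1 + κ / 2) ≤ 1} with hK
    have hKc : IsCompact K := h.compact.inter_right (isClosed_le (by fun_prop) (by fun_prop))
    have pos : ∀ q ∈ K, 0 < q.2 := by
      intro q hq
      refine lt_of_le_of_ne (h.nonneg₂ q hq.1) fun h0 => ?_
      have h1 := h.axis₁ q hq.1 h0.symm
      have h2 : q.1 * (1 + κ / 2) ≤ 1 := hq.2
      rw [h1] at h2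
      linarith
    rcases K.eq_empty_or_nonempty with he | hne
    · refine ⟨1, one_pos, fun q hq => ?_⟩
      have hn : ¬ q.1 * (1 + κ / 2) ≤ 1 := fun h1 =>
        (he ▸ (⟨hq, h1⟩ : q ∈ K) : q ∈ (∅ : Set (ℝ × ℝ)))
      have := h.nonneg₂ q hq
      simp only
      linarith
    · obtain ⟨q0, hq0, hmin⟩ := hKc.exists_isMinOn hne (f := fun q : ℝ × ℝ => q.2) (by fun_prop)
      have p0 := pos q0 hq0
      refine ⟨1 / q0.2, by positivity, fun q hq => ?_⟩
      have n1 := h.nonneg₁ q hq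
      have n2 := h.nonneg₂ q hq
      by_cases hqK : q.1 * (1 + κ / 2) ≤ 1
      · have hm : q0.2 ≤ q.2 := hmin (⟨hq, hqK⟩ : q ∈ K)
        have : 1 ≤ q.2 * (1 / q0.2) := by rw [mul_one_div, le_div_iff₀ p0]; linarith
        simp only
        nlinarith
      · have : 0 ≤ q.2 * (1 / q0.2) := by positivity
        simp only
        linarith
  refine ⟨κ / (2 * N), by positivity, fun τ hτ hδ => ?_⟩
  have := h.hullW_le hN hτ
  rw [lt_div_iff₀ (by positivity)] at hδ
  simp only at this
  nlinarith [hτ.1, hτ.2]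

theorem hullW_end₁ (h : Obst S) {κ : ℝ} (hκ : 0 < κ) :
    ∃ δ > 0, ∀ τ ∈ Icc (0:ℝ) 1, 1 - δ < τ → hullW S τ ≤ 1 + κ := by
  obtain ⟨δ, hδ, h'⟩ := h.swap.hullW_end₀ hκ
  refine ⟨δ, hδ, fun τ hτ hlt => ?_⟩
  have := h' (1 - τ) ⟨by linarith [hτ.2], by linarith [hτ.1]⟩ (by linarith)
  rwa [hullW_swap, sub_sub_cancel] at this

theorem hullW_zero (h : Obst S) : hullW S 0 = 1 := by
  refine le_antisymm (le_of_forall_pos_le_add fun κ hκ => ?_) (h.one_le_hullW ⟨le_rfl, zero_le_one⟩)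
  obtain ⟨δ, hδ, h'⟩ := h.hullW_end₀ hκ
  exact h' 0 ⟨le_rfl, zero_le_one⟩ hδ

theorem hullW_one (h : Obst S) : hullW S 1 = 1 := by
  have := h.swap.hullW_zero
  rwa [hullW_swap, sub_zero] at this

theorem continuousOn (h : Obst S) : ContinuousOn (hullW S) (Icc 0 1) := by
  have hIoo : ContinuousOn (hullW S) (Ioo 0 1) :=
    (h.concaveOn.subset Ioo_subset_Icc_self (convex_Ioo 0 1)).continuousOn isOpen_Ioo
  intro τ hτ
  rcases eq_or_lt_of_le hτ.1 with rfl | h0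
  · rw [Metric.continuousWithinAt_iff]
    intro ε hε
    obtain ⟨δ, hδ, h'⟩ := h.hullW_end₀ (half_pos hε)
    refine ⟨δ, hδ, fun {t} ht hd => ?_⟩
    rw [Real.dist_eq, sub_zero, abs_of_nonneg ht.1] at hd
    have h1 := h' t ht hd
    have h2 := h.one_le_hullW ht
    rw [h.hullW_zero, Real.dist_eq, abs_of_nonneg (by linarith)]
    linarith
  rcases eq_or_lt_of_le hτ.2 with rfl | h1
  · rw [Metric.continuousWithinAt_iff]
    intro ε hε
    obtain ⟨δ, hδ, h'⟩ := h.hullW_end₁ (half_pos hε)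
    refine ⟨δ, hδ, fun {t} ht hd => ?_⟩
    rw [Real.dist_eq, abs_sub_comm, abs_of_nonneg (by linarith [ht.2])] at hd
    have h1 := h' t ht (by linarith)
    have h2 := h.one_le_hullW ht
    rw [h.hullW_one, Real.dist_eq, abs_of_nonneg (by linarith)]
    linarith
  · exact (hIoo.continuousAt (isOpen_Ioo.mem_nhds ⟨h0, h1⟩)).continuousWithinAt

theorem isClosed_hullE (h : Obst S) : IsClosed (hullE S) := by
  have hc : ContinuousOn (fun τ => dirPt τ (hullW S τ)) (Icc 0 1) := by
    have hne : ∀ τ ∈ Icc (0:ℝ) 1, hullW S τ ≠ 0 := fun τ hτ => by linarith [h.one_le_hullW hτ]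
    exact ((continuousOn_const.sub continuousOn_id).div h.continuousOn hne).prodMk
      (continuousOn_id.div h.continuousOn hne)
  exact hc.preimage_isClosed_of_isClosed isClosed_Icc h.compact.isClosed

theorem zero_mem (h : Obst S) : (0:ℝ) ∈ hullE S :=
  ⟨⟨le_rfl, zero_le_one⟩, by simpa [h.hullW_zero, dirPt] using h.mem₁⟩

theorem one_mem (h : Obst S) : (1:ℝ) ∈ hullE S :=
  ⟨⟨zero_le_one, le_rfl⟩, by simpa [h.hullW_one, dirPt] using h.mem₂⟩

theorem le_hullW_of_mem (h : Obst S) {τ w : ℝ} (hw : 0 < w) (hS : dirPt τ w ∈ S) :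
    w ≤ hullW S τ := by
  refine h.le_hullW fun l hl => ?_
  have := hl _ hS
  simp only [dirPt] at this
  rw [div_mul_eq_mul_div, div_mul_eq_mul_div, ← add_div, le_div_iff₀ hw] at this
  linarith

/-- Between consecutive contact directions the hull is flat. -/
theorem exists_gap (h : Obst S) {τ : ℝ} (hτ : τ ∈ Ioo (0:ℝ) 1) (hE : τ ∉ hullE S) :
    ∃ τ₁ ∈ hullE S, ∃ τ₂ ∈ hullE S, τ₁ < τ ∧ τ < τ₂ ∧ ∃ l ∈ suppFun S,
      hullW S τ₁ = (1 - τ₁) * l.1 + τ₁ * l.2 ∧ hullW S τ₂ = (1 - τ₂) * l.1 + τ₂ * l.2 ∧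
      ∀ t ∈ Ioo τ₁ τ₂, hullW S t = (1 - t) * l.1 + t * l.2 ∧ t ∉ hullE S := by
  obtain ⟨l, hl, hWl⟩ := h.exists_supp hτ
  set f : ℝ → ℝ := fun t => (1 - t) * l.1 + t * l.2 with hf
  have hfc : Continuous f := by fun_prop
  have hf1 : ∀ t ∈ Icc (0:ℝ) 1, 1 ≤ f t := fun t ht => h.one_le hl ht
  set Z := {t | t ∈ Icc (0:ℝ) 1 ∧ dirPt t (f t) ∈ S} with hZ
  have hZc : IsCompact Z := by
    have hc : ContinuousOn (fun t => dirPt t (f t)) (Icc 0 1) := by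
      have hne : ∀ τ ∈ Icc (0:ℝ) 1, f τ ≠ 0 := fun τ hτ => by linarith [hf1 τ hτ]
      exact ((continuousOn_const.sub continuousOn_id).div hfc.continuousOn hne).prodMk
        (continuousOn_id.div hfc.continuousOn hne)
    exact isCompact_Icc.of_isClosed_subset
      (hc.preimage_isClosed_of_isClosed isClosed_Icc h.compact.isClosed) fun t ht => ht.1
  have hZW : ∀ t ∈ Z, hullW S t = f t := fun t ht =>
    le_antisymm (h.hullW_le hl ht.1) (h.le_hullW_of_mem (by linarith [hf1 t ht.1]) ht.2)
  have hZE : ∀ t ∈ Z, t ∈ hullE S := fun t ht => ⟨ht.1, by rw [hZW t ht]; exact ht.2⟩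
  have hτZ : τ ∉ Z := fun hmem => hE (hZE τ hmem)
  -- rotating the support line
  have rot : ∀ d : ℝ × ℝ, (∀ t ∈ Z, 0 < (1 - t) * d.1 + t * d.2) →
      0 ≤ (1 - τ) * d.1 + τ * d.2 := by
    intro d hd
    by_contra! hneg
    set K := S ∩ {q | q.1 * d.1 + q.2 * d.2 ≤ 0} with hK
    have hKc : IsCompact K := h.compact.inter_right (isClosed_le (by fun_prop) (by fun_prop))
    have hpos : ∀ q ∈ K, 0 < q.1 * l.1 + q.2 * l.2 - 1 := by
      intro q hq
      refine lt_of_le_of_ne (by linarith [hl q hq.1]) fun h0 => ?_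
      have n1 := h.nonneg₁ q hq.1
      have n2 := h.nonneg₂ q hq.1
      obtain ⟨r, hr, hr'⟩ := h.le_sum
      have hs : 0 < q.1 + q.2 := hr.trans_le (hr' q hq.1)
      set t := q.2 / (q.1 + q.2) with ht
      have ht1 : 1 - t = q.1 / (q.1 + q.2) := by rw [ht]; field_simp; ring
      have htI : t ∈ Icc (0:ℝ) 1 :=
        ⟨by positivity, by rw [ht, div_le_one hs]; linarith⟩
      have hft : f t = 1 / (q.1 + q.2) := by
        simp only [hf, ht1]
        rw [ht, div_mul_eq_mul_div, div_mul_eq_mul_div, ← add_div]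
        congr 1
        linarith
      have htZ : t ∈ Z := by
        refine ⟨htI, ?_⟩
        have : dirPt t (f t) = q := by
          rw [hft, dirPt, ht1, ht]
          ext <;> simp <;> field_simp
        rw [this]; exact hq.1
      have := hd t htZ
      rw [ht1, ht, div_mul_eq_mul_div, div_mul_eq_mul_div, ← add_div] at this
      have h2 : q.1 * d.1 + q.2 * d.2 ≤ 0 := hq.2
      have := (div_pos_iff_of_pos_right hs).1 this
      linarith
    obtain ⟨c, hc0, hc⟩ : ∃ c > 0, ∀ q ∈ K, c ≤ q.1 * l.1 + q.2 * l.2 - 1 := by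
      rcases K.eq_empty_or_nonempty with he | hne
      · exact ⟨1, one_pos, fun q hq => by simp [he] at hq⟩
      · obtain ⟨q0, hq0, hmin⟩ := hKc.exists_isMinOn hne
          (f := fun q : ℝ × ℝ => q.1 * l.1 + q.2 * l.2 - 1) (by fun_prop)
        exact ⟨_, hpos q0 hq0, fun q hq => hmin hq⟩
    set M := |d.1| + |d.2| + 1 with hM
    have hM0 : 0 < M := by positivity
    have hnew : ((l.1 + c / M * d.1, l.2 + c / M * d.2) : ℝ × ℝ) ∈ suppFun S := by
      intro q hq
      have hcM : 0 < c / M := by positivity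
      simp only
      have e : q.1 * (l.1 + c / M * d.1) + q.2 * (l.2 + c / M * d.2) =
        (q.1 * l.1 + q.2 * l.2) + c / M * (q.1 * d.1 + q.2 * d.2) := by ring
      rw [e]
      by_cases hqK : q.1 * d.1 + q.2 * d.2 ≤ 0
      · have h1 := hc q ⟨hq, hqK⟩
        have n1 := h.nonneg₁ q hq
        have n2 := h.nonneg₂ q hq
        have n3 := h.sum_le q hq
        have h2 : -M ≤ q.1 * d.1 + q.2 * d.2 := by
          have a1 := neg_abs_le d.1
          have a2 := neg_abs_le d.2
          have a3 := abs_nonneg d.1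
          have a4 := abs_nonneg d.2
          nlinarith
        have h3 : -c ≤ c / M * (q.1 * d.1 + q.2 * d.2) := by
          calc -c = c / M * (-M) := by field_simp
            _ ≤ _ := by gcongr
        linarith
      · have := hl q hq
        have : 0 < c / M * (q.1 * d.1 + q.2 * d.2) := mul_pos hcM (not_le.1 hqK)
        linarith
    have h1 := h.hullW_le hnew ⟨hτ.1.le, hτ.2.le⟩
    rw [hWl] at h1
    have hcM : 0 < c / M := by positivity
    simp only at h1
    nlinarith
  have hleft : (Z ∩ Iic τ).Nonempty := by
    by_contra hcon
    have hall : ∀ t ∈ Z, τ < t := fun t ht => by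
      by_contra! hle
      exact hcon ⟨t, ht, hle⟩
    rcases Z.eq_empty_or_nonempty with he | hne
    · have := rot (-1, -1) (by simp [he])
      simp at this
      linarith
    · have hm := hZc.sInf_mem hne
      have hm' := hall _ hm
      have := rot (-(τ + sInf Z) / 2, 1 - (τ + sInf Z) / 2) fun t ht => by
        have := csInf_le hZc.bddBelow ht
        simp only
        nlinarith
      simp only at this
      nlinarith
  have hright : (Z ∩ Ici τ).Nonempty := by
    by_contra hcon
    have hall : ∀ t ∈ Z, t < τ := fun t ht => by
      by_contra! hle
      exact hcon ⟨t, ht, hle⟩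
    obtain ⟨t, ht, _⟩ := hleft
    have hm := hZc.sSup_mem ⟨t, ht⟩
    have hm' := hall _ hm
    have := rot ((τ + sSup Z) / 2, (τ + sSup Z) / 2 - 1) fun t ht => by
      have := le_csSup hZc.bddAbove ht
      simp only
      nlinarith
    simp only at this
    nlinarith
  have h1 := (hZc.inter_right (isClosed_Iic (a := τ))).sSup_mem hleft
  have h2 := (hZc.inter_right (isClosed_Ici (a := τ))).sInf_mem hright
  set τ₁ := sSup (Z ∩ Iic τ) with hτ₁
  set τ₂ := sInf (Z ∩ Ici τ) with hτ₂
  refine ⟨τ₁, hZE _ h1.1, τ₂, hZE _ h2.1, lt_of_le_of_ne h1.2 fun h' => hτZ (h' ▸ h1.1),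
    lt_of_le_of_ne h2.2 fun h' => hτZ (h' ▸ h2.1), l, hl, hZW _ h1.1, hZW _ h2.1, fun t ht => ?_⟩
  have htI : t ∈ Icc (0:ℝ) 1 := ⟨h1.1.1.1.trans ht.1.le, ht.2.le.trans h2.1.1.2⟩
  have hWt : hullW S t = f t := by
    refine le_antisymm (h.hullW_le hl htI) ?_
    have hlt : 0 < τ₂ - τ₁ := by linarith [ht.1, ht.2]
    have hcv := h.concaveOn.2 h1.1.1 h2.1.1 (div_nonneg (sub_nonneg.2 ht.2.le) hlt.le)
      (div_nonneg (sub_nonneg.2 ht.1.le) hlt.le) (by field_simp; ring)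
    rw [hZW _ h1.1, hZW _ h2.1] at hcv
    simp only [smul_eq_mul] at hcv
    have e1 : (τ₂ - t) / (τ₂ - τ₁) * τ₁ + (t - τ₁) / (τ₂ - τ₁) * τ₂ = t := by field_simp; ring
    rw [e1] at hcv
    refine le_trans (le_of_eq ?_) hcv
    simp only [hf]
    field_simp
    ring
  refine ⟨hWt, fun htE => ?_⟩
  have htZ : t ∈ Z := ⟨htI, by rw [← hWt]; exact htE.2⟩
  rcases le_total t τ with hle | hle
  · have := le_csSup (hZc.inter_right (isClosed_Iic (a := τ))).bddAbove
      (⟨htZ, hle⟩ : t ∈ Z ∩ Iic τ)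
    linarith [ht.1]
  · have := csInf_le (hZc.inter_right (isClosed_Ici (a := τ))).bddBelow
      (⟨htZ, hle⟩ : t ∈ Z ∩ Ici τ)
    linarith [ht.2]

end Obst

/-- The right tangent of a concave function. -/
theorem concaveOn_right_tangent {W : ℝ → ℝ} (hW : ConcaveOn ℝ (Icc 0 1) W) {τ₀ : ℝ}
    (hτ : τ₀ ∈ Ioo (0:ℝ) 1) :
    ∃ m : ℝ, (∀ σ ∈ Icc τ₀ 1, W σ ≤ W τ₀ + m * (σ - τ₀)) ∧
      ∀ η > 0, ∃ δ > 0, ∀ τ ∈ Icc τ₀ 1, τ < τ₀ + δ → W τ₀ + m * (τ - τ₀) - η * (τ - τ₀) ≤ W τ := by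
  have key : ∀ s ∈ Icc (0:ℝ) 1, ∀ t ∈ Icc (0:ℝ) 1, ∀ u, s < u → u < t →
      (W t - W u) / (t - u) ≤ (W u - W s) / (u - s) := fun s hs t ht u h1 h2 =>
    hW.slope_anti_adjacent hs ht h1 h2
  set T := (fun t => (W t - W τ₀) / (t - τ₀)) '' Ioc τ₀ 1 with hT
  have hbdd : BddAbove T := by
    refine ⟨(W τ₀ - W 0) / (τ₀ - 0), ?_⟩
    rintro _ ⟨t, ht, rfl⟩
    exact key 0 ⟨le_rfl, zero_le_one⟩ t ⟨hτ.1.le.trans ht.1.le, ht.2⟩ τ₀ hτ.1 ht.1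
  have hne : T.Nonempty := ⟨_, 1, ⟨hτ.2, le_rfl⟩, rfl⟩
  refine ⟨sSup T, fun σ hσ => ?_, fun η hη => ?_⟩
  · rcases eq_or_lt_of_le hσ.1 with rfl | hlt
    · simp
    · have := le_csSup hbdd ⟨σ, ⟨hlt, hσ.2⟩, rfl⟩
      rw [div_le_iff₀ (by linarith)] at this
      linarith
  · obtain ⟨_, ⟨t, ht, rfl⟩, hlt⟩ := exists_lt_of_lt_csSup hne (sub_lt_self (sSup T) hη)
    refine ⟨t - τ₀, by linarith [ht.1], fun τ hτ' h' => ?_⟩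
    rcases eq_or_lt_of_le hτ'.1 with rfl | hl
    · simp
    · have h1 := hW.neg.secant_mono (a := τ₀) (x := τ) (y := t) ⟨hτ.1.le, hτ.2.le⟩
        ⟨by linarith [hτ.1], hτ'.2⟩ ⟨hτ.1.le.trans ht.1.le, ht.2⟩ hl.ne' ht.1.ne' (by linarith)
      simp only [Pi.neg_apply, ← neg_sub', neg_div, neg_le_neg_iff] at h1
      have h2 : sSup T - η < (W τ - W τ₀) / (τ - τ₀) := hlt.trans_le h1
      rw [lt_div_iff₀ (by linarith)] at h2
      linarith

/-- The two tangents of a concave function. -/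
theorem concaveOn_tangent {W : ℝ → ℝ} (hW : ConcaveOn ℝ (Icc 0 1) W) {τ₀ : ℝ}
    (hτ : τ₀ ∈ Ioo (0:ℝ) 1) :
    ∃ K : ℝ, 0 ≤ K ∧ ∀ η > 0, ∃ δ > 0, ∀ τ ∈ Icc (0:ℝ) 1, |τ - τ₀| < δ → ∃ m : ℝ, |m| ≤ K ∧
      (∀ σ ∈ uIcc τ₀ τ, W σ ≤ W τ₀ + m * (σ - τ₀)) ∧
      W τ₀ + m * (τ - τ₀) - W τ ≤ η * |τ - τ₀| := by
  have hW' : ConcaveOn ℝ (Icc 0 1) fun t => W (1 - t) := by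
    refine ⟨convex_Icc 0 1, fun s hs t ht a b ha hb hab => ?_⟩
    have := hW.2 (x := 1 - s) (y := 1 - t) ⟨by linarith [hs.2], by linarith [hs.1]⟩
      ⟨by linarith [ht.2], by linarith [ht.1]⟩ ha hb hab
    have e : a • (1 - s) + b • (1 - t) = 1 - (a • s + b • t) := by
      simp only [smul_eq_mul]; linear_combination hab
    rw [e] at this
    exact this
  obtain ⟨m₁, h1, h1'⟩ := concaveOn_right_tangent hW hτ
  obtain ⟨m₂, h2, h2'⟩ := concaveOn_right_tangent hW' (τ₀ := 1 - τ₀)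
    ⟨by linarith [hτ.2], by linarith [hτ.1]⟩
  refine ⟨max |m₁| |m₂|, le_max_of_le_left (abs_nonneg _), fun η hη => ?_⟩
  obtain ⟨δ₁, hδ₁, g1⟩ := h1' η hη
  obtain ⟨δ₂, hδ₂, g2⟩ := h2' η hη
  refine ⟨min δ₁ δ₂, lt_min hδ₁ hδ₂, fun τ hτ' hlt => ?_⟩
  have l1 := hlt.trans_le (min_le_left _ _)
  have l2 := hlt.trans_le (min_le_right _ _)
  rcases le_total τ₀ τ with hle | hle
  · have ab : |τ - τ₀| = τ - τ₀ := abs_of_nonneg (by linarith)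
    rw [ab] at l1 ⊢
    refine ⟨m₁, le_max_left _ _, fun σ hσ => ?_, ?_⟩
    · rw [uIcc_of_le hle] at hσ
      exact h1 σ ⟨hσ.1, hσ.2.trans hτ'.2⟩
    · have := g1 τ ⟨hle, hτ'.2⟩ (by linarith)
      linarith
  · have ab : |τ - τ₀| = -(τ - τ₀) := abs_of_nonpos (by linarith)
    rw [ab] at l2 ⊢
    refine ⟨-m₂, by rw [abs_neg]; exact le_max_right _ _, fun σ hσ => ?_, ?_⟩
    · rw [uIcc_of_ge hle] at hσ
      have := h2 (1 - σ) ⟨by linarith [hσ.2], by linarith [hσ.1, hτ'.1]⟩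
      simp only [sub_sub_cancel] at this
      linarith
    · have := g2 (1 - τ) ⟨by linarith, by linarith [hτ'.1]⟩ (by linarith)
      simp only [sub_sub_cancel] at this
      linarith

/-- Continuous induction along a closed set: a pseudometric dominated infinitesimally and on gaps
by the increments of a function is dominated by its total increment. -/
theorem le_increment {E : Set ℝ} (hE : IsClosed E) (hsub : E ⊆ Icc 0 1) (h0 : (0:ℝ) ∈ E)
    (h1 : (1:ℝ) ∈ E) {m : ℝ → ℝ → ℝ} {θ : ℝ → ℝ}
    (tri : ∀ a ∈ E, ∀ b ∈ E, ∀ c ∈ E, m a c ≤ m a b + m b c)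
    (hθ : ∀ s ∈ Icc (0:ℝ) 1, ∀ t ∈ Icc (0:ℝ) 1, s ≤ t → θ s ≤ θ t)
    (gap : ∀ τ ∈ Ioo (0:ℝ) 1, τ ∉ E → ∃ τ₁ ∈ E, ∃ τ₂ ∈ E, τ₁ < τ ∧ τ < τ₂ ∧
      (∀ t ∈ Ioo τ₁ τ₂, t ∉ E) ∧ m τ₁ τ₂ ≤ θ τ₂ - θ τ₁)
    (loc : ∀ ε > 0, ∀ τ₀ ∈ E, τ₀ ∈ Ioo (0:ℝ) 1 → ∃ δ > 0, ∀ τ ∈ E, |τ - τ₀| < δ →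
      (τ₀ ≤ τ → m τ₀ τ ≤ (1 + ε) * (θ τ - θ τ₀)) ∧ (τ ≤ τ₀ → m τ τ₀ ≤ (1 + ε) * (θ τ₀ - θ τ)))
    (left : ∀ ε > 0, ∃ δ > 0, ∀ τ ∈ E, τ < δ → m 0 τ ≤ ε)
    (right : ∀ ε > 0, ∃ δ > 0, ∀ τ ∈ E, 1 - δ < τ → m τ 1 ≤ ε) : m 0 1 ≤ θ 1 - θ 0 := by
  have main : ∀ ε > 0, m 0 1 ≤ (1 + ε) * (θ 1 - θ 0) + 2 * ε := by
    intro ε hε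
    set T := {t | t ∈ E ∧ m 0 t ≤ (1 + ε) * (θ t - θ 0) + ε} with hT
    have hmono : ∀ s ∈ E, ∀ t ∈ E, s ≤ t → (1 + ε) * (θ s - θ 0) ≤ (1 + ε) * (θ t - θ 0) := by
      intro s hs t ht hst
      have := hθ s (hsub hs) t (hsub ht) hst
      gcongr
    obtain ⟨δl, hδl, hl⟩ := left ε hε
    obtain ⟨δr, hδr, hr⟩ := right ε hε
    have h0T : (0:ℝ) ∈ T := ⟨h0, by simpa using hl 0 h0 hδl⟩
    have hTb : BddAbove T := ⟨1, fun t ht => (hsub ht.1).2⟩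
    set s := sSup T with hs
    have hsE : s ∈ E := closure_minimal (fun t ht => ht.1) hE (csSup_mem_closure ⟨0, h0T⟩ hTb)
    have hs01 := hsub hsE
    have app : ∀ δ > 0, ∃ t ∈ T, s - δ < t ∧ t ≤ s := fun δ hδ => by
      obtain ⟨t, ht, hlt⟩ := exists_lt_of_lt_csSup ⟨0, h0T⟩ (sub_lt_self s hδ)
      exact ⟨t, ht, hlt, le_csSup hTb ht⟩
    rcases eq_or_lt_of_le hs01.2 with h1s | hs1
    · obtain ⟨t, ht, hlt, hle⟩ := app δr hδr
      have e1 := tri 0 h0 t ht.1 1 h1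
      have e2 := hr t ht.1 (by linarith)
      have e3 := hmono t ht.1 1 h1 (by linarith)
      linarith [ht.2]
    · exfalso
      have hsT : s ∈ T := by
        rcases eq_or_lt_of_le hs01.1 with h | h
        · rw [← h]; exact h0T
        · obtain ⟨δ, hδ, hloc⟩ := loc ε hε s hsE ⟨h, hs1⟩
          obtain ⟨t, ht, hlt, hle⟩ := app δ hδ
          refine ⟨hsE, ?_⟩
          have e1 := tri 0 h0 t ht.1 s hsE
          have e2 := (hloc t ht.1 (by rw [abs_of_nonpos (by linarith)]; linarith)).2 hle
          linarith [ht.2]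
      obtain ⟨δ, hδ, hnear⟩ : ∃ δ > 0, ∀ t ∈ E, s < t → t < s + δ → t ∈ T := by
        rcases eq_or_lt_of_le hs01.1 with h | h
        · refine ⟨δl, hδl, fun t ht h1 h2 => ⟨ht, ?_⟩⟩
          have e1 := hl t ht (by linarith)
          have e2 := hmono 0 h0 t ht (by linarith)
          simp only [sub_self, mul_zero] at e2
          linarith
        · obtain ⟨δ, hδ, hloc⟩ := loc ε hε s hsE ⟨h, hs1⟩
          refine ⟨δ, hδ, fun t ht h1 h2 => ⟨ht, ?_⟩⟩
          have e1 := tri 0 h0 s hsE t ht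
          have e2 := (hloc t ht (by rw [abs_of_pos (by linarith)]; linarith)).1 h1.le
          linarith [hsT.2]
      have hno : ∀ t ∈ T, t ≤ s := fun t ht => le_csSup hTb ht
      set τ := (s + min (s + δ) 1) / 2 with hτ
      have m1 := min_le_left (s + δ) 1
      have m2 := min_le_right (s + δ) 1
      have m3 : s < min (s + δ) 1 := lt_min (by linarith) hs1
      have hτE : τ ∉ E := fun h => by
        have := hno _ (hnear τ h (by linarith) (by linarith))
        linarith
      obtain ⟨τ₁, e1, τ₂, e2, l1, l2, hg, hm⟩ := gap τ ⟨by linarith [hs01.1], by linarith⟩ hτE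
      have h1' : τ₁ ≤ s := by
        by_contra! hc
        have := hno _ (hnear τ₁ e1 hc (by linarith))
        linarith
      have h2' : τ₁ = s := by
        by_contra hne
        exact hg s ⟨lt_of_le_of_ne h1' hne, by linarith⟩ hsE
      rw [h2'] at hm e1
      have : τ₂ ∈ T := ⟨e2, by
        have t1 := tri 0 h0 s hsE τ₂ e2
        have t2 := hθ s hs01 τ₂ (hsub e2) (by linarith)
        have t3 : 0 ≤ ε * (θ τ₂ - θ s) := mul_nonneg hε.le (by linarith)
        linarith [hsT.2]⟩
      have := hno _ this
      linarith
  have hpos := hθ 0 ⟨le_rfl, zero_le_one⟩ 1 ⟨zero_le_one, le_rfl⟩ zero_le_one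
  refine le_of_forall_pos_le_add fun κ hκ => ?_
  have hC : 0 < θ 1 - θ 0 + 2 := by linarith
  have := main (κ / (θ 1 - θ 0 + 2)) (by positivity)
  have e : (1 + κ / (θ 1 - θ 0 + 2)) * (θ 1 - θ 0) + 2 * (κ / (θ 1 - θ 0 + 2)) =
      θ 1 - θ 0 + κ := by field_simp; ring
  linarith

section Angles
open InnerProductGeometry
variable {V : Type*} [NormedAddCommGroup V] [InnerProductSpace ℝ V]

theorem inner_le_of_norm_sub_le {u u' v v' : V} (h : ‖v‖ = ‖u‖) (h' : ‖v'‖ = ‖u'‖)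
    (hd : ‖v - v'‖ ≤ ‖u - u'‖) : inner ℝ u u' ≤ inner ℝ v v' := by
  have e1 := norm_sub_sq_real v v'
  have e2 := norm_sub_sq_real u u'
  have : ‖v - v'‖ ^ 2 ≤ ‖u - u'‖ ^ 2 := by gcongr
  rw [h, h'] at e1
  linarith

theorem norm_sub_le_of_inner_le {u u' v v' : V} (h : ‖v‖ = ‖u‖) (h' : ‖v'‖ = ‖u'‖)
    (hd : inner ℝ u u' ≤ inner ℝ v v') : ‖v - v'‖ ≤ ‖u - u'‖ := by
  have e1 := norm_sub_sq_real v v'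
  have e2 := norm_sub_sq_real u u'
  rw [h, h'] at e1
  exact le_of_sq_le_sq (by linarith) (norm_nonneg _)

theorem angle_le_of_inner_le {u u' v v' : V} (h : ‖v‖ = ‖u‖) (h' : ‖v'‖ = ‖u'‖)
    (hd : inner ℝ u u' ≤ inner ℝ v v') : angle v v' ≤ angle u u' := by
  unfold angle
  rw [h, h']
  exact Real.antitone_arccos (by gcongr)

theorem inner_le_of_angle_le {u u' v v' : V} (h : ‖v‖ = ‖u‖) (h' : ‖v'‖ = ‖u'‖)
    (hd : angle v v' ≤ angle u u') : inner ℝ u u' ≤ inner ℝ v v' := by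
  rw [← cos_angle_mul_norm_mul_norm, ← cos_angle_mul_norm_mul_norm v v', h, h']
  gcongr
  exact Real.cos_le_cos_of_nonneg_of_le_pi (angle_nonneg _ _) (angle_le_pi _ _) hd

/-- The law of cosines in terms of half the angle. -/
theorem sq_sin_half_angle (u v : V) :
    4 * (‖u‖ * ‖v‖) * Real.sin (angle u v / 2) ^ 2 = ‖u - v‖ ^ 2 - (‖u‖ - ‖v‖) ^ 2 := by
  have h1 := norm_sub_sq_real u v
  rw [← cos_angle_mul_norm_mul_norm] at h1
  have h2 := Real.cos_sq (angle u v / 2)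
  have h3 := Real.sin_sq_add_cos_sq (angle u v / 2)
  rw [mul_div_cancel₀ _ (two_ne_zero)] at h2
  have h4 : Real.sin (angle u v / 2) ^ 2 = (1 - Real.cos (angle u v)) / 2 := by linarith
  rw [h4, h1]
  ring

set_option maxHeartbeats 1000000 in
/-- Vectors whose distances are almost those of given ones make an angle that is almost at most
the given angle. -/
theorem exists_angle_le (K : ℝ) {ε c₀ c₁ : ℝ} (hε : 0 < ε) (hc₀ : 0 < c₀) (hc₁ : 0 < c₁)
    (hK : 0 ≤ K) :
    ∃ κ > 0, ∃ δ > 0, ∀ Δ : ℝ, 0 ≤ Δ → Δ < δ → ∀ u₀ u v₀ v : V, ‖v₀‖ = ‖u₀‖ → ‖v‖ = ‖u‖ →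
      ‖v₀ - v‖ ≤ ‖u₀ - u‖ + κ * Δ → ‖u₀ - u‖ ≤ K * Δ → c₀ ≤ ‖u₀‖ * ‖u‖ →
      c₁ * Δ ^ 2 ≤ ‖u₀ - u‖ ^ 2 - (‖u₀‖ - ‖u‖) ^ 2 → angle v₀ v ≤ (1 + ε) * angle u₀ u := by
  set e := min 1 (ε / 3) with he
  have he0 : 0 < e := by positivity
  have he1 : e ≤ 1 := min_le_left _ _
  have he2 : e ≤ ε / 3 := min_le_right _ _
  have hK1 : 0 < 2 * K + 1 := by linarith
  have hK2 : 0 < 4 * K ^ 2 + 1 := by positivity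
  set κ := min 1 (e * c₁ / (2 * K + 1)) with hκ
  have hκ1 : κ ≤ 1 := min_le_left _ _
  have hκ2 : κ * (2 * K + 1) ≤ e * c₁ := by
    rw [← le_div_iff₀ hK1]; exact min_le_right _ _
  have hκ0 : 0 < κ := by positivity
  set δ := min 1 (e * c₀ / (4 * K ^ 2 + 1)) with hδ
  have hδ1 : δ ≤ 1 := min_le_left _ _
  have hδ2 : δ * (4 * K ^ 2 + 1) ≤ e * c₀ := by
    rw [← le_div_iff₀ hK2]; exact min_le_right _ _
  refine ⟨κ, hκ0, δ, by positivity, fun Δ hΔ hΔδ u₀ u v₀ v h0 h hd hdK hN hA => ?_⟩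
  have s1 := sq_sin_half_angle u₀ u
  have s2 := sq_sin_half_angle v₀ v
  rw [h0, h] at s2
  set N := ‖u₀‖ * ‖u‖
  set A := ‖u₀ - u‖ ^ 2 - (‖u₀‖ - ‖u‖) ^ 2
  set φ := angle u₀ u
  set φ' := angle v₀ v
  set s := Real.sin (φ / 2)
  set s' := Real.sin (φ' / 2)
  have hN0 : 0 < N := hc₀.trans_le hN
  have hφ0 : 0 ≤ φ := angle_nonneg _ _
  have hφπ : φ ≤ Real.pi := angle_le_pi _ _
  have hφ'0 : 0 ≤ φ' := angle_nonneg _ _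
  have hφ'π : φ' ≤ Real.pi := angle_le_pi _ _
  have hs0 : 0 ≤ s := Real.sin_nonneg_of_nonneg_of_le_pi (by linarith) (by linarith)
  have hs'0 : 0 ≤ s' := Real.sin_nonneg_of_nonneg_of_le_pi (by linarith) (by linarith)
  have d0 := norm_nonneg (u₀ - u)
  have hd2 : ‖v₀ - v‖ ^ 2 ≤ (‖u₀ - u‖ + κ * Δ) ^ 2 := by gcongr
  have hA' : ‖v₀ - v‖ ^ 2 - (‖u₀‖ - ‖u‖) ^ 2 ≤ (1 + e) * A := by
    have t1 : ‖u₀ - u‖ * (κ * Δ) ≤ K * Δ * (κ * Δ) := by gcongr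
    have t2 : κ * (2 * K + 1) * Δ ^ 2 ≤ e * c₁ * Δ ^ 2 := by gcongr
    have t5 : κ ^ 2 ≤ κ := by nlinarith
    have t3 : κ ^ 2 * Δ ^ 2 ≤ κ * Δ ^ 2 := by gcongr
    have t4 : e * (c₁ * Δ ^ 2) ≤ e * A := by gcongr
    have : (‖u₀ - u‖ + κ * Δ) ^ 2 - (‖u₀‖ - ‖u‖) ^ 2 =
      A + 2 * (‖u₀ - u‖ * (κ * Δ)) + κ ^ 2 * Δ ^ 2 := by simp only [A]; ring
    linarith
  have hss : s' ≤ (1 + e) * s := by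
    refine le_of_sq_le_sq ?_ (by positivity)
    rw [← s2, ← s1] at hA'
    have : 4 * N * s' ^ 2 ≤ 4 * N * ((1 + e) * s ^ 2) := by linarith
    have := le_of_mul_le_mul_left this (by positivity)
    have h5 : 0 ≤ e * (1 + e) * s ^ 2 := by positivity
    have h6 : ((1 + e) * s) ^ 2 = (1 + e) * s ^ 2 + e * (1 + e) * s ^ 2 := by ring
    linarith
  have hsmall : 16 * s ^ 2 ≤ e := by
    have t1 : ‖u₀ - u‖ ^ 2 ≤ (K * Δ) ^ 2 := by gcongr
    have t2 : 4 * N * s ^ 2 ≤ (K * Δ) ^ 2 := by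
      rw [s1]
      have := sq_nonneg (‖u₀‖ - ‖u‖)
      simp only [A]
      linarith
    have t3 : c₀ * s ^ 2 ≤ N * s ^ 2 := by gcongr
    have t5 : Δ ^ 2 ≤ δ := by nlinarith
    have t6 : 4 * K ^ 2 * Δ ^ 2 ≤ 4 * K ^ 2 * δ := by gcongr
    have t4 : 4 * K ^ 2 * Δ ^ 2 ≤ e * c₀ := by linarith
    have : c₀ * (16 * s ^ 2) ≤ c₀ * e := by linarith
    exact le_of_mul_le_mul_left this hc₀
  have hπ := Real.pi_le_four
  have hπ0 := Real.pi_pos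
  have hj : φ' / 2 ≤ 2 * s' := by
    have := Real.mul_le_sin (x := φ' / 2) (by linarith) (by linarith)
    rw [div_mul_eq_mul_div, div_le_iff₀ hπ0] at this
    have t : s' * Real.pi ≤ s' * 4 := by gcongr
    linarith
  have hsq : (φ' / 2) ^ 2 ≤ e := by
    have : φ' / 2 ≤ 4 * s := by nlinarith
    have : (φ' / 2) ^ 2 ≤ (4 * s) ^ 2 := by gcongr
    linarith
  have hfin : φ' / 2 ≤ (1 + e) * s' := by
    rcases eq_or_lt_of_le hφ'0 with h0 | h0
    · rw [← h0, zero_div]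
      positivity
    · have hx1 : φ' / 2 ≤ 1 := by nlinarith
      have := Real.sin_gt_sub_cube (x := φ' / 2) (by linarith)
      have t1 : φ' / 2 * (1 - e / 4) ≤ s' := by
        refine le_trans ?_ this.le
        nlinarith
      have t2 : (1 + e) * (φ' / 2 * (1 - e / 4)) ≤ (1 + e) * s' := by gcongr
      nlinarith [mul_nonneg (mul_nonneg he0.le h0.le) (sub_nonneg.2 he1)]
  have hsφ : s ≤ φ / 2 := Real.sin_le (by linarith)
  have t1 : (1 + e) * s' ≤ (1 + e) * ((1 + e) * (φ / 2)) := by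
    gcongr
    refine hss.trans ?_
    gcongr
  have t2 : (1 + e) * (1 + e) ≤ 1 + ε := by nlinarith
  have t3 : (1 + e) * (1 + e) * φ ≤ (1 + ε) * φ := by gcongr
  linarith

/-- A lower bound for the excess of a squared distance over the squared difference of norms. -/
theorem gram_le_mul_excess {a b : V} (α₀ β₀ α β : ℝ) :
    (α₀ * β - α * β₀) ^ 2 * (‖a‖ ^ 2 * ‖b‖ ^ 2 - inner ℝ a b ^ 2) ≤
      ‖α₀ • a + β₀ • b‖ * ‖α • a + β • b‖ *
        (‖(α₀ • a + β₀ • b) - (α • a + β • b)‖ ^ 2 -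
          (‖α₀ • a + β₀ • b‖ - ‖α • a + β • b‖) ^ 2) := by
  set u₀ := α₀ • a + β₀ • b with h0
  set u := α • a + β • b with h
  have e1 := norm_sub_sq_real u₀ u
  have e2 : ‖u₀‖ ^ 2 * ‖u‖ ^ 2 - inner ℝ u₀ u ^ 2 =
      (α₀ * β - α * β₀) ^ 2 * (‖a‖ ^ 2 * ‖b‖ ^ 2 - inner ℝ a b ^ 2) := by
    simp only [← real_inner_self_eq_norm_sq, h0, h, inner_add_left, inner_add_right,
      real_inner_smul_left, real_inner_smul_right, real_inner_comm a b]
    ring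
  rw [← e2, e1]
  have := abs_le.1 (abs_real_inner_le_norm u₀ u)
  have n1 := norm_nonneg u₀
  have n2 := norm_nonneg u
  nlinarith [mul_nonneg n1 n2]

/-- Angles add up along a segment. -/
theorem angle_lineMap_add {a b : V} (hab : ∀ s t : ℝ, s • a + t • b = 0 → s = 0 ∧ t = 0) {s t : ℝ}
    (hs : 0 ≤ s) (hst : s ≤ t) :
    angle ((1 - s) • a + s • b) ((1 - t) • a + t • b) =
      angle a ((1 - t) • a + t • b) - angle a ((1 - s) • a + s • b) := by
  have hne : ∀ s : ℝ, (1 - s) • a + s • b ≠ 0 := fun s h => by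
    have := hab _ _ h
    linarith
  rcases eq_or_lt_of_le hs with rfl | hs
  · have := hne 0
    simp only [sub_zero, one_smul, zero_smul, add_zero] at this ⊢
    rw [angle_self this, sub_zero]
  rcases eq_or_lt_of_le hst with rfl | hst
  · rw [angle_self (hne s), sub_self]
  have hinj : ∀ p q : ℝ, (1 - p) • a + p • b = (1 - q) • a + q • b → p = q := fun p q h => by
    have := hab (q - p) (p - q) (by
      rw [← sub_eq_zero] at h; rw [← h]; module)
    linarith
  have hS : Sbtw ℝ a ((1 - s) • a + s • b) ((1 - t) • a + t • b) := by
    refine ⟨⟨s / t, ⟨(div_pos hs (hs.trans hst)).le, (div_le_one (hs.trans hst)).2 hst.le⟩, ?_⟩, fun h => ?_,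
      fun h => hst.ne (hinj _ _ h)⟩
    · rw [AffineMap.lineMap_apply_module]
      have ht : t ≠ 0 := (hs.trans hst).ne'
      have : s = s / t * t := by field_simp
      conv_rhs => rw [this]
      module
    · exact hs.ne' (hinj s 0 (by rw [h]; simp))
  have := EuclideanGeometry.angle_add_angle_eq_of_sbtw (p := (0:V)) hS
  simp only [EuclideanGeometry.angle, vsub_eq_sub, sub_zero] at this
  linarith

end Angles

namespace Dom
variable {X : Type} [MetricSpace X] {A : Dom X}

variable (A) in
/-- The point of the sector at `y` with given affine coordinates. -/
def sec (x y z : X) (q : ℝ × ℝ) : Euc 2 := A.p y + (q.1 • (A.p x - A.p y) + q.2 • (A.p z - A.p y))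

variable (A) in
/-- The obstacles in the triangle spanned by the sector at `y`. -/
def obs (x y z : X) : Set (ℝ × ℝ) :=
  {q | 0 ≤ q.1 ∧ 0 ≤ q.2 ∧ 0 < q.1 + q.2 ∧ q.1 + q.2 ≤ 1 ∧ A.sec x y z q ∉ A.U}

theorem sec_smul (x y z : X) (s : ℝ) (q : ℝ × ℝ) :
    A.p y + s • (q.1 • (A.p x - A.p y) + q.2 • (A.p z - A.p y)) = A.sec x y z (s • q) := by
  simp only [sec, Prod.smul_fst, Prod.smul_snd, smul_eq_mul]
  module

theorem sec_lineMap (x y z : X) (q q' : ℝ × ℝ) (t : ℝ) :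
    AffineMap.lineMap (A.sec x y z q) (A.sec x y z q') t =
      A.sec x y z ((1 - t) * q.1 + t * q'.1, (1 - t) * q.2 + t * q'.2) := by
  simp only [sec, AffineMap.lineMap_apply_module']
  module

theorem sec_sub (x y z : X) (q q' : ℝ × ℝ) : A.sec x y z q - A.sec x y z q' =
    (q.1 - q'.1) • (A.p x - A.p y) + (q.2 - q'.2) • (A.p z - A.p y) := by
  simp only [sec]; module

theorem dist_sec_le (x y z : X) (q q' : ℝ × ℝ) : dist (A.sec x y z q) (A.sec x y z q') ≤
    |q.1 - q'.1| * ‖A.p x - A.p y‖ + |q.2 - q'.2| * ‖A.p z - A.p y‖ := by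
  rw [dist_eq_norm, sec_sub]
  refine (norm_add_le _ _).trans ?_
  rw [norm_smul, norm_smul, Real.norm_eq_abs, Real.norm_eq_abs]

theorem continuous_sec (x y z : X) : Continuous (A.sec x y z) := by
  unfold sec; fun_prop

theorem dirPt_nonneg {τ w : ℝ} (hτ : τ ∈ Icc (0:ℝ) 1) (hw : 0 < w) :
    0 ≤ (dirPt τ w).1 ∧ 0 ≤ (dirPt τ w).2 ∧ (dirPt τ w).1 + (dirPt τ w).2 = 1 / w := by
  refine ⟨div_nonneg (by linarith [hτ.2]) hw.le, div_nonneg hτ.1 hw.le, ?_⟩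
  simp only [dirPt]
  rw [← add_div]; ring_nf

variable (A) in
/-- The point in direction `τ` of the line where the functional `l` is `1`. -/
def ln (x y z : X) (l : ℝ × ℝ) (τ : ℝ) : Euc 2 := A.sec x y z (dirPt τ ((1 - τ) * l.1 + τ * l.2))

theorem exists_dirPt {l : ℝ × ℝ} {τ₁ τ₂ c : ℝ} (h1 : 0 < (1 - τ₁) * l.1 + τ₁ * l.2)
    (h2 : 0 < (1 - τ₂) * l.1 + τ₂ * l.2) (hc : c ∈ Icc (0:ℝ) 1) :
    ∃ σ ∈ uIcc τ₁ τ₂, ((1 - c) * (dirPt τ₁ ((1 - τ₁) * l.1 + τ₁ * l.2)).1 +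
        c * (dirPt τ₂ ((1 - τ₂) * l.1 + τ₂ * l.2)).1,
      (1 - c) * (dirPt τ₁ ((1 - τ₁) * l.1 + τ₁ * l.2)).2 +
        c * (dirPt τ₂ ((1 - τ₂) * l.1 + τ₂ * l.2)).2) = dirPt σ ((1 - σ) * l.1 + σ * l.2) := by
  set w₁ := (1 - τ₁) * l.1 + τ₁ * l.2 with hw1
  set w₂ := (1 - τ₂) * l.1 + τ₂ * l.2 with hw2
  have c0 := hc.1
  have c1 : 0 ≤ 1 - c := by linarith [hc.2]
  have hs : 0 < (1 - c) * w₂ + c * w₁ := by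
    rcases eq_or_lt_of_le c0 with rfl | c0
    · simpa using h2
    · have := mul_nonneg c1 h2.le
      have := mul_pos c0 h1
      linarith
  set s := (1 - c) * w₂ + c * w₁ with hs'
  have hσ : ((1 - c) * w₂ / s) * τ₁ + (c * w₁ / s) * τ₂ = ((1 - c) * w₂ * τ₁ + c * w₁ * τ₂) / s := by
    field_simp
  refine ⟨((1 - c) * w₂ * τ₁ + c * w₁ * τ₂) / s, ?_, ?_⟩
  · rw [← segment_eq_uIcc, ← hσ]
    exact ⟨_, _, div_nonneg (mul_nonneg c1 h2.le) hs.le, div_nonneg (mul_nonneg c0 h1.le) hs.le,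
      by rw [← add_div]; exact div_self hs.ne', rfl⟩
  · have hw : (1 - ((1 - c) * w₂ * τ₁ + c * w₁ * τ₂) / s) * l.1 +
        ((1 - c) * w₂ * τ₁ + c * w₁ * τ₂) / s * l.2 = w₁ * w₂ / s := by
      have e : ∀ p q : ℝ, (1 - p / s) * l.1 + p / s * l.2 = (s * l.1 + p * (l.2 - l.1)) / s := by
        intro p q; field_simp; ring
      rw [e _ 0]
      congr 1
      rw [hs', hw1, hw2]
      ring
    rw [hw]
    ext
    · simp only [dirPt]
      field_simp
      rw [hs']; ring
    · simp only [dirPt]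
      field_simp
      try ring

namespace Angle
variable {x y z : X}

theorem obst (h : A.Angle x y z) : Obst (A.obs x y z) where
  compact := by
    obtain ⟨r, hr, hc⟩ := h.clean
    have e : A.obs x y z = Icc ((0, 0) : ℝ × ℝ) (1, 1) ∩
        ({q | r ≤ q.1 + q.2} ∩ {q | q.1 + q.2 ≤ 1} ∩ A.sec x y z ⁻¹' A.Uᶜ) := by
      ext q
      constructor
      · rintro ⟨h1, h2, h3, h4, h5⟩
        refine ⟨⟨⟨h1, h2⟩, ⟨by simp only; linarith, by simp only; linarith⟩⟩, ⟨?_, h4⟩, h5⟩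
        by_contra hlt
        exact h5 (hc _ _ h1 h2 h3 (not_le.1 hlt).le)
      · rintro ⟨⟨⟨h1, h2⟩, _⟩, ⟨h3, h4⟩, h5⟩
        exact ⟨h1, h2, hr.trans_le h3, h4, h5⟩
    rw [e]
    refine isCompact_Icc.inter_right (((isClosed_le ?_ ?_).inter (isClosed_le ?_ ?_)).inter
      (A.isOpen.isClosed_compl.preimage (continuous_sec x y z))) <;> fun_prop
  nonneg₁ q hq := hq.1
  nonneg₂ q hq := hq.2.1
  sum_le q hq := hq.2.2.2.1
  le_sum := by
    obtain ⟨r, hr, hc⟩ := h.clean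
    refine ⟨r, hr, fun q hq => ?_⟩
    by_contra hlt
    exact hq.2.2.2.2 (hc _ _ hq.1 hq.2.1 hq.2.2.1 (not_le.1 hlt).le)
  mem₁ := ⟨by simp, by simp, by simp, by simp, fun hU => h.hx (by simpa [sec] using hU)⟩
  mem₂ := ⟨by simp, by simp, by simp, by simp, fun hU => h.hz (by simpa [sec] using hU)⟩
  axis₁ q hq h0 := by
    obtain ⟨h1, h2, h3, h4, h5⟩ := hq
    by_contra hne
    rw [h0, add_zero] at h3 h4
    refine h5 (h.sx.2 _ ?_).1
    rw [openSegment_eq_image_lineMap]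
    refine ⟨q.1, ⟨h3, lt_of_le_of_ne h4 hne⟩, ?_⟩
    rw [AffineMap.lineMap_apply_module', sec, h0]
    module
  axis₂ q hq h0 := by
    obtain ⟨h1, h2, h3, h4, h5⟩ := hq
    by_contra hne
    rw [h0, zero_add] at h3 h4
    refine h5 (h.sz.2 _ ?_).1
    rw [openSegment_eq_image_lineMap]
    refine ⟨q.2, ⟨h3, lt_of_le_of_ne h4 hne⟩, ?_⟩
    rw [AffineMap.lineMap_apply_module', sec, h0]
    module

theorem sec_mem_of_lt (h : A.Angle x y z) {q l : ℝ × ℝ} (h1 : 0 ≤ q.1) (h2 : 0 ≤ q.2)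
    (h0 : 0 < q.1 + q.2) (hl : l ∈ suppFun (A.obs x y z)) (hlt : q.1 * l.1 + q.2 * l.2 < 1) :
    A.sec x y z q ∈ A.U := by
  by_contra hU
  have l1 := h.obst.one_le₁ hl
  have l2 := h.obst.one_le₂ hl
  have := hl q ⟨h1, h2, h0, by nlinarith, hU⟩
  linarith

theorem sec_dirPt_mem (h : A.Angle x y z) {τ w : ℝ} (hτ : τ ∈ Icc (0:ℝ) 1)
    (hw : hullW (A.obs x y z) τ < w) : A.sec x y z (dirPt τ w) ∈ A.U := by
  have hw0 : 0 < w := by linarith [h.obst.one_le_hullW hτ]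
  obtain ⟨M, _, hM⟩ := h.obst.exists_const
  obtain ⟨_, ⟨l, hl, rfl⟩, hlt⟩ := exists_lt_of_csInf_lt (Nonempty.image _ ⟨_, hM⟩) hw
  obtain ⟨d1, d2, d3⟩ := dirPt_nonneg hτ hw0
  refine h.sec_mem_of_lt d1 d2 (by rw [d3]; positivity) hl ?_
  simp only [dirPt]
  rw [div_mul_eq_mul_div, div_mul_eq_mul_div, ← add_div, div_lt_one hw0]
  exact hlt

end Angle

variable (A) in
/-- The element where the hull of the obstacles meets the boundary in direction `τ`. -/
structure Hit (x y z : X) (τ : ℝ) (u : X) : Prop where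
  mem : τ ∈ hullE (A.obs x y z)
  bd : u ∈ A.Bd
  p_eq : A.p u = A.sec x y z (dirPt τ (hullW (A.obs x y z) τ))
  sees : A.Sees y u

theorem dirPt_smul {τ w c : ℝ} : (c⁻¹) • dirPt τ w = dirPt τ (c * w) := by
  simp only [dirPt, Prod.smul_mk, smul_eq_mul, Prod.mk.injEq]
  constructor <;> · rw [div_eq_mul_inv, div_eq_mul_inv, mul_inv]; ring

variable {x y z : X}

theorem Angle.exists_hit [CompleteSpace X] (h : A.Angle x y z) {τ : ℝ}
    (hτ : τ ∈ hullE (A.obs x y z)) : ∃ u, A.Hit x y z τ u := by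
  have hW := h.obst.one_le_hullW hτ.1
  obtain ⟨d1, d2, d3⟩ := dirPt_nonneg hτ.1 (w := hullW (A.obs x y z) τ) (by linarith)
  obtain ⟨u, hu, hp, hs⟩ := h.exists_elem d1 d2 (by rw [d3]; positivity)
    (fun s h0 h1 => by
      rw [sec_smul, ← inv_inv s, dirPt_smul]
      refine h.sec_dirPt_mem hτ.1 ?_
      exact lt_mul_of_one_lt_left (by linarith) ((one_lt_inv₀ h0).2 h1)) hτ.2.2.2.2.2
  exact ⟨u, hτ, hu, hp, hs⟩

theorem Angle.hit_zero (h : A.Angle x y z) : A.Hit x y z 0 x where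
  mem := h.obst.zero_mem
  bd := h.hx
  p_eq := by rw [h.obst.hullW_zero]; simp [sec, dirPt]
  sees := h.sx

theorem Angle.hit_one (h : A.Angle x y z) : A.Hit x y z 1 z where
  mem := h.obst.one_mem
  bd := h.hz
  p_eq := by rw [h.obst.hullW_one]; simp [sec, dirPt]
  sees := h.sz

/-- Points of a line above the hull. -/
theorem Hit.dist_pt_le (h : A.Angle x y z) {τ t : ℝ} {u : X} (hu : A.Hit x y z τ u)
    (ht : t ∈ Icc (0:ℝ) 1) {l : ℝ × ℝ}
    (hl : ∀ σ ∈ uIcc τ t, hullW (A.obs x y z) σ < (1 - σ) * l.1 + σ * l.2) :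
    dist u (A.pt (A.ln x y z l t)) ≤
      dist (A.p u) (A.ln x y z l τ) + dist (A.ln x y z l τ) (A.ln x y z l t) := by
  have hsub : uIcc τ t ⊆ Icc 0 1 := (ordConnected_Icc).uIcc_subset hu.mem.1 ht
  have hW := h.obst.one_le_hullW hu.mem.1
  have hl0 := hl τ left_mem_uIcc
  have hl1 := hl t right_mem_uIcc
  have hW1 := h.obst.one_le_hullW ht
  set W := hullW (A.obs x y z) τ with hWdef
  have hmem : A.ln x y z l τ ∈ openSegment ℝ (A.p y) (A.p u) := by
    rw [openSegment_eq_image_lineMap]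
    have hW0 : W ≠ 0 := by linarith
    have hl2 : 0 < (1 - τ) * l.1 + τ * l.2 := by linarith
    refine ⟨W / ((1 - τ) * l.1 + τ * l.2), ⟨div_pos (by linarith) hl2, (div_lt_one hl2).2 hl0⟩, ?_⟩
    rw [hu.p_eq]
    have : A.p y = A.sec x y z (0, 0) := by simp [sec]
    rw [this, sec_lineMap, ln]
    congr 1
    simp only [dirPt, mul_zero, zero_add]
    rw [← hWdef]
    ext <;> simp only <;> field_simp
  have hseg : segment ℝ (A.ln x y z l τ) (A.ln x y z l t) ⊆ A.U := by
    intro R hR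
    rw [segment_eq_image_lineMap] at hR
    obtain ⟨c, hc, rfl⟩ := hR
    rw [ln, ln, sec_lineMap]
    obtain ⟨σ, hσ, e⟩ := exists_dirPt (l := l) (τ₁ := τ) (τ₂ := t) (by linarith) (by linarith) hc
    rw [e]
    exact h.sec_dirPt_mem (hsub hσ) (hl σ hσ)
  have h1 := A.pt_seg _ _ hseg
  have h2 := (hu.sees.2 _ hmem).2.2
  have h3 := dist_triangle u (A.pt (A.ln x y z l τ)) (A.pt (A.ln x y z l t))
  linarith

theorem tendsto_ln (l : ℝ × ℝ) {τ : ℝ} (h0 : 0 < (1 - τ) * l.1 + τ * l.2) :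
    Tendsto (fun κ : ℝ => A.ln x y z (l.1 + κ, l.2 + κ) τ) (nhdsWithin 0 (Ioi 0))
      (nhds (A.ln x y z l τ)) := by
  have hc : ContinuousAt (fun κ : ℝ => A.ln x y z (l.1 + κ, l.2 + κ) τ) 0 := by
    unfold ln
    refine (continuous_sec x y z).continuousAt.comp ?_
    unfold dirPt
    refine ContinuousAt.prodMk (ContinuousAt.div (by fun_prop) (by fun_prop) ?_)
      (ContinuousAt.div (by fun_prop) (by fun_prop) ?_) <;> simpa using h0.ne'
  have := hc.tendsto
  simp only [add_zero] at this
  exact this.mono_left nhdsWithin_le_nhds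

/-- The distance of two hits is at most the length of a path following a line above the hull. -/
theorem Hit.dist_le (h : A.Angle x y z) {τ t : ℝ} {u v : X} (hu : A.Hit x y z τ u)
    (hv : A.Hit x y z t v) {l : ℝ × ℝ}
    (hl : ∀ σ ∈ uIcc τ t, hullW (A.obs x y z) σ ≤ (1 - σ) * l.1 + σ * l.2) :
    dist u v ≤ dist (A.p u) (A.ln x y z l τ) + dist (A.ln x y z l τ) (A.ln x y z l t) +
      dist (A.ln x y z l t) (A.p v) := by
  have hp : ∀ {σ}, σ ∈ Icc (0:ℝ) 1 → hullW (A.obs x y z) σ ≤ (1 - σ) * l.1 + σ * l.2 →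
      0 < (1 - σ) * l.1 + σ * l.2 := fun hσ h' => by linarith [h.obst.one_le_hullW hσ]
  have t1 := tendsto_ln (A := A) (x := x) (y := y) (z := z) l (hp hu.mem.1 (hl τ left_mem_uIcc))
  have t2 := tendsto_ln (A := A) (x := x) (y := y) (z := z) l (hp hv.mem.1 (hl t right_mem_uIcc))
  refine ge_of_tendsto (((tendsto_const_nhds (x := A.p u)).dist t1).add (t1.dist t2) |>.add
    (t2.dist (tendsto_const_nhds (x := A.p v)))) ?_
  filter_upwards [self_mem_nhdsWithin] with κ hκ
  have hκ' : (0:ℝ) < κ := hκ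
  have key : ∀ σ ∈ uIcc τ t, hullW (A.obs x y z) σ < (1 - σ) * (l.1 + κ) + σ * (l.2 + κ) :=
    fun σ hσ => by have := hl σ hσ; linarith
  have a1 := hu.dist_pt_le h hv.mem.1 (l := (l.1 + κ, l.2 + κ)) key
  have a2 := hv.dist_pt_le h hv.mem.1 (l := (l.1 + κ, l.2 + κ)) fun σ hσ => by
    simp only [uIcc_self, mem_singleton_iff] at hσ
    rw [hσ]
    exact key t right_mem_uIcc
  rw [dist_self, add_zero] at a2
  have := dist_triangle_right u v (A.pt (A.ln x y z (l.1 + κ, l.2 + κ) t))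
  rw [dist_comm _ (A.p v)]
  linarith

end Dom

section Gram
variable {V : Type*} [NormedAddCommGroup V] [InnerProductSpace ℝ V]

theorem gram_eq (a b : V) (α₀ β₀ α β : ℝ) :
    ‖α₀ • a + β₀ • b‖ ^ 2 * ‖α • a + β • b‖ ^ 2 -
        inner ℝ (α₀ • a + β₀ • b) (α • a + β • b) ^ 2 =
      (α₀ * β - α * β₀) ^ 2 * (‖a‖ ^ 2 * ‖b‖ ^ 2 - inner ℝ a b ^ 2) := by
  simp only [← real_inner_self_eq_norm_sq, inner_add_left, inner_add_right,
    real_inner_smul_left, real_inner_smul_right, real_inner_comm a b]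
  ring

theorem gram_pos {a b : V} (hab : ∀ s t : ℝ, s • a + t • b = 0 → s = 0 ∧ t = 0) :
    0 < ‖a‖ ^ 2 * ‖b‖ ^ 2 - inner ℝ a b ^ 2 := by
  by_contra! hle
  have hb : 0 < ‖b‖ := norm_pos_iff.2 fun hb => by simpa using (hab 0 1 (by simp [hb])).2
  have e := gram_eq a b (‖b‖ ^ 2) (-inner ℝ a b) 0 1
  have e2 : inner ℝ (‖b‖ ^ 2 • a + (-inner ℝ a b) • b) ((0:ℝ) • a + (1:ℝ) • b) = 0 := by
    simp only [zero_smul, one_smul, zero_add, inner_add_left, real_inner_smul_left,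
      real_inner_self_eq_norm_sq]
    ring
  rw [e2] at e
  simp only [zero_smul, one_smul, zero_add] at e
  have h0 : ‖‖b‖ ^ 2 • a + (-inner ℝ a b) • b‖ ^ 2 * ‖b‖ ^ 2 ≤ 0 := by
    have : (‖b‖ ^ 2 * 1 - 0 * -inner ℝ a b) ^ 2 * (‖a‖ ^ 2 * ‖b‖ ^ 2 - inner ℝ a b ^ 2) ≤ 0 :=
      mul_nonpos_of_nonneg_of_nonpos (sq_nonneg _) hle
    linarith
  have h1 : ‖‖b‖ ^ 2 • a + (-inner ℝ a b) • b‖ ^ 2 ≤ 0 := by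
    by_contra! hlt
    have := mul_pos hlt (pow_pos hb 2)
    linarith
  have h2 : ‖b‖ ^ 2 • a + (-inner ℝ a b) • b = 0 := by
    rw [← norm_eq_zero]
    nlinarith [norm_nonneg (‖b‖ ^ 2 • a + (-inner ℝ a b) • b)]
  have := (hab _ _ h2).1
  nlinarith

/-- A lower bound for the norms of the points of a segment. -/
theorem le_norm_lineMap {a b : V} (τ : ℝ) :
    ‖a‖ ^ 2 * ‖b‖ ^ 2 - inner ℝ a b ^ 2 ≤
      (‖(1 - τ) • a + τ • b‖ * (‖a‖ + ‖b‖)) ^ 2 := by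
  have e := gram_eq a b (1 - τ) τ (-1) 1
  have h1 : ‖(-1:ℝ) • a + (1:ℝ) • b‖ ≤ ‖a‖ + ‖b‖ := by
    refine (norm_add_le _ _).trans ?_
    simp
  have h2 : ‖(-1:ℝ) • a + (1:ℝ) • b‖ ^ 2 ≤ (‖a‖ + ‖b‖) ^ 2 := by gcongr
  have h3 := mul_le_mul_of_nonneg_left h2 (sq_nonneg ‖(1 - τ) • a + τ • b‖)
  have h4 := sq_nonneg (inner ℝ ((1 - τ) • a + τ • b) ((-1:ℝ) • a + (1:ℝ) • b))
  have h5 : ((1 - τ) * 1 - -1 * τ) ^ 2 = 1 := by ring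
  rw [h5, one_mul] at e
  rw [mul_pow]
  linarith

end Gram

theorem dirPt_sub_le {τ τ' w w' : ℝ} (hτ' : τ' ∈ Icc (0:ℝ) 1) (hw : 1 ≤ w) (hw' : 1 ≤ w') :
    |(dirPt τ w).1 - (dirPt τ' w').1| ≤ |τ - τ'| + |w - w'| ∧
      |(dirPt τ w).2 - (dirPt τ' w').2| ≤ |τ - τ'| + |w - w'| := by
  have hw0 : 0 < w := by linarith
  have hw0' : 0 < w' := by linarith
  have key : ∀ p p' : ℝ, |p'| ≤ 1 → |p / w - p' / w'| ≤ |p - p'| + |w - w'| := by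
    intro p p' hp
    have e : p / w - p' / w' = (p - p') / w + p' * (w' - w) / (w * w') := by
      field_simp; ring
    rw [e]
    refine (abs_add_le _ _).trans (add_le_add ?_ ?_)
    · rw [abs_div, abs_of_pos hw0]
      exact div_le_self (abs_nonneg _) hw
    · rw [abs_div, abs_of_pos (mul_pos hw0 hw0'), abs_mul, abs_sub_comm w' w]
      refine (div_le_self (by positivity) (by nlinarith)).trans ?_
      exact mul_le_of_le_one_left (abs_nonneg _) hp
  constructor
  · have := key (1 - τ) (1 - τ') (by rw [abs_le]; constructor <;> linarith [hτ'.1, hτ'.2])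
    rwa [show 1 - τ - (1 - τ') = -(τ - τ') by ring, abs_neg] at this
  · exact key τ τ' (by rw [abs_le]; constructor <;> linarith [hτ'.1, hτ'.2])

namespace Dom
variable {X : Type} [MetricSpace X] {A : Dom X} {x y z : X}

variable (A) in
/-- A triangle of mutually visible elements without boundary points inside. -/
structure Tri (x y z : X) : Prop where
  hx : x ∈ A.Bd
  hy : y ∈ A.Bd
  hz : z ∈ A.Bd
  sx : A.Sees y x
  sz : A.Sees y z
  sxz : A.Sees x z
  li : ∀ s t : ℝ, s • (A.p x - A.p y) + t • (A.p z - A.p y) = 0 → s = 0 ∧ t = 0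
  int : ∀ α β : ℝ, 0 < α → 0 < β → α + β < 1 →
    A.p y + (α • (A.p x - A.p y) + β • (A.p z - A.p y)) ∈ A.U

theorem dist_sec_dirPt_le {τ τ' w w' : ℝ} (hτ' : τ' ∈ Icc (0:ℝ) 1) (hw : 1 ≤ w) (hw' : 1 ≤ w') :
    dist (A.sec x y z (dirPt τ w)) (A.sec x y z (dirPt τ' w')) ≤
      (|τ - τ'| + |w - w'|) * (‖A.p x - A.p y‖ + ‖A.p z - A.p y‖) := by
  refine (dist_sec_le x y z _ _).trans ?_
  obtain ⟨h1, h2⟩ := dirPt_sub_le (τ := τ) hτ' hw hw'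
  rw [mul_add]
  gcongr

theorem Hit.dist_pt_eq (h : A.Angle x y z) {τ t : ℝ} {u : X} (hu : A.Hit x y z τ u)
    (ht : t ∈ Icc (0:ℝ) 1) {l : ℝ × ℝ}
    (hl : ∀ σ ∈ uIcc τ t, hullW (A.obs x y z) σ ≤ (1 - σ) * l.1 + σ * l.2)
    (hτl : hullW (A.obs x y z) τ = (1 - τ) * l.1 + τ * l.2) (hU : A.ln x y z l t ∈ A.U) :
    dist u (A.pt (A.ln x y z l t)) = dist (A.p u) (A.ln x y z l t) := by
  refine le_antisymm ?_ (A.dist_p_le hU)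
  have hp : ∀ {σ}, σ ∈ Icc (0:ℝ) 1 → hullW (A.obs x y z) σ ≤ (1 - σ) * l.1 + σ * l.2 →
      0 < (1 - σ) * l.1 + σ * l.2 := fun hσ h' => by linarith [h.obst.one_le_hullW hσ]
  have t1 := tendsto_ln (A := A) (x := x) (y := y) (z := z) l (hp hu.mem.1 (hl τ left_mem_uIcc))
  have t2 := tendsto_ln (A := A) (x := x) (y := y) (z := z) l (hp ht (hl t right_mem_uIcc))
  have e : A.ln x y z l τ = A.p u := by rw [hu.p_eq, hτl, ln]
  rw [e] at t1
  have t3 : Tendsto (fun κ : ℝ => A.pt (A.ln x y z (l.1 + κ, l.2 + κ) t)) (nhdsWithin 0 (Ioi 0))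
      (nhds (A.pt (A.ln x y z l t))) :=
    (A.continuousOn_pt.continuousAt (A.isOpen.mem_nhds hU)).tendsto.comp t2
  have := le_of_tendsto_of_tendsto ((tendsto_const_nhds (x := u)).dist t3)
    (((tendsto_const_nhds (x := A.p u)).dist t1).add (t1.dist t2)) (by
      filter_upwards [self_mem_nhdsWithin] with κ hκ
      have hκ' : (0:ℝ) < κ := hκ
      exact hu.dist_pt_le h ht fun σ hσ => by have := hl σ hσ; simp only; linarith)
  rwa [dist_self, zero_add] at this

/-- The two ends of a gap span a triangle without boundary points. -/
theorem Hit.tri (h : A.Angle x y z) {τ₁ τ₂ : ℝ} {u v : X} (hu : A.Hit x y z τ₁ u)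
    (hv : A.Hit x y z τ₂ v) (hlt : τ₁ < τ₂) {l : ℝ × ℝ} (hl : l ∈ suppFun (A.obs x y z))
    (h1 : hullW (A.obs x y z) τ₁ = (1 - τ₁) * l.1 + τ₁ * l.2)
    (h2 : hullW (A.obs x y z) τ₂ = (1 - τ₂) * l.1 + τ₂ * l.2)
    (hg : ∀ t ∈ Ioo τ₁ τ₂, hullW (A.obs x y z) t = (1 - t) * l.1 + t * l.2 ∧
      t ∉ hullE (A.obs x y z)) : A.Tri u y v := by
  have w1 := h.obst.one_le_hullW hu.mem.1
  have w2 := h.obst.one_le_hullW hv.mem.1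
  set w₁ := hullW (A.obs x y z) τ₁ with hw1
  set w₂ := hullW (A.obs x y z) τ₂ with hw2
  obtain ⟨n1, n2, n3⟩ := dirPt_nonneg (w := w₁) hu.mem.1 (by linarith)
  obtain ⟨m1, m2, m3⟩ := dirPt_nonneg (w := w₂) hv.mem.1 (by linarith)
  have pu : A.p u = A.p y + ((dirPt τ₁ w₁).1 • (A.p x - A.p y) + (dirPt τ₁ w₁).2 • (A.p z - A.p y)) :=
    hu.p_eq
  have pv : A.p v = A.p y + ((dirPt τ₂ w₂).1 • (A.p x - A.p y) + (dirPt τ₂ w₂).2 • (A.p z - A.p y)) :=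
    hv.p_eq
  have comb : ∀ s t : ℝ, s • (A.p u - A.p y) + t • (A.p v - A.p y) =
      (s * (dirPt τ₁ w₁).1 + t * (dirPt τ₂ w₂).1) • (A.p x - A.p y) +
        (s * (dirPt τ₁ w₁).2 + t * (dirPt τ₂ w₂).2) • (A.p z - A.p y) := fun s t => by
    rw [pu, pv]; module
  have hli : ∀ s t : ℝ, s • (A.p u - A.p y) + t • (A.p v - A.p y) = 0 → s = 0 ∧ t = 0 := by
    intro s t hst
    rw [comb] at hst
    obtain ⟨e1, e2⟩ := h.li _ _ hst
    simp only [dirPt] at e1 e2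
    have f1 : s / w₁ * (1 - τ₁) + t / w₂ * (1 - τ₂) = 0 := by rw [← e1]; ring
    have f2 : s / w₁ * τ₁ + t / w₂ * τ₂ = 0 := by rw [← e2]; ring
    have f3 : t / w₂ * (τ₂ - τ₁) = 0 := by linear_combination (1 - τ₁) * f2 - τ₁ * f1
    have f4 : t / w₂ = 0 := (mul_eq_zero.1 f3).resolve_right (by linarith)
    have f5 : s / w₁ = 0 := by linear_combination f1 + f2 - f4
    exact ⟨(div_eq_zero_iff.1 f5).resolve_right (by linarith),
      (div_eq_zero_iff.1 f4).resolve_right (by linarith)⟩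
  have hpuv : A.p u ≠ A.p v := fun he => by
    have := hli 1 (-1) (by rw [he]; module)
    linarith [this.1]
  have hle : ∀ σ ∈ Icc τ₁ τ₂, hullW (A.obs x y z) σ ≤ (1 - σ) * l.1 + σ * l.2 := fun σ hσ =>
    h.obst.hullW_le hl ⟨hu.mem.1.1.trans hσ.1, hσ.2.trans hv.mem.1.2⟩
  refine ⟨hu.bd, h.hy, hv.bd, hu.sees, hv.sees, ⟨hpuv, fun R hR => ?_⟩, hli, fun α β hα hβ hαβ => ?_⟩
  · have hR' := hR
    rw [openSegment_eq_image_lineMap] at hR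
    obtain ⟨c, hc, hcR⟩ := hR
    obtain ⟨σ, hσ, e⟩ := exists_dirPt (l := l) (τ₁ := τ₁) (τ₂ := τ₂) (by linarith) (by linarith)
      (Ioo_subset_Icc_self hc)
    have eR : R = A.ln x y z l σ := by
      rw [← hcR, hu.p_eq, hv.p_eq, sec_lineMap, ln, ← e, ← hw1, ← hw2, h1, h2]
    rw [uIcc_of_le hlt.le] at hσ
    have hσI : σ ∈ Icc (0:ℝ) 1 := ⟨hu.mem.1.1.trans hσ.1, hσ.2.trans hv.mem.1.2⟩
    have hσ1 : σ ≠ τ₁ := fun he => by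
      have : R = A.p u := by rw [eR, he, hu.p_eq, ← hw1, h1, ln]
      rw [this] at hR'
      exact hpuv (left_mem_openSegment_iff.1 hR')
    have hσ2 : σ ≠ τ₂ := fun he => by
      have : R = A.p v := by rw [eR, he, hv.p_eq, ← hw2, h2, ln]
      rw [this] at hR'
      exact hpuv (right_mem_openSegment_iff.1 hR')
    obtain ⟨g1, g2⟩ := hg σ ⟨lt_of_le_of_ne hσ.1 hσ1.symm, lt_of_le_of_ne hσ.2 hσ2⟩
    have hRU : R ∈ A.U := by
      by_contra hU
      have hwσ := h.obst.one_le_hullW hσI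
      obtain ⟨d1, d2, d3⟩ := dirPt_nonneg (w := hullW (A.obs x y z) σ) hσI (by linarith)
      refine g2 ⟨hσI, d1, d2, by rw [d3]; positivity, ?_, ?_⟩
      · rw [d3]; exact (div_le_one (by linarith)).2 hwσ
      · rwa [g1, ← ln, ← eR]
    rw [eR] at hRU ⊢
    refine ⟨hRU, hu.dist_pt_eq h hσI (fun s hs => ?_) h1 hRU,
      hv.dist_pt_eq h hσI (fun s hs => ?_) h2 hRU⟩
    · rw [uIcc_of_le hσ.1] at hs
      exact hle s ⟨hs.1, hs.2.trans hσ.2⟩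
    · rw [uIcc_of_ge hσ.2] at hs
      exact hle s ⟨hσ.1.trans hs.1, hs.2⟩
  · rw [comb]
    have e3 : (α * (dirPt τ₁ w₁).1 + β * (dirPt τ₂ w₂).1) +
        (α * (dirPt τ₁ w₁).2 + β * (dirPt τ₂ w₂).2) = α * (1 / w₁) + β * (1 / w₂) := by
      rw [← n3, ← m3]; ring
    refine h.sec_mem_of_lt (q := (α * (dirPt τ₁ w₁).1 + β * (dirPt τ₂ w₂).1,
      α * (dirPt τ₁ w₁).2 + β * (dirPt τ₂ w₂).2)) (l := l) (by positivity) (by positivity) ?_ hl ?_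
    · simp only
      rw [e3]
      have : 0 < w₁ := by linarith
      have : 0 < w₂ := by linarith
      positivity
    · simp only
      have f1 : (dirPt τ₁ w₁).1 * l.1 + (dirPt τ₁ w₁).2 * l.2 = 1 := by
        simp only [dirPt]
        rw [div_mul_eq_mul_div, div_mul_eq_mul_div, ← add_div, ← h1, div_self (by linarith)]
      have f2 : (dirPt τ₂ w₂).1 * l.1 + (dirPt τ₂ w₂).2 * l.2 = 1 := by
        simp only [dirPt]
        rw [div_mul_eq_mul_div, div_mul_eq_mul_div, ← add_div, ← h2, div_self (by linarith)]
      have : (α * (dirPt τ₁ w₁).1 + β * (dirPt τ₂ w₂).1) * l.1 +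
          (α * (dirPt τ₁ w₁).2 + β * (dirPt τ₂ w₂).2) * l.2 = α + β := by
        linear_combination α * f1 + β * f2
      linarith

end Dom

namespace Dom
open InnerProductGeometry
variable {X : Type} [MetricSpace X] {A : Dom X} {x y z : X}

theorem Hit.sub_eq {τ : ℝ} {u : X} (hu : A.Hit x y z τ u) : A.p u - A.p y =
    (hullW (A.obs x y z) τ)⁻¹ • ((1 - τ) • (A.p x - A.p y) + τ • (A.p z - A.p y)) := by
  rw [hu.p_eq, sec]
  simp only [dirPt, div_eq_mul_inv]
  module

theorem Hit.sub_eq' {τ : ℝ} {u : X} (hu : A.Hit x y z τ u) : A.p u - A.p y =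
    ((1 - τ) / hullW (A.obs x y z) τ) • (A.p x - A.p y) +
      (τ / hullW (A.obs x y z) τ) • (A.p z - A.p y) := by
  rw [hu.p_eq, sec]
  simp only [dirPt]
  module

theorem Hit.angle_eq (h : A.Angle x y z) {τ t : ℝ} {u v : X} (hu : A.Hit x y z τ u)
    (hv : A.Hit x y z t v) (hle : τ ≤ t) : angle (A.p u - A.p y) (A.p v - A.p y) =
      angle (A.p x - A.p y) ((1 - t) • (A.p x - A.p y) + t • (A.p z - A.p y)) -
      angle (A.p x - A.p y) ((1 - τ) • (A.p x - A.p y) + τ • (A.p z - A.p y)) := by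
  have w1 := h.obst.one_le_hullW hu.mem.1
  have w2 := h.obst.one_le_hullW hv.mem.1
  rw [hu.sub_eq, hv.sub_eq, angle_smul_left_of_pos _ _ (by positivity),
    angle_smul_right_of_pos _ _ (by positivity), angle_lineMap_add h.li hu.mem.1.1 hle]

theorem Hit.norm_le (h : A.Angle x y z) {τ : ℝ} {u : X} (hu : A.Hit x y z τ u) :
    ‖A.p u - A.p y‖ ≤ ‖A.p x - A.p y‖ + ‖A.p z - A.p y‖ := by
  have w1 := h.obst.one_le_hullW hu.mem.1
  obtain ⟨h1, h2⟩ := hu.mem.1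
  rw [hu.sub_eq']
  refine (norm_add_le _ _).trans ?_
  rw [norm_smul, norm_smul, Real.norm_of_nonneg (div_nonneg (by linarith) (by linarith)),
    Real.norm_of_nonneg (div_nonneg (by linarith) (by linarith))]
  refine add_le_add (mul_le_of_le_one_left (norm_nonneg _) ?_)
    (mul_le_of_le_one_left (norm_nonneg _) ?_) <;>
  · rw [div_le_one (by linarith)]; linarith

section
variable {Y : Type} [MetricSpace Y] {B : Dom Y}

theorem _root_.BdIso.norm_sub [CompleteSpace Y] (I : BdIso A B) {a b : X} (ha : a ∈ A.Bd)
    (hb : b ∈ A.Bd) (h : A.Sees a b) :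
    ‖B.p (I.F b) - B.p (I.F a)‖ = ‖A.p b - A.p a‖ := by
  rw [← dist_eq_norm, ← dist_eq_norm, dist_comm, I.dist_p ha hb h, dist_comm]

theorem _root_.BdIso.norm_sub_le (I : BdIso A B) {a b c : X} (ha : a ∈ A.Bd) (hb : b ∈ A.Bd) :
    ‖(B.p (I.F a) - B.p (I.F c)) - (B.p (I.F b) - B.p (I.F c))‖ ≤ dist a b := by
  rw [sub_sub_sub_cancel_right, ← dist_eq_norm, ← I.dist_F a ha b hb]
  exact B.p_lip _ _

variable [CompleteSpace Y]

theorem Hit.angle_near (h : A.Angle x y z) (I : BdIso A B) {τ₀ : ℝ} (hτ₀ : τ₀ ∈ Ioo (0:ℝ) 1)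
    {ε : ℝ} (hε : 0 < ε) : ∃ δ > 0, ∀ τ u₀ u, A.Hit x y z τ₀ u₀ → A.Hit x y z τ u → |τ - τ₀| < δ →
      angle (B.p (I.F u₀) - B.p (I.F y)) (B.p (I.F u) - B.p (I.F y)) ≤
        (1 + ε) * angle (A.p u₀ - A.p y) (A.p u - A.p y) := by
  obtain ⟨K₀, hK₀, hK⟩ := concaveOn_tangent h.obst.concaveOn hτ₀
  have hΓ := gram_pos h.li
  obtain ⟨M, hM1, hM⟩ := h.obst.exists_const
  have hWM : ∀ τ ∈ Icc (0:ℝ) 1, hullW (A.obs x y z) τ ≤ M := fun τ hτ =>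
    (h.obst.hullW_le hM hτ).trans (by simp only; linarith)
  set W := hullW (A.obs x y z) with hW
  set a := A.p x - A.p y with ha
  set b := A.p z - A.p y with hb
  set Γ := ‖a‖ ^ 2 * ‖b‖ ^ 2 - inner ℝ a b ^ 2 with hΓd
  have hane : a ≠ 0 := fun h0 => by
    have := (h.li 1 0 (by rw [← ha, h0]; simp)).1
    linarith
  set R := ‖a‖ + ‖b‖ with hR
  have hR0 : 0 < R := by have := norm_pos_iff.2 hane; positivity
  have hM0 : 0 < M := by linarith
  obtain ⟨κ, hκ, δ₁, hδ₁, main⟩ := exists_angle_le (V := Euc 2) ((K₀ + 2) * R) (ε := ε)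
    (c₀ := Γ / (R * M) ^ 2) (c₁ := Γ / (M ^ 2 * R) ^ 2) hε (by positivity) (by positivity)
    (by positivity)
  set η := min 1 (κ / (2 * R)) with hη
  have hη0 : 0 < η := by positivity
  have hη1 : η ≤ 1 := min_le_left _ _
  have hη2 : η * (2 * R) ≤ κ := by
    rw [← le_div_iff₀ (by positivity)]; exact min_le_right _ _
  obtain ⟨δ₂, hδ₂, tan⟩ := hK η hη0
  refine ⟨min δ₁ δ₂, lt_min hδ₁ hδ₂, fun τ u₀ u hu₀ hu hd => ?_⟩
  have hτ := hu.mem.1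
  obtain ⟨m, hm, hline, hclose⟩ := tan τ hτ (hd.trans_le (min_le_right _ _))
  set Δ := |τ - τ₀| with hΔ
  have hΔ0 : 0 ≤ Δ := abs_nonneg _
  have w0 : 1 ≤ W τ₀ := h.obst.one_le_hullW hu₀.mem.1
  have w1 : 1 ≤ W τ := h.obst.one_le_hullW hτ
  have m0 := hWM τ₀ hu₀.mem.1
  have m1 := hWM τ hτ
  have hl1 : W τ ≤ W τ₀ + m * (τ - τ₀) := hline τ right_mem_uIcc
  have n0 := hu₀.norm_le h
  have n1 := hu.norm_le h
  have hval : ∀ σ, (1 - σ) * (W τ₀ - m * τ₀) + σ * (W τ₀ + m * (1 - τ₀)) =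
      W τ₀ + m * (σ - τ₀) := fun σ => by ring
  -- the distance in the space
  have hD : dist u₀ u ≤ ‖(A.p u₀ - A.p y) - (A.p u - A.p y)‖ + κ * Δ := by
    have hd' := hu₀.dist_le h hu (l := (W τ₀ - m * τ₀, W τ₀ + m * (1 - τ₀))) fun σ hσ => by
      simp only [hval]; exact hline σ hσ
    have e0 : A.ln x y z (W τ₀ - m * τ₀, W τ₀ + m * (1 - τ₀)) τ₀ = A.p u₀ := by
      rw [ln, hu₀.p_eq]
      simp only [hval, sub_self, mul_zero, add_zero, ← hW]
    have e1 : dist (A.ln x y z (W τ₀ - m * τ₀, W τ₀ + m * (1 - τ₀)) τ) (A.p u) ≤ η * Δ * R := by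
      rw [ln, hu.p_eq]
      simp only [hval, ← hW]
      refine (dist_sec_dirPt_le hτ (w1.trans hl1) w1).trans ?_
      rw [sub_self, abs_zero, zero_add, abs_of_nonneg (by linarith)]
      gcongr
    rw [e0, dist_self, zero_add] at hd'
    have := dist_triangle_right (A.p u₀) (A.ln x y z (W τ₀ - m * τ₀, W τ₀ + m * (1 - τ₀)) τ) (A.p u)
    have t2 := dist_triangle (A.p u₀) (A.p u) (A.ln x y z (W τ₀ - m * τ₀, W τ₀ + m * (1 - τ₀)) τ)
    rw [dist_comm (A.p u)] at t2
    rw [sub_sub_sub_cancel_right, ← dist_eq_norm]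
    nlinarith
  have hWd : |τ₀ - τ| + |W τ₀ - W τ| ≤ (K₀ + 2) * Δ := by
    rw [abs_sub_comm τ₀]
    have e : W τ₀ - W τ = (W τ₀ + m * (τ - τ₀) - W τ) - m * (τ - τ₀) := by ring
    have : |W τ₀ - W τ| ≤ η * Δ + K₀ * Δ := by
      rw [e]
      refine (abs_sub _ _).trans (add_le_add ?_ ?_)
      · rw [abs_of_nonneg (by linarith)]; exact hclose
      · rw [abs_mul]; gcongr
    nlinarith
  have lower : ∀ {t v}, A.Hit x y z t v → Γ ≤ (‖A.p v - A.p y‖ * (R * M)) ^ 2 := by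
    intro t v hv
    refine (le_norm_lineMap (a := a) (b := b) t).trans ?_
    have wv : 1 ≤ W t := h.obst.one_le_hullW hv.mem.1
    have e : (1 - t) • a + t • b = W t • (A.p v - A.p y) := by
      rw [hv.sub_eq, ← hW, smul_inv_smul₀ (by linarith)]
    rw [e, norm_smul, Real.norm_of_nonneg (by linarith)]
    have := hWM t hv.mem.1
    rw [mul_comm R M, ← mul_assoc, mul_comm _ M]
    gcongr
  refine main Δ hΔ0 (hd.trans_le (min_le_left _ _)) _ _ _ _ (I.norm_sub h.hy hu₀.bd hu₀.sees)
    (I.norm_sub h.hy hu.bd hu.sees) ((I.norm_sub_le hu₀.bd hu.bd).trans hD) ?_ ?_ ?_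
  · rw [sub_sub_sub_cancel_right, ← dist_eq_norm, hu₀.p_eq, hu.p_eq]
    refine (dist_sec_dirPt_le hτ w0 w1).trans ?_
    exact (mul_le_mul_of_nonneg_right hWd hR0.le).trans (le_of_eq (by ring))
  · rw [div_le_iff₀ (by positivity)]
    have l0 := Real.sqrt_le_sqrt (lower hu₀)
    have l1 := Real.sqrt_le_sqrt (lower hu)
    rw [Real.sqrt_sq (by positivity)] at l0 l1
    have := mul_le_mul l0 l1 (Real.sqrt_nonneg _) (by positivity)
    rw [Real.mul_self_sqrt hΓ.le] at this
    refine this.trans (le_of_eq (by ring))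
  · have g := gram_le_mul_excess (a := a) (b := b) ((1 - τ₀) / W τ₀) (τ₀ / W τ₀)
      ((1 - τ) / W τ) (τ / W τ)
    rw [← hu₀.sub_eq', ← hu.sub_eq'] at g
    have e : (1 - τ₀) / W τ₀ * (τ / W τ) - (1 - τ) / W τ * (τ₀ / W τ₀) =
        (τ - τ₀) / (W τ₀ * W τ) := by field_simp; ring
    rw [e, div_pow, ← sq_abs (τ - τ₀), ← hΔ] at g
    set ex := ‖A.p u₀ - A.p y - (A.p u - A.p y)‖ ^ 2 - (‖A.p u₀ - A.p y‖ - ‖A.p u - A.p y‖) ^ 2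
      with hex
    have hex0 : 0 ≤ ex := by
      rw [hex, sub_nonneg, sq_le_sq, abs_of_nonneg (norm_nonneg (_ - _))]
      exact abs_norm_sub_norm_le _ _
    have hWW : W τ₀ * W τ ≤ M ^ 2 := by rw [sq]; gcongr
    have hnn : ‖A.p u₀ - A.p y‖ * ‖A.p u - A.p y‖ ≤ R ^ 2 := by rw [sq]; gcongr
    have g2 := g.trans (mul_le_mul_of_nonneg_right hnn hex0)
    have g3 : Δ ^ 2 / (M ^ 2) ^ 2 * Γ ≤ R ^ 2 * ex := by
      refine le_trans ?_ g2
      gcongr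
    rw [div_mul_eq_mul_div, div_le_iff₀ (by positivity)] at g3 ⊢
    exact (mul_comm _ _).trans_le (g3.trans (le_of_eq (by ring)))

theorem Hit.angle_end (h : A.Angle x y z) (I : BdIso A B) {t : ℝ} (hW1 : hullW (A.obs x y z) t = 1)
    (hend : ∀ κ > 0, ∃ δ > 0, ∀ τ ∈ Icc (0:ℝ) 1, |τ - t| < δ → hullW (A.obs x y z) τ ≤ 1 + κ)
    {u₀ : X} (hu₀ : A.Hit x y z t u₀) {ε : ℝ} (hε : 0 < ε) :
    ∃ δ > 0, ∀ τ u, A.Hit x y z τ u → |τ - t| < δ →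
      angle (B.p (I.F u₀) - B.p (I.F y)) (B.p (I.F u) - B.p (I.F y)) ≤ ε := by
  set v₀ := B.p (I.F u₀) - B.p (I.F y) with hv₀
  have hne : v₀ ≠ 0 := by
    rw [hv₀, ← norm_pos_iff, I.norm_sub h.hy hu₀.bd hu₀.sees, norm_pos_iff, sub_ne_zero]
    exact hu₀.sees.1.symm
  have hc : ContinuousAt (fun v => angle v₀ v) v₀ :=
    (continuousAt_angle (x := (v₀, v₀)) hne hne).comp (f := fun v => (v₀, v)) (by fun_prop)
  obtain ⟨ρ, hρ, hang⟩ := Metric.continuousAt_iff.1 hc ε hε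
  set R := ‖A.p x - A.p y‖ + ‖A.p z - A.p y‖ with hR
  have hR0 : 0 ≤ R := by positivity
  obtain ⟨δ₁, hδ₁, hend'⟩ := hend (ρ / (4 * (R + 1))) (by positivity)
  refine ⟨min δ₁ (ρ / (4 * (R + 1))), by positivity, fun τ u hu hd => ?_⟩
  set κ := ρ / (4 * (R + 1)) with hκ
  have hκ0 : 0 < κ := by positivity
  have hκR : κ * (4 * (R + 1)) = ρ := by rw [hκ]; field_simp
  have hd1 := hd.trans_le (min_le_left _ _)
  have hd2 := hd.trans_le (min_le_right _ _)
  have hτ := hu.mem.1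
  have ht := hu₀.mem.1
  have w1 := h.obst.one_le_hullW hτ
  have hwτ := hend' τ hτ hd1
  have hval : ∀ σ : ℝ, (1 - σ) * (1 + κ) + σ * (1 + κ) = 1 + κ := fun σ => by ring
  have hD := hu₀.dist_le h hu (l := (1 + κ, 1 + κ)) fun σ hσ => by
    simp only [hval]
    refine hend' σ ((ordConnected_Icc).uIcc_subset ht hτ hσ) (lt_of_le_of_lt ?_ hd1)
    rw [uIcc_comm] at hσ
    rw [abs_sub_comm σ, abs_sub_comm τ]
    exact abs_sub_right_of_mem_uIcc hσ
  have e1 : dist (A.p u₀) (A.ln x y z (1 + κ, 1 + κ) t) ≤ κ * R := by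
    rw [hu₀.p_eq, hW1, ln]
    simp only [hval]
    refine (dist_sec_dirPt_le ht le_rfl (by linarith)).trans ?_
    rw [← hR]
    gcongr
    rw [sub_self, abs_zero, zero_add, abs_sub_comm, abs_of_nonneg] <;> linarith
  have e2 : dist (A.ln x y z (1 + κ, 1 + κ) t) (A.ln x y z (1 + κ, 1 + κ) τ) ≤ κ * R := by
    rw [ln, ln]
    simp only [hval]
    refine (dist_sec_dirPt_le hτ (by linarith) (by linarith)).trans ?_
    rw [← hR]
    gcongr
    rw [sub_self, abs_zero, add_zero, abs_sub_comm]
    exact hd2.le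
  have e3 : dist (A.ln x y z (1 + κ, 1 + κ) τ) (A.p u) ≤ κ * R := by
    rw [hu.p_eq, ln]
    simp only [hval]
    refine (dist_sec_dirPt_le hτ (by linarith) (by linarith)).trans ?_
    rw [← hR]
    gcongr
    rw [sub_self, abs_zero, zero_add, abs_of_nonneg] <;> linarith
  have hv := I.norm_sub_le (c := y) hu.bd hu₀.bd
  have := hang (x := B.p (I.F u) - B.p (I.F y)) (by
    rw [dist_eq_norm]
    rw [dist_comm] at hv
    refine hv.trans_lt ?_
    nlinarith)
  rw [angle_self hne, Real.dist_eq, sub_zero] at this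
  exact (le_abs_self _).trans this.le

theorem Angle.angle_le [CompleteSpace X] (h : A.Angle x y z) (I : BdIso A B) :
    angle (B.p (I.F x) - B.p (I.F y)) (B.p (I.F z) - B.p (I.F y)) ≤
      angle (A.p x - A.p y) (A.p z - A.p y) := by
  have hex : ∀ τ, ∃ u, τ ∈ hullE (A.obs x y z) → A.Hit x y z τ u := fun τ => by
    by_cases hτ : τ ∈ hullE (A.obs x y z)
    · obtain ⟨u, hu⟩ := h.exists_hit hτ
      exact ⟨u, fun _ => hu⟩
    · exact ⟨x, fun h' => absurd h' hτ⟩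
  choose g hg using hex
  have huniq : ∀ {τ u v}, A.Hit x y z τ u → A.Hit x y z τ v → u = v := fun hu hv =>
    hu.sees.unique hv.sees (by rw [hu.p_eq, hv.p_eq])
  have g0 : g 0 = x := huniq (hg 0 h.obst.zero_mem) h.hit_zero
  have g1 : g 1 = z := huniq (hg 1 h.obst.one_mem) h.hit_one
  have hsub : hullE (A.obs x y z) ⊆ Icc 0 1 := fun τ hτ => hτ.1
  have key := le_increment h.obst.isClosed_hullE hsub h.obst.zero_mem h.obst.one_mem
    (m := fun τ σ => angle (B.p (I.F (g τ)) - B.p (I.F y)) (B.p (I.F (g σ)) - B.p (I.F y)))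
    (θ := fun τ => angle (A.p x - A.p y) ((1 - τ) • (A.p x - A.p y) + τ • (A.p z - A.p y)))
    (fun a _ b _ c _ => angle_le_angle_add_angle _ _ _)
    (fun s hs t ht hst => by
      have := angle_lineMap_add h.li hs.1 hst
      have := angle_nonneg ((1 - s) • (A.p x - A.p y) + s • (A.p z - A.p y))
        ((1 - t) • (A.p x - A.p y) + t • (A.p z - A.p y))
      linarith)
    (fun τ hτ hE => by
      obtain ⟨τ₁, h1, τ₂, h2, l1, l2, l, hl, e1, e2, hgap⟩ := h.obst.exists_gap hτ hE
      have u1 := hg τ₁ h1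
      have u2 := hg τ₂ h2
      have T := u1.tri h u2 (l1.trans l2) hl e1 e2 hgap
      refine ⟨τ₁, h1, τ₂, h2, l1, l2, fun t ht => (hgap t ht).2, ?_⟩
      rw [← u1.angle_eq h u2 (l1.trans l2).le]
      have n1 := I.norm_sub h.hy u1.bd u1.sees
      have n2 := I.norm_sub h.hy u2.bd u2.sees
      refine angle_le_of_inner_le n1 n2 (inner_le_of_norm_sub_le n1 n2 ?_)
      refine (I.norm_sub_le u1.bd u2.bd).trans ?_
      rw [T.sxz.dist_eq, sub_sub_sub_cancel_right, dist_eq_norm])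
    (fun ε hε τ₀ hE hτ₀ => by
      obtain ⟨δ, hδ, hnear⟩ := Hit.angle_near h I hτ₀ hε
      refine ⟨δ, hδ, fun τ hτ hd => ?_⟩
      have := hnear τ _ _ (hg τ₀ hE) (hg τ hτ) hd
      refine ⟨fun hle => ?_, fun hle => ?_⟩
      · rwa [(hg τ₀ hE).angle_eq h (hg τ hτ) hle] at this
      · rw [angle_comm, angle_comm (A.p (g τ₀) - A.p y),
          (hg τ hτ).angle_eq h (hg τ₀ hE) hle] at this
        exact this)
    (fun ε hε => by
      obtain ⟨δ, hδ, hn⟩ := Hit.angle_end h I h.obst.hullW_zero (fun κ hκ => by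
        obtain ⟨δ, hδ, h'⟩ := h.obst.hullW_end₀ hκ
        exact ⟨δ, hδ, fun τ hτ hd => h' τ hτ (by
          rw [sub_zero] at hd; exact (le_abs_self _).trans_lt hd)⟩) (hg 0 h.obst.zero_mem) hε
      exact ⟨δ, hδ, fun τ hτ hd => hn τ _ (hg τ hτ) (by rwa [sub_zero, abs_of_nonneg hτ.1.1])⟩)
    (fun ε hε => by
      obtain ⟨δ, hδ, hn⟩ := Hit.angle_end h I h.obst.hullW_one (fun κ hκ => by
        obtain ⟨δ, hδ, h'⟩ := h.obst.hullW_end₁ hκ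
        exact ⟨δ, hδ, fun τ hτ hd => h' τ hτ (by
          rw [abs_lt] at hd; linarith)⟩) (hg 1 h.obst.one_mem) hε
      refine ⟨δ, hδ, fun τ hτ hd => ?_⟩
      have := hn τ _ (hg τ hτ) (by rw [abs_sub_comm, abs_of_nonneg (by linarith [hτ.1.2])]; linarith)
      rwa [angle_comm])
  have hx : A.p x - A.p y ≠ 0 := sub_ne_zero.2 h.sx.1.symm
  simp only [g0, g1, sub_self, zero_smul, sub_zero, one_smul, add_zero, zero_add,
    angle_self hx] at key
  exact key

theorem Angle.inner_le [CompleteSpace X] (h : A.Angle x y z) (I : BdIso A B) :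
    inner ℝ (A.p x - A.p y) (A.p z - A.p y) ≤
      inner ℝ (B.p (I.F x) - B.p (I.F y)) (B.p (I.F z) - B.p (I.F y)) :=
  inner_le_of_angle_le (I.norm_sub h.hy h.hx h.sx) (I.norm_sub h.hy h.hz h.sz) (h.angle_le I)

theorem Angle.dist_le [CompleteSpace X] (h : A.Angle x y z) (I : BdIso A B) :
    dist (B.p (I.F x)) (B.p (I.F z)) ≤ dist (A.p x) (A.p z) := by
  have := norm_sub_le_of_inner_le (I.norm_sub h.hy h.hx h.sx) (I.norm_sub h.hy h.hz h.sz)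
    (h.inner_le I)
  rwa [sub_sub_sub_cancel_right, sub_sub_sub_cancel_right, ← dist_eq_norm, ← dist_eq_norm] at this

end

/-- The directions of two hits span an angle. -/
theorem Hit.angle (h : A.Angle x y z) {τ₁ τ₂ : ℝ} {u v : X} (hu : A.Hit x y z τ₁ u)
    (hv : A.Hit x y z τ₂ v) (hlt : τ₁ < τ₂) : A.Angle u y v := by
  have w1 := h.obst.one_le_hullW hu.mem.1
  have w2 := h.obst.one_le_hullW hv.mem.1
  obtain ⟨a1, b1⟩ := hu.mem.1
  obtain ⟨a2, b2⟩ := hv.mem.1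
  have pu := hu.sub_eq'
  have pv := hv.sub_eq'
  set w₁ := hullW (A.obs x y z) τ₁ with hw1
  set w₂ := hullW (A.obs x y z) τ₂ with hw2
  have comb : ∀ s t : ℝ, s • (A.p u - A.p y) + t • (A.p v - A.p y) =
      (s * ((1 - τ₁) / w₁) + t * ((1 - τ₂) / w₂)) • (A.p x - A.p y) +
        (s * (τ₁ / w₁) + t * (τ₂ / w₂)) • (A.p z - A.p y) := fun s t => by
    rw [pu, pv]; module
  have hsum : ∀ s t : ℝ, s * ((1 - τ₁) / w₁) + t * ((1 - τ₂) / w₂) +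
      (s * (τ₁ / w₁) + t * (τ₂ / w₂)) = s / w₁ + t / w₂ := fun s t => by ring
  refine ⟨hu.bd, h.hy, hv.bd, hu.sees, hv.sees, fun s t hst => ?_, ?_⟩
  · rw [comb] at hst
    obtain ⟨e1, e2⟩ := h.li _ _ hst
    have f1 : s / w₁ * (1 - τ₁) + t / w₂ * (1 - τ₂) = 0 := by rw [← e1]; ring
    have f2 : s / w₁ * τ₁ + t / w₂ * τ₂ = 0 := by rw [← e2]; ring
    have f3 : t / w₂ * (τ₂ - τ₁) = 0 := by linear_combination (1 - τ₁) * f2 - τ₁ * f1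
    have f4 : t / w₂ = 0 := (mul_eq_zero.1 f3).resolve_right (by linarith)
    have f5 : s / w₁ = 0 := by linear_combination f1 + f2 - f4
    exact ⟨(div_eq_zero_iff.1 f5).resolve_right (by linarith),
      (div_eq_zero_iff.1 f4).resolve_right (by linarith)⟩
  · obtain ⟨r, hr, hc⟩ := h.clean
    refine ⟨r, hr, fun α β hα hβ h0 hle => ?_⟩
    rw [comb]
    have q1 : 0 ≤ 1 - τ₁ := by linarith
    have q2 : 0 ≤ 1 - τ₂ := by linarith
    have : α / w₁ ≤ α := div_le_self hα w1
    have : β / w₂ ≤ β := div_le_self hβ w2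
    refine hc _ _ (by positivity) (by positivity) ?_ ?_
    · rw [hsum]
      rcases hα.lt_or_eq with h1 | rfl
      · positivity
      · rcases hβ.lt_or_eq with h1 | rfl
        · positivity
        · simp at h0
    · rw [hsum]; linarith

end Dom

section Vec
variable {V W : Type*} [NormedAddCommGroup V] [InnerProductSpace ℝ V]
  [NormedAddCommGroup W] [InnerProductSpace ℝ W]

theorem norm_comb_eq {a b : V} {a' b' : W} (ha : ‖a'‖ = ‖a‖) (hb : ‖b'‖ = ‖b‖)
    (hi : inner ℝ a' b' = inner ℝ a b) (s t : ℝ) : ‖s • a' + t • b'‖ = ‖s • a + t • b‖ := by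
  rw [← sq_eq_sq₀ (norm_nonneg _) (norm_nonneg _), norm_add_sq_real, norm_add_sq_real]
  simp only [norm_smul, real_inner_smul_left, real_inner_smul_right, ha, hb, hi]

/-- A vector is determined by its norm and lower bounds for inner products. -/
theorem eq_comb_of_inner_le {a b : V} {a' b' u' : W} (ha : ‖a'‖ = ‖a‖) (hb : ‖b'‖ = ‖b‖)
    (hi : inner ℝ a' b' = inner ℝ a b) {s t : ℝ} (hs : 0 ≤ s) (ht : 0 ≤ t)
    (hu : ‖u'‖ = ‖s • a + t • b‖) (h1 : inner ℝ a (s • a + t • b) ≤ inner ℝ a' u')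
    (h2 : inner ℝ b (s • a + t • b) ≤ inner ℝ b' u') : u' = s • a' + t • b' := by
  have e1 := norm_sub_sq_real u' (s • a' + t • b')
  rw [norm_comb_eq ha hb hi, hu] at e1
  have e2 : inner ℝ u' (s • a' + t • b') = s * inner ℝ a' u' + t * inner ℝ b' u' := by
    rw [real_inner_comm, inner_add_left, real_inner_smul_left, real_inner_smul_left]
  have e3 : ‖s • a + t • b‖ ^ 2 =
      s * inner ℝ a (s • a + t • b) + t * inner ℝ b (s • a + t • b) := by
    rw [← real_inner_self_eq_norm_sq, ← real_inner_smul_left, ← real_inner_smul_left,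
      ← inner_add_left]
  have := mul_le_mul_of_nonneg_left h1 hs
  have := mul_le_mul_of_nonneg_left h2 ht
  have e4 : ‖u' - (s • a' + t • b')‖ ^ 2 ≤ 0 := by rw [e1, e2]; linarith
  rw [← sub_eq_zero, ← norm_eq_zero]
  exact pow_eq_zero_iff two_ne_zero |>.1 (le_antisymm e4 (sq_nonneg _))

theorem li_of_gram_pos {a b : V} (h : 0 < ‖a‖ ^ 2 * ‖b‖ ^ 2 - inner ℝ a b ^ 2) (s t : ℝ)
    (hst : s • a + t • b = 0) : s = 0 ∧ t = 0 := by
  have e1 := gram_eq a b s t 0 1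
  have e2 := gram_eq a b s t 1 0
  rw [hst] at e1 e2
  simp only [norm_zero, inner_zero_left, ne_eq, OfNat.ofNat_ne_zero, not_false_eq_true, zero_pow,
    zero_mul, sub_self, mul_one, sub_zero, mul_zero, zero_sub, one_mul] at e1 e2
  constructor
  · have := (mul_eq_zero.1 e1.symm).resolve_right h.ne'
    exact pow_eq_zero_iff two_ne_zero |>.1 this
  · have := (mul_eq_zero.1 e2.symm).resolve_right h.ne'
    rw [neg_sq] at this
    exact pow_eq_zero_iff two_ne_zero |>.1 this

end Vec

namespace Dom
variable {X : Type} [MetricSpace X] {A : Dom X} {x y z : X}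

theorem Tri.rot (T : A.Tri x y z) : A.Tri y z x where
  hx := T.hy
  hy := T.hz
  hz := T.hx
  sx := T.sz.symm
  sz := T.sxz.symm
  sxz := T.sx
  li s t hst := by
    have := T.li t (-s - t) (by rw [← hst]; module)
    exact ⟨by linarith, this.1⟩
  int α β hα hβ h := by
    have := T.int β (1 - α - β) hβ (by linarith) (by linarith)
    convert this using 1
    module

theorem sec_symm (x y z : X) (q : ℝ × ℝ) : A.sec z y x q = A.sec x y z (q.2, q.1) := by
  simp only [sec]; module

theorem sec_rot (x y z : X) (q : ℝ × ℝ) : A.sec y z x q = A.sec x y z (q.2, 1 - q.1 - q.2) := by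
  simp only [sec]; module

theorem sec_zero (x y z : X) : A.sec x y z (0, 0) = A.p y := by simp [sec]

theorem sec_one_zero (x y z : X) : A.sec x y z (1, 0) = A.p x := by simp [sec]

theorem sec_zero_one (x y z : X) : A.sec x y z (0, 1) = A.p z := by simp [sec]

theorem Tri.sec_mem (T : A.Tri x y z) {q : ℝ × ℝ} (h1 : 0 ≤ q.1) (h2 : 0 ≤ q.2)
    (h3 : q.1 + q.2 ≤ 1) (hy : 0 < q.1 + q.2) (hx : q.1 < 1) (hz : q.2 < 1) :
    A.sec x y z q ∈ A.U := by
  rcases h1.lt_or_eq with h1 | h1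
  · rcases h2.lt_or_eq with h2 | h2
    · rcases h3.lt_or_eq with h3 | h3
      · exact T.int _ _ h1 h2 h3
      · refine (T.sxz.2 _ ?_).1
        rw [openSegment_eq_image_lineMap]
        refine ⟨q.2, ⟨h2, hz⟩, ?_⟩
        rw [← sec_one_zero x y z, ← sec_zero_one x y z, sec_lineMap]
        congr 1
        ext <;> simp
        linarith
    · refine (T.sx.2 _ ?_).1
      rw [openSegment_eq_image_lineMap]
      refine ⟨q.1, ⟨h1, hx⟩, ?_⟩
      rw [← sec_zero x y z, ← sec_one_zero x y z, sec_lineMap]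
      congr 1
      ext <;> simp [← h2]
  · refine (T.sz.2 _ ?_).1
    rw [openSegment_eq_image_lineMap]
    refine ⟨q.2, ⟨by linarith, hz⟩, ?_⟩
    rw [← sec_zero x y z, ← sec_zero_one x y z, sec_lineMap]
    congr 1
    ext <;> simp [← h1]

theorem Tri.angle (T : A.Tri x y z) : A.Angle x y z where
  hx := T.hx
  hy := T.hy
  hz := T.hz
  sx := T.sx
  sz := T.sz
  li := T.li
  clean := ⟨1/2, by norm_num, fun α β ha hb h0 h1 =>
    T.sec_mem (q := (α, β)) ha hb (by simp only; linarith) h0 (by simp only; linarith)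
      (by simp only; linarith)⟩

theorem Sees.sec_mem {u : X} {q : ℝ × ℝ} (hs : A.Sees y u) (hp : A.p u = A.sec x y z q) {t : ℝ}
    (h0 : 0 < t) (h1 : t < 1) : A.sec x y z (t • q) ∈ A.U := by
  refine (hs.2 _ ?_).1
  rw [openSegment_eq_image_lineMap, hp]
  refine ⟨t, ⟨h0, h1⟩, ?_⟩
  rw [← sec_zero x y z, sec_lineMap]
  simp [Prod.smul_def]

theorem Angle.dist_sec (h : A.Angle x y z) {q : ℝ × ℝ} (h1 : 0 ≤ q.1) (h2 : 0 ≤ q.2)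
    (h0 : 0 < q.1 + q.2) (hU : ∀ s : ℝ, 0 < s → s ≤ 1 → A.sec x y z (s • q) ∈ A.U) :
    dist y (A.pt (A.sec x y z q)) = dist (A.p y) (A.sec x y z q) := by
  have := h.dist_eq h1 h2 h0 (fun s h0 h1 => by rw [sec_smul]; exact hU s h0 h1) one_pos le_rfl
  rwa [sec_smul, one_smul] at this

/-- A ray in a clean sector first leaves the domain at an element seen from the vertex. -/
theorem Angle.exists_exit [CompleteSpace X] (h : A.Angle x y z) {q : ℝ × ℝ} (h1 : 0 ≤ q.1)
    (h2 : 0 ≤ q.2) (h0 : 0 < q.1 + q.2) {t : ℝ} (ht : 0 < t) (hU : A.sec x y z (t • q) ∉ A.U) :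
    ∃ s, 0 < s ∧ s ≤ t ∧ ∃ u ∈ A.Bd, A.p u = A.sec x y z (s • q) ∧ A.Sees y u := by
  obtain ⟨r, hr, hc⟩ := h.clean
  set ε := r / (q.1 + q.2) with hε
  have hε0 : 0 < ε := by positivity
  have hsm : ∀ s, 0 < s → s ≤ ε → A.sec x y z (s • q) ∈ A.U := fun s hs hle => by
    refine hc _ _ (mul_nonneg hs.le h1) (mul_nonneg hs.le h2) ?_ ?_
    · simp only [Prod.smul_fst, Prod.smul_snd, smul_eq_mul]
      rw [← mul_add]; positivity
    · simp only [Prod.smul_fst, Prod.smul_snd, smul_eq_mul]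
      rw [← mul_add]
      rwa [hε, le_div_iff₀ h0] at hle
  have hεt : ε < t := by
    by_contra! hle
    exact hU (hsm t ht hle)
  have hgl : ∀ σ, lin (A.sec x y z (ε • q)) (A.sec x y z (t • q)) σ =
      A.sec x y z ((ε + σ * (t - ε)) • q) := fun σ => by
    rw [lin, sec_lineMap]
    congr 1
    ext <;> simp only [Prod.smul_fst, Prod.smul_snd, smul_eq_mul] <;> ring
  obtain ⟨u, hu, s, hs, hpu, hin⟩ := A.exists_first_exit (hsm ε hε0 le_rfl) hU
  have hd : 0 < t - ε := by linarith
  rw [hgl] at hpu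
  have hs0 : 0 < ε + s * (t - ε) := by have := hs.1; positivity
  have hq : ∀ c : ℝ, A.p y + c • (((ε + s * (t - ε)) • q).1 • (A.p x - A.p y) +
      ((ε + s * (t - ε)) • q).2 • (A.p z - A.p y)) = A.sec x y z ((c * (ε + s * (t - ε))) • q) :=
    fun c => by rw [sec_smul, smul_smul]
  obtain ⟨v, hv, hpv, hsv⟩ := h.exists_elem (α := ((ε + s * (t - ε)) • q).1)
    (β := ((ε + s * (t - ε)) • q).2) (by simp only [Prod.smul_fst, smul_eq_mul]; positivity)
    (by simp only [Prod.smul_snd, smul_eq_mul]; positivity)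
    (by simp only [Prod.smul_fst, Prod.smul_snd, smul_eq_mul]; rw [← mul_add]; positivity)
    (fun c c0 c1 => by
      rw [hq]
      have hc0 : 0 < c * (ε + s * (t - ε)) := by positivity
      rcases le_or_gt (c * (ε + s * (t - ε))) ε with hle | hlt
      · exact hsm _ hc0 hle
      · have := (hin ((c * (ε + s * (t - ε)) - ε) / (t - ε))
          ⟨div_nonneg (by linarith) hd.le, by
            rw [div_lt_iff₀ hd]
            nlinarith⟩).1
        rw [hgl, div_mul_cancel₀ _ hd.ne'] at this
        convert this using 3
        ring)
    (by
      have := hq 1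
      rw [one_smul, one_mul] at this
      rw [this, ← hpu]
      exact hu)
  refine ⟨ε + s * (t - ε), hs0, ?_, v, hv, ?_, hsv⟩
  · nlinarith [hs.2]
  · rw [hpv]; rfl

theorem Angle.sub (h : A.Angle x y z) {u : X} {α β : ℝ} (hu : u ∈ A.Bd) (hs : A.Sees y u)
    (hα : 0 ≤ α) (hβ : 0 < β) (hp : A.p u = A.sec x y z (α, β)) : A.Angle x y u := by
  have pu : A.p u - A.p y = α • (A.p x - A.p y) + β • (A.p z - A.p y) := by
    rw [hp, sec]; module
  refine ⟨h.hx, h.hy, hu, h.sx, hs, fun s t hst => ?_, ?_⟩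
  · rw [pu] at hst
    have := h.li (s + t * α) (t * β) (by rw [← hst]; module)
    have ht : t = 0 := (mul_eq_zero.1 this.2).resolve_right hβ.ne'
    exact ⟨by simpa [ht] using this.1, ht⟩
  · obtain ⟨r, hr, hc⟩ := h.clean
    refine ⟨r / (1 + α + β), by positivity, fun s t h1 h2 h0 hle => ?_⟩
    rw [pu]
    have := hc (s + t * α) (t * β) (by positivity) (by positivity) (by
        rcases h2.lt_or_eq with h2 | rfl
        · have := mul_pos h2 hβ
          have := mul_nonneg h2.le hα
          linarith
        · simpa using h0) (by
        rw [le_div_iff₀ (by positivity)] at hle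
        nlinarith)
    convert this using 2
    module

section
variable {Y : Type} [MetricSpace Y] {B : Dom Y}

variable (A B) in
/-- Congruence of two triples of elements. -/
structure Cong (x y z : X) (x' y' z' : Y) : Prop where
  na : ‖B.p x' - B.p y'‖ = ‖A.p x - A.p y‖
  nb : ‖B.p z' - B.p y'‖ = ‖A.p z - A.p y‖
  ip : inner ℝ (B.p x' - B.p y') (B.p z' - B.p y') = inner ℝ (A.p x - A.p y) (A.p z - A.p y)

variable {x' y' z' : Y}

theorem Cong.dist_sec (c : Cong A B x y z x' y' z') (q q' : ℝ × ℝ) :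
    dist (B.sec x' y' z' q) (B.sec x' y' z' q') = dist (A.sec x y z q) (A.sec x y z q') := by
  rw [dist_eq_norm, dist_eq_norm, sec_sub, sec_sub, norm_comb_eq c.na c.nb c.ip]

theorem Cong.symm (c : Cong A B x y z x' y' z') : Cong B A x' y' z' x y z :=
  ⟨c.na.symm, c.nb.symm, c.ip.symm⟩

theorem Cong.li (c : Cong A B x y z x' y' z')
    (li : ∀ s t : ℝ, s • (A.p x - A.p y) + t • (A.p z - A.p y) = 0 → s = 0 ∧ t = 0) :
    ∀ s t : ℝ, s • (B.p x' - B.p y') + t • (B.p z' - B.p y') = 0 → s = 0 ∧ t = 0 := by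
  refine li_of_gram_pos ?_
  rw [c.na, c.nb, c.ip]
  exact gram_pos li

variable [CompleteSpace Y]

theorem Tri.cong (T : A.Tri x y z) (I : BdIso A B) : Cong A B x y z (I.F x) (I.F y) (I.F z) := by
  have n1 := I.norm_sub T.hy T.hx T.sx
  have n2 := I.norm_sub T.hy T.hz T.sz
  refine ⟨n1, n2, ?_⟩
  have n3 := I.norm_sub T.hz T.hx T.sxz.symm
  have e1 := norm_sub_sq_real (B.p (I.F x) - B.p (I.F y)) (B.p (I.F z) - B.p (I.F y))
  have e2 := norm_sub_sq_real (A.p x - A.p y) (A.p z - A.p y)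
  rw [sub_sub_sub_cancel_right] at e1 e2
  rw [n1, n2, n3] at e1
  linarith

variable [CompleteSpace X]

theorem Cong.p_eq (I : BdIso A B) (c : Cong A B x y z (I.F x) (I.F y) (I.F z))
    (h : A.Angle x y z) {u : X} (hu : u ∈ A.Bd) (hs : A.Sees y u) {q : ℝ × ℝ} (h1 : 0 < q.1)
    (h2 : 0 < q.2) (hp : A.p u = A.sec x y z q) :
    B.p (I.F u) = B.sec (I.F x) (I.F y) (I.F z) q := by
  have pu : A.p u - A.p y = q.1 • (A.p x - A.p y) + q.2 • (A.p z - A.p y) := by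
    rw [hp, sec]; module
  have a1 := (h.sub hu hs h1.le h2 hp).inner_le I
  have a2 := (h.symm.sub hu hs h2.le h1 (by rw [hp, sec_symm])).inner_le I
  have := eq_comb_of_inner_le c.na c.nb c.ip h1.le h2.le (u' := B.p (I.F u) - B.p (I.F y))
    (by rw [I.norm_sub h.hy hu hs, pu]) (by rw [← pu]; exact a1) (by rw [← pu]; exact a2)
  rw [sec, ← this]
  module

/-- A ray through a foreign point of the image triangle never leaves the domain. -/
theorem Tri.ray_mem (T : A.Tri x y z) (I : BdIso A B) {q : ℝ × ℝ} (h1 : 0 < q.1) (h2 : 0 < q.2)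
    (h3 : q.1 + q.2 ≤ 1) (hq : B.sec (I.F x) (I.F y) (I.F z) q ∉ B.U) {t : ℝ} (ht : 0 < t) :
    A.sec x y z (t • q) ∈ A.U := by
  by_contra hU
  obtain ⟨s, hs, -, u, hu, hpu, hsu⟩ := T.angle.exists_exit h1.le h2.le (by linarith) ht hU
  have hs1 : 1 < s := by
    by_contra! hle
    refine hu ?_
    rw [hpu]
    refine T.sec_mem ?_ ?_ ?_ ?_ ?_ ?_ <;>
      simp only [Prod.smul_fst, Prod.smul_snd, smul_eq_mul] <;> nlinarith
  have hp := (T.cong I).p_eq I T.angle hu hsu (q := s • q) (by simp only [Prod.smul_fst, smul_eq_mul]; positivity)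
    (by simp only [Prod.smul_snd, smul_eq_mul]; positivity) hpu
  have := (I.sees T.hy hu hsu).sec_mem hp (t := s⁻¹) (by positivity) (inv_lt_one_of_one_lt₀ hs1)
  rw [smul_smul, inv_mul_cancel₀ (by positivity), one_smul] at this
  exact hq this

/-- If the image triangle contains a foreign point, there are such points near each vertex. -/
theorem Tri.unclean (T : A.Tri x y z) (I : BdIso A B) {q : ℝ × ℝ} (h1 : 0 < q.1) (h2 : 0 < q.2)
    (h3 : q.1 + q.2 < 1) (hq : B.sec (I.F x) (I.F y) (I.F z) q ∉ B.U) {r : ℝ} (hr : 0 < r) :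
    ∃ p : ℝ × ℝ, 0 < p.1 ∧ 0 < p.2 ∧ p.1 + p.2 < r ∧
      B.sec (I.F x) (I.F y) (I.F z) p ∉ B.U := by
  by_contra! hno
  have c := T.cong I
  have h' : B.Angle (I.F x) (I.F y) (I.F z) := by
    refine ⟨I.F_mem x T.hx, I.F_mem y T.hy, I.F_mem z T.hz, I.sees T.hy T.hx T.sx,
      I.sees T.hy T.hz T.sz, c.li T.li, min (r / 2) (1 / 2), by positivity,
      fun α β hα hβ h0 hle => ?_⟩
    have l1 := hle.trans (min_le_left _ _)
    have l2 := hle.trans (min_le_right _ _)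
    rcases hα.lt_or_eq with hα | rfl
    · rcases hβ.lt_or_eq with hβ | rfl
      · exact hno (α, β) hα hβ (by simp only; linarith)
      · have := (I.sees T.hy T.hx T.sx).sec_mem (x := I.F x) (z := I.F z) (q := (1, 0))
          (sec_one_zero _ _ _).symm (t := α) hα (by linarith)
        simpa [sec] using this
    · have := (I.sees T.hy T.hz T.sz).sec_mem (x := I.F x) (z := I.F z) (q := (0, 1))
          (sec_zero_one _ _ _).symm (t := β) (by linarith) (by linarith)
      simpa [sec] using this
  obtain ⟨s, hs, hs1, u, hu, hpu, hsu⟩ := h'.exists_exit h1.le h2.le (by linarith) one_pos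
    (by rwa [one_smul])
  have c' : Cong B A (I.F x) (I.F y) (I.F z) (I.symm.F (I.F x)) (I.symm.F (I.F y))
      (I.symm.F (I.F z)) := by
    simp only [BdIso.symm, I.GF x T.hx, I.GF y T.hy, I.GF z T.hz]
    exact c.symm
  have hp := c'.p_eq I.symm h' hu hsu (q := s • q)
    (by simp only [Prod.smul_fst, smul_eq_mul]; positivity)
    (by simp only [Prod.smul_snd, smul_eq_mul]; positivity) hpu
  have hG : I.G u ∈ A.Bd := I.G_mem u hu
  refine hG ?_
  have : I.symm.F u = I.G u := rfl
  rw [← this, hp]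
  simp only [BdIso.symm, I.GF x T.hx, I.GF y T.hy, I.GF z T.hz]
  refine T.int _ _ ?_ ?_ ?_ <;> simp only [Prod.smul_fst, Prod.smul_snd, smul_eq_mul] <;> nlinarith

end

end Dom

namespace Dom
variable {X : Type} [MetricSpace X] {A : Dom X} {x y z : X}

theorem exists_coord
    (li : ∀ s t : ℝ, s • (A.p x - A.p y) + t • (A.p z - A.p y) = 0 → s = 0 ∧ t = 0) :
    ∃ cf : Euc 2 → ℝ × ℝ, Continuous cf ∧ (∀ P, A.sec x y z (cf P) = P) ∧
      ∀ q, cf (A.sec x y z q) = q := by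
  have hli : LinearIndependent ℝ ![A.p x - A.p y, A.p z - A.p y] :=
    LinearIndependent.pair_iff.2 li
  set b := basisOfLinearIndependentOfCardEqFinrank hli (by simp) with hb
  have hb0 : b 0 = A.p x - A.p y := by simp [hb]
  have hb1 : b 1 = A.p z - A.p y := by simp [hb]
  have key : ∀ P, A.sec x y z (b.coord 0 (P - A.p y), b.coord 1 (P - A.p y)) = P := by
    intro P
    have := b.sum_repr (P - A.p y)
    rw [Fin.sum_univ_two, hb0, hb1] at this
    simp only [sec, Module.Basis.coord_apply, this]
    module
  refine ⟨fun P => (b.coord 0 (P - A.p y), b.coord 1 (P - A.p y)), ?_, key, fun q => ?_⟩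
  · have h0 := (b.coord 0).continuous_of_finiteDimensional
    have h1 := (b.coord 1).continuous_of_finiteDimensional
    fun_prop
  · have := key (A.sec x y z q)
    rw [← sub_eq_zero, sec_sub] at this
    have := li _ _ this
    ext
    · linarith [this.1]
    · linarith [this.2]

theorem Tri.exists_edge_pt [CompleteSpace X] (T : A.Tri x y z) {τ₁ τ₂ : ℝ} {c : X} {q : ℝ × ℝ}
    (hp : A.p c = A.sec x y z q) (h0 : 0 < τ₁) (h1 : τ₂ < 1)
    (hq : 1 < q.1 + q.2) (hq1 : τ₁ * (q.1 + q.2) < q.2) (hq2 : q.2 < τ₂ * (q.1 + q.2))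
    (ray₁ : ∀ t : ℝ, 0 < t → A.sec x y z (t * (1 - τ₁), t * τ₁) ∈ A.U)
    (ray₂ : ∀ t : ℝ, 0 < t → A.sec x y z (t * (1 - τ₂), t * τ₂) ∈ A.U) :
    ∃ τ, 0 < τ ∧ τ < 1 ∧ dist c (A.pt (A.sec x y z (1 - τ, τ))) +
      dist (A.p y) (A.sec x y z (1 - τ, τ)) ≤ dist c y := by
  obtain ⟨cf, hcf, hcf1, hcf2⟩ := exists_coord T.li
  have h12 : τ₁ < τ₂ := by nlinarith
  have hcon := continuous_sec (A := A) x y z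
  set g : ℝ → Euc 2 := fun τ => A.sec x y z (1 - τ, τ) with hg
  have hgc : Continuous g := hcon.comp (by fun_prop)
  have hgU : ∀ τ ∈ Icc τ₁ τ₂, g τ ∈ A.U := fun τ hτ => by
    refine T.sec_mem ?_ ?_ ?_ ?_ ?_ ?_ <;> simp only <;> linarith [hτ.1, hτ.2]
  set G : ℝ → ℝ := fun τ => dist c (A.pt (g τ)) + dist (A.p y) (g τ) with hG
  have hGc : ContinuousOn G (Icc τ₁ τ₂) :=
    (continuous_dist.comp_continuousOn (continuousOn_const.prodMk
      (A.continuousOn_pt.comp hgc.continuousOn hgU))).add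
      (continuous_dist.comp_continuousOn (continuousOn_const.prodMk hgc.continuousOn))
  obtain ⟨τ, hτ, hmin⟩ := isCompact_Icc.exists_isMinOn (nonempty_Icc.2 h12.le) hGc
  have hray : ∀ n : ℝ × ℝ, 0 < n.1 → 0 < n.2 →
      (∀ s : ℝ, 0 < s → s ≤ 1 → A.sec x y z (s • n) ∈ A.U) → 
      dist y (A.pt (A.sec x y z n)) = dist (A.p y) (A.sec x y z n) := fun n h1 h2 h =>
    T.angle.dist_sec h1.le h2.le (by linarith) h
  refine ⟨τ, h0.trans_le hτ.1, hτ.2.trans_lt h1, ?_⟩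
  change G τ ≤ _
  refine le_of_forall_pos_le_add fun ε hε => ?_
  obtain ⟨N, hN, hφ, hd⟩ := A.exists_crossing (a := c) (b := y)
    (φ := fun a => - min (min ((cf (A.p a)).2 - τ₁ * ((cf (A.p a)).1 + (cf (A.p a)).2))
      (τ₂ * ((cf (A.p a)).1 + (cf (A.p a)).2) - (cf (A.p a)).2))
      ((cf (A.p a)).1 + (cf (A.p a)).2 - 1))
    (by have h : Continuous fun a => cf (A.p a) := hcf.comp A.continuous_p
        exact (((h.snd.sub (continuous_const.mul (h.fst.add h.snd))).min
          ((continuous_const.mul (h.fst.add h.snd)).sub h.snd)).min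
          ((h.fst.add h.snd).sub continuous_const)).neg)
    (by simp only [hp, hcf2, neg_lt_zero, lt_min_iff]
        refine ⟨⟨?_, ?_⟩, ?_⟩ <;> linarith)
    (by simp only [← sec_zero (A := A) x y z, hcf2]; norm_num)
    (show dist c y < dist c y + ε by linarith)
  rw [A.p_pt N hN] at hφ
  set n := cf N with hn
  have hNn : A.sec x y z n = N := hcf1 N
  have hmn : min (min (n.2 - τ₁ * (n.1 + n.2)) (τ₂ * (n.1 + n.2) - n.2)) (n.1 + n.2 - 1) = 0 := by
    simpa using hφ
  have k1 : 0 ≤ n.2 - τ₁ * (n.1 + n.2) := hmn ▸ (min_le_left _ _).trans (min_le_left _ _)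
  have k2 : 0 ≤ τ₂ * (n.1 + n.2) - n.2 := hmn ▸ (min_le_left _ _).trans (min_le_right _ _)
  have k3 : 0 ≤ n.1 + n.2 - 1 := hmn ▸ min_le_right _ _
  set t := n.1 + n.2 with ht
  have ht0 : 0 < t := by linarith
  set σ := n.2 / t with hσ
  have e2 : n.2 = t * σ := by rw [hσ]; field_simp
  have e1 : n.1 = t * (1 - σ) := by rw [mul_sub, ← e2]; linarith
  have hσm : σ ∈ Icc τ₁ τ₂ := by
    rw [hσ]; exact ⟨by rw [le_div_iff₀ ht0]; linarith, by rw [div_le_iff₀ ht0]; linarith⟩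
  have hσ0 : 0 < σ := h0.trans_le hσm.1
  have hσ1 : σ < 1 := hσm.2.trans_lt h1
  have hU : ∀ s : ℝ, 0 < s → s ≤ t → A.sec x y z (s * (1 - σ), s * σ) ∈ A.U := by
    intro s hs hst
    by_cases hk : s ≤ 1
    · refine T.sec_mem ?_ ?_ ?_ ?_ ?_ ?_ <;> simp only <;> nlinarith
    · have : σ = τ₁ ∨ σ = τ₂ := by
        rcases min_choice (min (n.2 - τ₁ * t) (τ₂ * t - n.2)) (t - 1) with h | h
        · rcases min_choice (n.2 - τ₁ * t) (τ₂ * t - n.2) with h' | h'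
          · left; rw [hσ, div_eq_iff ht0.ne']; rw [h, h'] at hmn; linarith
          · right; rw [hσ, div_eq_iff ht0.ne']; rw [h, h'] at hmn; linarith
        · rw [h] at hmn; exfalso; linarith
      rcases this with h | h <;> rw [h]
      · exact ray₁ s hs
      · exact ray₂ s hs
  have hNs : N = A.sec x y z (t * (1 - σ), t * σ) := by rw [← hNn, ← e1, ← e2]
  have d1 : dist y (A.pt N) = dist (A.p y) N := by
    rw [hNs]
    refine hray _ (mul_pos ht0 (by linarith)) (mul_pos ht0 hσ0) fun s hs hs1 => ?_
    have := hU (s * t) (by positivity) (by nlinarith)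
    simpa [Prod.smul_def, mul_assoc] using this
  have hlin : ∀ s, lin (A.p y) (g σ) s = A.sec x y z (s * (1 - σ), s * σ) := fun s => by
    rw [← sec_zero x y z, lin, sec_lineMap]; simp
  have eN : N = lin (A.p y) (g σ) t := by rw [hlin, ← hNs]
  have d2 : dist (A.pt N) (A.pt (g σ)) = (t - 1) * dist (A.p y) (g σ) := by
    have eg : lin (A.p y) (g σ) 1 = g σ := by simp [lin]
    have hRs : ∀ R ∈ segment ℝ (lin (A.p y) (g σ) 1) (lin (A.p y) (g σ) t), R ∈ A.U := by
      intro R hR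
      obtain ⟨s, hs, rfl⟩ := segment_lineMap _ _ (by linarith) hR
      rw [hlin]
      exact hU s (by linarith [hs.1]) hs.2
    rw [eg, ← eN] at hRs
    have e3 := dist_lineMap_nonneg (A.p y) (g σ) (s := 1) (t := t) (by linarith)
    rw [AffineMap.lineMap_apply_one] at e3
    rw [A.dist_pt (fun R hR => hRs R (by rwa [segment_symm])), eN]
    exact e3
  have d3 : dist (A.p y) N = t * dist (A.p y) (g σ) := by
    rw [eN, lin, dist_left_lineMap, Real.norm_eq_abs, abs_of_pos ht0]
  have d4 := dist_triangle c (A.pt N) (A.pt (g σ))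
  have := hmin hσm
  simp only [mem_ofPred_eq, hG] at this ⊢
  rw [dist_comm (A.pt N) y] at hd
  linarith

/-- Behind an edge of the sector one finds an element, seen from the vertex, that lies on a
shortest path from the vertex. -/
theorem Tri.exists_through [CompleteSpace X] (T : A.Tri x y z) {τ₁ τ₂ : ℝ} {c : X} {q : ℝ × ℝ}
    (hc : c ∈ A.Bd) (hp : A.p c = A.sec x y z q) (h0 : 0 < τ₁) (h1 : τ₂ < 1)
    (hq : 1 < q.1 + q.2) (hq1 : τ₁ * (q.1 + q.2) < q.2) (hq2 : q.2 < τ₂ * (q.1 + q.2))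
    (ray₁ : ∀ t : ℝ, 0 < t → A.sec x y z (t * (1 - τ₁), t * τ₁) ∈ A.U)
    (ray₂ : ∀ t : ℝ, 0 < t → A.sec x y z (t * (1 - τ₂), t * τ₂) ∈ A.U) :
    ∃ u ∈ A.Bd, ∃ τ, 0 < τ ∧ τ < 1 ∧ ∃ l, 1 < l ∧ A.p u = A.sec x y z (l * (1 - τ), l * τ) ∧
      A.Sees y u ∧ dist c u + dist u y ≤ dist c y := by
  obtain ⟨τ, hτ0, hτ1, hle⟩ := T.exists_edge_pt hp h0 h1 hq hq1 hq2 ray₁ ray₂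
  set G := A.sec x y z (1 - τ, τ) with hg
  have hgU : G ∈ A.U := by
    refine T.sec_mem ?_ ?_ ?_ ?_ ?_ ?_ <;> simp only <;> linarith
  have hray : ∀ n : ℝ × ℝ, 0 < n.1 → 0 < n.2 →
      (∀ s : ℝ, 0 < s → s ≤ 1 → A.sec x y z (s • n) ∈ A.U) →
      dist y (A.pt (A.sec x y z n)) = dist (A.p y) (A.sec x y z n) := fun n h1 h2 h =>
    T.angle.dist_sec h1.le h2.le (by linarith) h
  set v := lin (A.p y) G (1/2) with hv
  have hlin : ∀ s, lin (A.p y) G s = A.sec x y z (s * (1 - τ), s * τ) := fun s => by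
    rw [← sec_zero x y z, lin, hg, sec_lineMap]; simp
  have hUs : ∀ s : ℝ, 0 < s → s ≤ 1 → lin (A.p y) G s ∈ A.U := fun s hs hs1 => by
    rw [hlin]
    refine T.sec_mem ?_ ?_ ?_ ?_ ?_ ?_ <;> simp only <;> nlinarith
  have hne : A.p y ≠ G := fun h => T.hy (h ▸ hgU)
  set D := dist (A.p y) G with hD
  have hD0 : 0 < D := dist_pos.2 hne
  have hdy : ∀ s : ℝ, 0 < s → (∀ r, 0 < r → r ≤ s → lin (A.p y) G r ∈ A.U) →
      dist y (A.pt (lin (A.p y) G s)) = s * D := fun s hs h => by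
    have : dist y (A.pt (lin (A.p y) G s)) = dist (A.p y) (lin (A.p y) G s) := by
      rw [hlin]
      refine hray _ (mul_pos hs (by linarith)) (mul_pos hs hτ0) fun r hr hr1 => ?_
      have := h (r * s) (by positivity) (by nlinarith)
      rw [hlin] at this
      simpa [Prod.smul_def, mul_assoc] using this
    rw [this, lin, dist_left_lineMap, Real.norm_eq_abs, abs_of_pos hs]
  have hlg : lin (A.p y) G 1 = G := by simp [lin]
  have hvg : dist v G = 1 / 2 * D := by
    rw [hv, lin, dist_lineMap_right, ← hD]; norm_num
  have hvseg : segment ℝ v G ⊆ A.U := fun R hR => by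
    rw [hv] at hR
    nth_rw 2 [← hlg] at hR
    obtain ⟨s, hs, rfl⟩ := segment_lineMap _ _ (by norm_num) hR
    exact hUs s (by linarith [hs.1]) hs.2
  have hdv : dist c (A.pt v) = dist c (A.pt G) + dist v G := by
    refine le_antisymm ?_ ?_
    · have := dist_triangle c (A.pt G) (A.pt v)
      rwa [dist_comm (A.pt G), A.dist_pt hvseg] at this
    · have e := hdy (1/2) (by norm_num) fun r h0 h1 => hUs r h0 (by linarith)
      have := dist_triangle c (A.pt v) y
      rw [dist_comm (A.pt v) y, e] at this
      rw [hvg]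
      linarith
  obtain ⟨u, hu, s, hs, hpu, hσ, hdu⟩ := A.exists_extension hc
    (dist_pos.1 (by rw [hvg]; positivity)) hvseg hdv
  have hvl : ∀ σ, lin v G σ = lin (A.p y) G ((1 + σ) / 2) := fun σ => by
    simp only [hv, lin, AffineMap.lineMap_apply_module']
    module
  have hUl : ∀ r, 0 < r → r < (1 + s) / 2 → lin (A.p y) G r ∈ A.U := fun r hr hrs => by
    by_cases h : r ≤ 1
    · exact hUs r hr h
    · have := (hσ (2 * r - 1) ⟨by linarith, by linarith⟩).1
      rwa [hvl, show (1 + (2 * r - 1)) / 2 = r by ring] at this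
  have hpul : A.p u = lin (A.p y) G ((1 + s) / 2) := by rw [hpu, hvl]
  have hsee : A.Sees y u := by
    refine ⟨?_, fun R hR => ?_⟩
    · rw [hpul, ← dist_pos, lin, dist_left_lineMap, Real.norm_eq_abs,
        abs_of_pos (by linarith)]
      exact mul_pos (by linarith) hD0
    · rw [openSegment_eq_image_lineMap] at hR
      obtain ⟨r, hr, rfl⟩ := hR
      have er : AffineMap.lineMap (A.p y) (A.p u) r = lin (A.p y) G (r * ((1 + s) / 2)) := by
        rw [hpul]; simp only [lin, AffineMap.lineMap_apply_module']; module
      rw [er]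
      set r' := r * ((1 + s) / 2) with hr'
      have hr0 : 0 < r' := mul_pos hr.1 (by linarith)
      have hr1 : r' < (1 + s) / 2 := by nlinarith [hr.2]
      refine ⟨hUl r' hr0 hr1, ?_, le_antisymm ?_ (A.dist_p_le (hUl r' hr0 hr1))⟩
      · rw [hdy r' hr0 fun t h0 h1 => hUl t h0 (by linarith), lin, dist_left_lineMap,
          Real.norm_eq_abs, abs_of_pos hr0]
      · rw [hpul, lin, dist_lineMap_nonneg _ _ hr1.le]
        by_cases h : 1 / 2 ≤ r'
        · have := (hσ (2 * r' - 1) ⟨by linarith, by linarith⟩).2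
          rw [hvl, show (1 + (2 * r' - 1)) / 2 = r' by ring, hvg] at this
          change dist u (A.pt (lin (A.p y) G r')) ≤ _
          rw [this]
          linarith
        · have := (hσ 0 ⟨le_rfl, by linarith⟩).2
          rw [hvl, hvg] at this
          have t := dist_triangle u (A.pt (lin (A.p y) G ((1 + 0) / 2)))
            (A.pt (lin (A.p y) G r'))
          have e : dist (A.pt (lin (A.p y) G ((1 + 0) / 2))) (A.pt (lin (A.p y) G r')) =
              (1 / 2 - r') * D := by
            rw [A.dist_pt, lin, lin, dist_lineMap_nonneg _ _ (by linarith)]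
            · rw [← hD]; norm_num
            · intro R hR
              rw [segment_symm] at hR
              obtain ⟨t, ht, rfl⟩ := segment_lineMap _ _ (by linarith) hR
              exact hUl t (by linarith [ht.1]) (by linarith [ht.2])
          rw [this, e] at t
          refine t.trans (le_of_eq ?_)
          ring
  refine ⟨u, hu, τ, hτ0, hτ1, (1 + s) / 2, by linarith, by rw [hpul, hlin], hsee, ?_⟩
  have : dist u y = (1 + s) / 2 * D := by
    rw [hsee.symm.dist_eq, dist_comm, hpul, lin, dist_left_lineMap, Real.norm_eq_abs,
      abs_of_pos (by linarith)]
  rw [this]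
  rw [hdv, hvg] at hdu
  linarith

end Dom

namespace Dom
variable {X : Type} [MetricSpace X] {A : Dom X} {x y z : X}

/-- A point beyond the edge has a uniformly positive detour through the triangle. -/
theorem exists_detour
    (li : ∀ s t : ℝ, s • (A.p x - A.p y) + t • (A.p z - A.p y) = 0 → s = 0 ∧ t = 0) {q : ℝ × ℝ}
    (hq : 1 < q.1 + q.2) : ∃ δ, 0 < δ ∧ ∀ n m : ℝ × ℝ, 0 ≤ n.1 → 0 ≤ n.2 → n.1 + n.2 ≤ 1 →
      0 ≤ m.1 → 0 ≤ m.2 → m.1 + m.2 ≤ 1 →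
      dist (A.sec x y z n) (A.sec x y z m) + δ ≤
        dist (A.sec x y z n) (A.sec x y z q) + dist (A.sec x y z q) (A.sec x y z m) := by
  set K : Set (ℝ × ℝ) := {n | 0 ≤ n.1 ∧ 0 ≤ n.2 ∧ n.1 + n.2 ≤ 1} with hK
  have hKc : IsCompact K := by
    refine (isCompact_Icc (a := ((0, 0) : ℝ × ℝ)) (b := (1, 1))).of_isClosed_subset ?_ ?_
    · refine IsClosed.inter (isClosed_le continuous_const continuous_fst) (IsClosed.inter
        (isClosed_le continuous_const continuous_snd)
        (isClosed_le (continuous_fst.add continuous_snd) continuous_const))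
    · rintro n ⟨h1, h2, h3⟩
      exact ⟨⟨h1, h2⟩, by simp only; linarith, by simp only; linarith⟩
  obtain ⟨⟨n, m⟩, ⟨hn, hm⟩, hmin⟩ := (hKc.prod hKc).exists_isMinOn
    (f := fun w : (ℝ × ℝ) × (ℝ × ℝ) => dist (A.sec x y z w.1) (A.sec x y z q) +
      dist (A.sec x y z q) (A.sec x y z w.2) - dist (A.sec x y z w.1) (A.sec x y z w.2))
    ⟨((0, 0), (0, 0)), by simp [hK]⟩
    (by have := continuous_sec (A := A) x y z
        fun_prop)
  refine ⟨dist (A.sec x y z n) (A.sec x y z q) + dist (A.sec x y z q) (A.sec x y z m) -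
    dist (A.sec x y z n) (A.sec x y z m), ?_, fun n m h1 h2 h3 h4 h5 h6 => ?_⟩
  rotate_left
  · have := hmin (a := (n, m)) ⟨⟨h1, h2, h3⟩, ⟨h4, h5, h6⟩⟩
    rw [mem_ofPred_eq] at this
    linarith
  · have h0 := dist_triangle (A.sec x y z n) (A.sec x y z q) (A.sec x y z m)
    refine lt_of_le_of_ne (by linarith) fun h => ?_
    have hb := dist_add_dist_eq_iff.1 (sub_eq_zero.1 h.symm)
    obtain ⟨t, ht, he⟩ := hb
    rw [sec_lineMap, ← sub_eq_zero, sec_sub] at he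
    have := li _ _ he
    simp only at this
    obtain ⟨-, -, hn3⟩ := hn
    obtain ⟨-, -, hm3⟩ := hm
    simp only at hn3 hm3
    nlinarith [ht.1, ht.2]

/-- A shortest path from a vertex to an element inside the triangle does not come from an element
beyond the opposite edge. -/
theorem no_through
    (li : ∀ s t : ℝ, s • (A.p x - A.p y) + t • (A.p z - A.p y) = 0 → s = 0 ∧ t = 0)
    (hx : x ∈ A.Bd) (hy : y ∈ A.Bd) (hz : z ∈ A.Bd)
    (sx : A.Sees y x) (sz : A.Sees y z) (sxz : A.Sees x z) {c u : X} {q : ℝ × ℝ} {τ l : ℝ}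
    (hq1 : 0 < q.1) (hq2 : 0 < q.2) (hq : q.1 + q.2 < 1) (hc : A.p c = A.sec x y z q)
    (h0 : 0 < τ) (h1 : τ < 1) (hl : 1 < l) (hu : A.p u = A.sec x y z (l * (1 - τ), l * τ))
    (hs : A.Sees y u) (hd : dist c u + dist u y ≤ dist c y) : False := by
  obtain ⟨cf, hcf, hcf1, hcf2⟩ := exists_coord li
  obtain ⟨δ, hδ, hdet⟩ := exists_detour li (q := (l * (1 - τ), l * τ)) (by simp only; linarith)
  obtain ⟨N, hN, hφ, hcr⟩ := A.exists_crossing (a := c) (b := u)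
    (φ := fun a => - min (min (cf (A.p a)).1 (cf (A.p a)).2) (1 - (cf (A.p a)).1 - (cf (A.p a)).2))
    (by have h : Continuous fun a => cf (A.p a) := hcf.comp A.continuous_p
        exact ((h.fst.min h.snd).min ((continuous_const.sub h.fst).sub h.snd)).neg)
    (by simp only [hc, hcf2, neg_lt_zero, lt_min_iff]
        exact ⟨⟨hq1, hq2⟩, by linarith⟩)
    (by simp only [hu, hcf2, neg_pos]
        exact (min_le_right _ _).trans_lt (by linarith))
    (show dist c u < dist c u + δ by linarith)
  rw [A.p_pt N hN] at hφ
  set n := cf N with hn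
  have hNn : A.sec x y z n = N := hcf1 N
  have hmn : min (min n.1 n.2) (1 - n.1 - n.2) = 0 := by simpa using hφ
  have k1 : 0 ≤ n.1 := hmn ▸ (min_le_left _ _).trans (min_le_left _ _)
  have k2 : 0 ≤ n.2 := hmn ▸ (min_le_left _ _).trans (min_le_right _ _)
  have k3 : 0 ≤ 1 - n.1 - n.2 := hmn ▸ min_le_right _ _
  have huN : dist (A.p u) N ≤ dist u (A.pt N) := A.dist_p_le hN
  have hsd := hs.symm.dist_eq
  have hNx : N ≠ A.p x := fun h => hx (h ▸ hN)
  have hNy : N ≠ A.p y := fun h => hy (h ▸ hN)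
  have hNz : N ≠ A.p z := fun h => hz (h ▸ hN)
  have hnx : n ≠ (1, 0) := fun h => hNx (by rw [← hNn, h, sec_one_zero])
  have hny : n ≠ (0, 0) := fun h => hNy (by rw [← hNn, h, sec_zero])
  have hnz : n ≠ (0, 1) := fun h => hNz (by rw [← hNn, h, sec_zero_one])
  -- the crossing point would be on an edge at `y`
  have key : dist y (A.pt N) = dist (A.p y) N → False := fun h => by
    have := hdet n (0, 0) k1 k2 (by linarith) le_rfl le_rfl (by norm_num)
    rw [hNn, sec_zero, ← hu] at this
    have := dist_triangle c (A.pt N) y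
    rw [dist_comm (A.pt N) y, h] at this
    rw [dist_comm (A.pt N) u] at hcr
    rw [dist_comm N (A.p u), dist_comm N] at *
    linarith
  by_cases e1 : n.1 = 0
  · refine key (sz.2 N ?_).2.1
    rw [openSegment_eq_image_lineMap]
    refine ⟨n.2, ⟨k2.lt_of_ne fun h => hny (Prod.ext e1 h.symm), ?_⟩, ?_⟩
    · exact lt_of_le_of_ne (by linarith) fun h => hnz (Prod.ext e1 h)
    · rw [← sec_zero x y z, ← sec_zero_one x y z, sec_lineMap, ← hNn]
      congr 1
      ext <;> simp [e1]
  by_cases e2 : n.2 = 0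
  · refine key (sx.2 N ?_).2.1
    rw [openSegment_eq_image_lineMap]
    refine ⟨n.1, ⟨k1.lt_of_ne' e1, ?_⟩, ?_⟩
    · exact lt_of_le_of_ne (by linarith) fun h => hnx (Prod.ext h e2)
    · rw [← sec_zero x y z, ← sec_one_zero x y z, sec_lineMap, ← hNn]
      congr 1
      ext <;> simp [e2]
  have p1 := k1.lt_of_ne' e1
  have p2 := k2.lt_of_ne' e2
  have e3 : n.1 + n.2 = 1 := by
    rcases min_choice (min n.1 n.2) (1 - n.1 - n.2) with h | h
    · have := lt_min p1 p2
      rw [hmn] at h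
      linarith
    · rw [hmn] at h; linarith
  have hop : ∀ m : ℝ × ℝ, 0 < m.1 → 0 < m.2 → m.1 + m.2 = 1 →
      A.sec x y z m ∈ openSegment ℝ (A.p x) (A.p z) := by
    intro m h1 h2 h3
    rw [openSegment_eq_image_lineMap]
    refine ⟨m.2, ⟨h2, by linarith⟩, ?_⟩
    rw [← sec_one_zero x y z, ← sec_zero_one x y z, sec_lineMap]
    congr 1
    ext <;> simp
    linarith
  set M := A.sec x y z (1 - τ, τ) with hM
  have hMo : M ∈ openSegment ℝ (A.p x) (A.p z) := hop _ (by simp only; linarith) h0 (by simp only; ring)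
  have hNo : N ∈ openSegment ℝ (A.p x) (A.p z) := hNn ▸ hop n p1 p2 e3
  have hNM : dist (A.pt N) (A.pt M) = dist N M := A.dist_pt fun R hR =>
    (sxz.2 R ((convex_openSegment _ _).segment_subset hNo hMo hR)).1
  have hMl : M = AffineMap.lineMap (A.p y) (A.p u) l⁻¹ := by
    rw [hu, ← sec_zero x y z, sec_lineMap, hM]
    congr 1
    have : l ≠ 0 := by linarith
    ext <;> simp <;> field_simp
  have hli0 : 0 < l⁻¹ := by positivity
  have hli1 : l⁻¹ < 1 := inv_lt_one_of_one_lt₀ hl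
  have hMu : M ∈ openSegment ℝ (A.p y) (A.p u) := by
    rw [openSegment_eq_image_lineMap]
    exact ⟨_, ⟨hli0, hli1⟩, hMl.symm⟩
  have hyM := (hs.2 M hMu).2.1
  have huM : dist (A.p u) M + dist (A.p y) M = dist (A.p u) (A.p y) := by
    rw [hMl, dist_comm (A.p u), dist_lineMap_right, dist_left_lineMap, Real.norm_eq_abs,
      Real.norm_eq_abs, abs_of_pos hli0, abs_of_pos (by linarith), dist_comm (A.p u)]
    ring
  have t1 := dist_triangle c (A.pt M) y
  have t2 := dist_triangle c (A.pt N) (A.pt M)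
  have := hdet n (1 - τ, τ) k1 k2 e3.le (by simp only; linarith) h0.le (by simp only; linarith)
  rw [hNn, ← hu, ← hM, dist_comm N (A.p u)] at this
  rw [dist_comm (A.pt M) y, hyM] at t1
  rw [dist_comm (A.pt N) u] at hcr
  linarith

variable {Y : Type} [MetricSpace Y] {B : Dom Y} [CompleteSpace X] [CompleteSpace Y]

/-- An element beyond an edge of a triangle is not mapped into the image triangle. -/
theorem Tri.no_beyond (T : A.Tri x y z) (I : BdIso A B) {c : X} {q q' : ℝ × ℝ}
    (hc : c ∈ A.Bd) (hp : A.p c = A.sec x y z q) (hq1 : 0 < q.1) (hq2 : 0 < q.2)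
    (hq : 1 < q.1 + q.2) (hp' : B.p (I.F c) = B.sec (I.F x) (I.F y) (I.F z) q')
    (hq1' : 0 < q'.1) (hq2' : 0 < q'.2) (hq' : q'.1 + q'.2 < 1) : False := by
  have hc' := I.F_mem c hc
  have hno : B.sec (I.F x) (I.F y) (I.F z) q' ∉ B.U := hp' ▸ hc'
  set r := min (q.2 / (q.1 + q.2)) (q.1 / (q.1 + q.2)) / 2 with hr
  have hs0 : 0 < q.1 + q.2 := by linarith
  have hr0 : 0 < r := by positivity
  have hr1 : r * (q.1 + q.2) < q.2 := by
    have := (le_div_iff₀ hs0).1 (min_le_left (q.2 / (q.1 + q.2)) (q.1 / (q.1 + q.2)))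
    rw [hr]; linarith
  have hr2 : r * (q.1 + q.2) < q.1 := by
    have := (le_div_iff₀ hs0).1 (min_le_right (q.2 / (q.1 + q.2)) (q.1 / (q.1 + q.2)))
    rw [hr]; linarith
  have hrh : r < 1 := by nlinarith
  -- obstacles near the endpoints of the edge
  obtain ⟨m, m1, m2, m3, m4⟩ := T.rot.rot.unclean I (q := (q'.2, 1 - q'.1 - q'.2))
    hq2' (by simp only; linarith) (by simp only; linarith)
    (by rw [sec_rot, sec_rot]
        convert hno using 2
        exact congrArg _ (by ext <;> simp only <;> ring)) hr0
  obtain ⟨n, n1, n2, n3, n4⟩ := T.rot.unclean I (q := (1 - q'.1 - q'.2, q'.1))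
    (by simp only; linarith) hq1' (by simp only; linarith)
    (by rw [sec_rot]
        convert hno using 2
        exact congrArg _ (by ext <;> simp only <;> ring)) hr0
  rw [sec_rot, sec_rot, show ((m.2, 1 - m.1 - m.2).2, 1 - (m.2, 1 - m.1 - m.2).1 -
    (m.2, 1 - m.1 - m.2).2) = (1 - m.1 - m.2, m.1) by ext <;> simp] at m4
  rw [sec_rot] at n4
  have hm2 : 0 < 1 - m.2 := by linarith
  have hn1 : 0 < 1 - n.1 := by linarith
  have c₁ : m.1 / (1 - m.2) < r := by rw [div_lt_iff₀ hm2]; nlinarith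
  have c₂ : n.2 / (1 - n.1) < r := by rw [div_lt_iff₀ hn1]; nlinarith
  have ray₁ : ∀ t : ℝ, 0 < t →
      A.sec x y z (t * (1 - m.1 / (1 - m.2)), t * (m.1 / (1 - m.2))) ∈ A.U := fun t ht => by
    have := T.ray_mem I (q := (1 - m.1 - m.2, m.1)) (by simp only; linarith) m1
      (by simp only; linarith) m4 (t := t / (1 - m.2)) (by positivity)
    convert this using 2
    ext <;> simp <;> field_simp
    ring
  have ray₂ : ∀ t : ℝ, 0 < t →
      A.sec x y z (t * (1 - (1 - n.2 / (1 - n.1))), t * (1 - n.2 / (1 - n.1))) ∈ A.U :=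
    fun t ht => by
    have := T.ray_mem I (q := (n.2, 1 - n.1 - n.2)) n2 (by simp only; linarith)
      (by simp only; linarith) n4 (t := t / (1 - n.1)) (by positivity)
    convert this using 2
    ext <;> simp <;> field_simp
  obtain ⟨u, hu, τ, h0, h1, l, hl, hpu, hsu, hd⟩ := T.exists_through hc hp (by positivity)
    (show 1 - n.2 / (1 - n.1) < 1 by have : 0 < n.2 / (1 - n.1) := by positivity
                                     linarith) hq
    (by nlinarith) (by nlinarith) ray₁ ray₂
  have cg := T.cong I
  refine no_through (cg.li T.li) (I.F_mem x T.hx) (I.F_mem y T.hy) (I.F_mem z T.hz)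
    (I.sees T.hy T.hx T.sx) (I.sees T.hy T.hz T.sz) (I.sees T.hx T.hz T.sxz) hq1' hq2' hq' hp'
    h0 h1 hl (cg.p_eq I T.angle hu hsu (by simp only; nlinarith) (by simp only; nlinarith) hpu)
    (I.sees T.hy hu hsu) ?_
  rwa [I.dist_F _ hc _ hu, I.dist_F _ hu _ T.hy, I.dist_F _ hc _ T.hy]

end Dom

namespace Dom
variable {X : Type} [MetricSpace X] {A : Dom X} {x y z : X}
variable {Y : Type} [MetricSpace Y] {B : Dom Y} [CompleteSpace X] [CompleteSpace Y]

theorem norm_sub_comb_lt {V : Type*} [NormedAddCommGroup V] [InnerProductSpace ℝ V] {a b : V}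
    {m μ α β : ℝ} (ha : m ≤ ‖a‖ ^ 2) (hb : m ≤ inner ℝ a b) (hm : 0 < m) (hα : 0 < α) (hβ : 0 < β)
    (hμ : μ * m = (‖a‖ + ‖b‖) ^ 2 * (α + β)) : ‖μ • a - (α • a + β • b)‖ < μ * ‖a‖ := by
  have ha0 : 0 < ‖a‖ := by
    by_contra! h
    have := le_antisymm h (norm_nonneg a)
    rw [this] at ha; norm_num at ha; linarith
  have hR : 0 < ‖a‖ + ‖b‖ := by positivity
  have hμ0 : 0 < μ := by
    have : 0 < μ * m := by rw [hμ]; positivity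
    exact pos_of_mul_pos_left this hm.le
  have e : ‖μ • a - (α • a + β • b)‖ ^ 2 = μ ^ 2 * ‖a‖ ^ 2 -
      2 * μ * (α * ‖a‖ ^ 2 + β * inner ℝ a b) + ‖α • a + β • b‖ ^ 2 := by
    rw [norm_sub_sq_real, real_inner_smul_left, inner_add_right, real_inner_smul_right,
      real_inner_smul_right, real_inner_self_eq_norm_sq, norm_smul, mul_pow, Real.norm_eq_abs,
      sq_abs]
    ring
  have h1 : ‖α • a + β • b‖ ≤ (α + β) * (‖a‖ + ‖b‖) := by
    refine (norm_add_le _ _).trans ?_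
    rw [norm_smul, norm_smul, Real.norm_eq_abs, Real.norm_eq_abs, abs_of_pos hα, abs_of_pos hβ]
    nlinarith [norm_nonneg a, norm_nonneg b]
  have h2 : ‖α • a + β • b‖ ^ 2 ≤ ((α + β) * (‖a‖ + ‖b‖)) ^ 2 :=
    pow_le_pow_left₀ (norm_nonneg _) h1 2
  have h3 : m * (α + β) ≤ α * ‖a‖ ^ 2 + β * inner ℝ a b := by nlinarith
  have h4 := mul_le_mul_of_nonneg_left h3 hμ0.le
  have h5 : ((α + β) * (‖a‖ + ‖b‖)) ^ 2 = μ * (m * (α + β)) := by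
    rw [← mul_assoc, hμ]; ring
  have h6 : 0 < μ * (m * (α + β)) := by positivity
  refine lt_of_pow_lt_pow_left₀ 2 (by positivity) ?_
  rw [e, mul_pow]
  nlinarith

theorem norm_le_norm_comb {V : Type*} [NormedAddCommGroup V] [InnerProductSpace ℝ V] {a b : V}
    (hpos : 0 ≤ inner ℝ a b) {s t : ℝ} (hs : s ≤ 0) (ht : t ≤ 0) :
    ‖a‖ ≤ ‖(s - 1) • a + t • b‖ := by
  have e2 : ‖(s - 1) • a + t • b‖ ^ 2 = (1 - s) ^ 2 * ‖a‖ ^ 2 +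
      2 * ((1 - s) * -t) * inner ℝ a b + t ^ 2 * ‖b‖ ^ 2 := by
    rw [norm_add_sq_real, norm_smul, norm_smul, mul_pow, mul_pow, Real.norm_eq_abs,
      Real.norm_eq_abs, sq_abs, sq_abs, real_inner_smul_left, real_inner_smul_right]
    ring
  have h5 : 0 ≤ 2 * ((1 - s) * -t) * inner ℝ a b :=
    mul_nonneg (mul_nonneg zero_le_two (mul_nonneg (by linarith) (by linarith))) hpos
  have h6 : 0 ≤ t ^ 2 * ‖b‖ ^ 2 := by positivity
  have h7 : ‖a‖ ^ 2 ≤ (1 - s) ^ 2 * ‖a‖ ^ 2 :=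
    le_mul_of_one_le_left (by positivity) (by nlinarith)
  exact le_of_sq_le_sq (by linarith) (norm_nonneg _)

/-- An element near a vertex that is mapped into the image triangle lies in the opposite sector. -/
theorem Tri.nonpos_of_near (T : A.Tri x y z) (I : BdIso A B) {c : X} {n q' : ℝ × ℝ}
    (hc : c ∈ A.Bd) (hcn : A.p c = A.sec x y z n) (hn1 : n.1 < 1)
    (hn2 : n.2 < 1) (hn : n.1 + n.2 < 1)
    (hp' : B.p (I.F c) = B.sec (I.F x) (I.F y) (I.F z) q')
    (hq1' : 0 < q'.1) (hq2' : 0 < q'.2) (hq' : q'.1 + q'.2 < 1) : n.1 ≤ 0 ∧ n.2 ≤ 0 := by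
  rcases le_or_gt n.1 0 with g1 | g1 <;> rcases le_or_gt n.2 0 with g2 | g2
  · exact ⟨g1, g2⟩
  · exfalso
    rcases g1.lt_or_eq with g1 | g1
    · refine T.rot.rot.no_beyond I (q := (n.2, 1 - n.1 - n.2)) (q' := (q'.2, 1 - q'.1 - q'.2))
        hc ?_ g2 ?_ ?_ ?_ hq2' ?_ ?_
      · rw [sec_rot, sec_rot, hcn]
        exact congrArg _ (Prod.ext (by simp only; ring) (by simp only; ring))
      · simp only; linarith
      · simp only; linarith
      · rw [sec_rot, sec_rot, hp']
        exact congrArg _ (Prod.ext (by simp only; ring) (by simp only; ring))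
      · simp only; linarith
      · simp only; linarith
    · refine hc ?_
      rw [hcn]
      exact T.sec_mem g1.ge g2.le (by linarith) (by linarith) (by linarith) (by linarith)
  · exfalso
    rcases g2.lt_or_eq with g2 | g2
    · refine T.rot.no_beyond I (q := (1 - n.1 - n.2, n.1)) (q' := (1 - q'.1 - q'.2, q'.1))
        hc ?_ ?_ g1 ?_ ?_ ?_ hq1' ?_
      · rw [sec_rot, hcn]
        exact congrArg _ (Prod.ext rfl (by simp only; ring))
      · simp only; linarith
      · simp only; linarith
      · rw [sec_rot, hp']
        exact congrArg _ (Prod.ext rfl (by simp only; ring))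
      · simp only; linarith
      · simp only; linarith
    · refine absurd ?_ hc
      rw [hcn]
      exact T.sec_mem g1.le g2.ge (by linarith) (by linarith) (by linarith) (by linarith)
  · refine absurd ?_ hc
    rw [hcn]
    exact T.sec_mem g1.le g2.le (by linarith) (by linarith) (by linarith) (by linarith)

theorem Tri.sec_mem_of_inner_pos (T : A.Tri x y z) (I : BdIso A B)
    (hpos : 0 < inner ℝ (A.p x - A.p y) (A.p z - A.p y)) {q : ℝ × ℝ} (h1 : 0 < q.1) (h2 : 0 < q.2)
    (h3 : q.1 + q.2 < 1) : B.sec (I.F x) (I.F y) (I.F z) q ∈ B.U := by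
  by_contra hno
  have cg := T.cong I
  obtain ⟨cf, hcf, hcf1, hcf2⟩ := exists_coord T.li
  set a := A.p x - A.p y with ha
  set b := A.p z - A.p y with hb
  have ha0 : 0 < ‖a‖ := norm_pos_iff.2 (sub_ne_zero.2 T.sx.1.symm)
  obtain ⟨m, hm0, hma, hmb⟩ : ∃ m, 0 < m ∧ m ≤ ‖a‖ ^ 2 ∧ m ≤ inner ℝ a b :=
    ⟨min (‖a‖ ^ 2) (inner ℝ a b), lt_min (by positivity) hpos, min_le_left _ _, min_le_right _ _⟩
  obtain ⟨δ, hδ, hnear⟩ : ∃ δ > 0, ∀ P, dist P (A.p y) < δ → |(cf P).1| + |(cf P).2| < 1 := by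
    have hcont : Continuous fun P => |(cf P).1| + |(cf P).2| := by fun_prop
    have h0 : |(cf (A.p y)).1| + |(cf (A.p y)).2| < 1 := by
      rw [← sec_zero (A := A) x y z, hcf2]; norm_num
    exact Metric.eventually_nhds_iff.1 (hcont.continuousAt.eventually (gt_mem_nhds h0))
  set R := ‖a‖ + ‖b‖ with hR
  have hR0 : 0 < R := by positivity
  obtain ⟨p, p1, p2, p3, p4⟩ := T.unclean I h1 h2 h3 hno
    (r := min (min (m / R ^ 2) (δ * m / (2 * ‖a‖ * R ^ 2))) 1) (by positivity)
  have hp1 : p.1 + p.2 < 1 := p3.trans_le (min_le_right _ _)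
  set μ := R ^ 2 * (p.1 + p.2) / m with hμ
  have hμ0 : 0 < μ := by positivity
  have hμ1 : μ < 1 := by
    have := p3.trans_le ((min_le_left _ _).trans (min_le_left _ _))
    rw [lt_div_iff₀ (by positivity)] at this
    rw [hμ, div_lt_one hm0]; linarith
  have hμδ : 2 * μ * ‖a‖ < δ := by
    have := p3.trans_le ((min_le_left _ _).trans (min_le_right _ _))
    rw [lt_div_iff₀ (by positivity)] at this
    have e : 2 * μ * ‖a‖ = (p.1 + p.2) * (2 * ‖a‖ * R ^ 2) / m := by rw [hμ]; ring
    rw [e, div_lt_iff₀ hm0]; linarith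
  have ha' : ‖B.p (I.F x) - B.p (I.F y)‖ = ‖a‖ := cg.na
  have hb' : ‖B.p (I.F z) - B.p (I.F y)‖ = ‖b‖ := cg.nb
  have hd : dist (B.sec (I.F x) (I.F y) (I.F z) (μ, 0)) (B.sec (I.F x) (I.F y) (I.F z) p) <
      μ * ‖a‖ := by
    rw [cg.dist_sec, dist_eq_norm, sec_sub]
    convert norm_sub_comb_lt hma hmb hm0 p1 p2 (μ := μ) (by rw [hμ]; field_simp; rfl) using 1
    exact congrArg _ (by simp only [ha, hb]; module)
  have sx' := I.sees T.hy T.hx T.sx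
  have hlinx : AffineMap.lineMap (B.p (I.F y)) (B.p (I.F x)) μ =
      B.sec (I.F x) (I.F y) (I.F z) (μ, 0) := by
    rw [← sec_zero (A := B) (I.F x) (I.F y) (I.F z), ← sec_one_zero (A := B) (I.F x) (I.F y) (I.F z),
      sec_lineMap]
    simp
  have hmu : B.sec (I.F x) (I.F y) (I.F z) (μ, 0) ∈ openSegment ℝ (B.p (I.F y)) (B.p (I.F x)) := by
    rw [openSegment_eq_image_lineMap]
    exact ⟨μ, ⟨hμ0, hμ1⟩, hlinx⟩
  obtain ⟨hPU, hPy, hPx⟩ := sx'.2 _ hmu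
  rw [← hlinx, dist_left_lineMap, dist_comm (B.p (I.F y)), dist_eq_norm, ha', Real.norm_eq_abs,
    abs_of_pos hμ0, hlinx] at hPy
  rw [← hlinx, dist_comm (B.p _), dist_lineMap_right, dist_comm (B.p (I.F y)), dist_eq_norm, ha',
    Real.norm_eq_abs, abs_of_pos (by linarith), hlinx] at hPx
  obtain ⟨c', hc', s, hs, hpc, hcs⟩ := B.exists_first_exit hPU p4
  have hdP := (hcs 0 ⟨le_rfl, hs.1⟩).2
  rw [lin, AffineMap.lineMap_apply_zero, sub_zero] at hdP
  have hdP' : dist c' (B.pt (B.sec (I.F x) (I.F y) (I.F z) (μ, 0))) < μ * ‖a‖ := by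
    rw [hdP]
    refine (mul_le_of_le_one_left dist_nonneg hs.2).trans_lt hd
  rw [lin, sec_lineMap] at hpc
  set c := I.G c' with hcdef
  have hc : c ∈ A.Bd := I.G_mem c' hc'
  have hFc : I.F c = c' := I.FG c' hc'
  have hcx : dist (A.p c) (A.p x) < ‖a‖ := by
    refine (A.p_lip c x).trans_lt ?_
    rw [← I.dist_F _ hc _ T.hx, hFc]
    have := dist_triangle c' (B.pt (B.sec (I.F x) (I.F y) (I.F z) (μ, 0))) (I.F x)
    rw [dist_comm (B.pt _) (I.F x), hPx] at this
    linarith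
  have hcy : dist (A.p c) (A.p y) < δ := by
    refine (A.p_lip c y).trans_lt ?_
    rw [← I.dist_F _ hc _ T.hy, hFc]
    have := dist_triangle c' (B.pt (B.sec (I.F x) (I.F y) (I.F z) (μ, 0))) (I.F y)
    rw [dist_comm (B.pt _) (I.F y), hPy] at this
    linarith
  have hnr := hnear _ hcy
  set n := cf (A.p c) with hn
  have hcn : A.p c = A.sec x y z n := (hcf1 _).symm
  have hs1 := hs.1
  have hs2 := hs.2
  have hk1 : 0 < (1 - s) * μ + s * p.1 := by
    have : 0 ≤ (1 - s) * μ := mul_nonneg (by linarith) hμ0.le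
    positivity
  have hk2 : 0 < (1 - s) * 0 + s * p.2 := by rw [mul_zero, zero_add]; positivity
  have hk3 : (1 - s) * μ + s * p.1 + ((1 - s) * 0 + s * p.2) < 1 := by nlinarith
  have habs1 := abs_lt.1 ((le_add_of_nonneg_right (abs_nonneg n.2)).trans_lt hnr)
  have habs2 := abs_lt.1 ((le_add_of_nonneg_left (abs_nonneg n.1)).trans_lt hnr)
  have hle1 := neg_abs_le n.1
  have hle2 := neg_abs_le n.2
  have hle1' := le_abs_self n.1
  have hle2' := le_abs_self n.2
  obtain ⟨g1, g2⟩ := T.nonpos_of_near I hc hcn habs1.2 habs2.2 (by linarith)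
    (by rw [hFc, hpc]) hk1 hk2 hk3
  have e : A.p c - A.p x = (n.1 - 1) • a + n.2 • b := by rw [hcn, sec]; module
  rw [dist_eq_norm, e] at hcx
  exact (norm_le_norm_comb hpos.le g1 g2).not_gt hcx

/-- The image of an empty triangle is an empty triangle. -/
theorem Tri.map (T : A.Tri x y z) (I : BdIso A B) : B.Tri (I.F x) (I.F y) (I.F z) where
  hx := I.F_mem x T.hx
  hy := I.F_mem y T.hy
  hz := I.F_mem z T.hz
  sx := I.sees T.hy T.hx T.sx
  sz := I.sees T.hy T.hz T.sz
  sxz := I.sees T.hx T.hz T.sxz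
  li := (T.cong I).li T.li
  int α β hα hβ hs := by
    change B.sec (I.F x) (I.F y) (I.F z) (α, β) ∈ B.U
    by_cases h : 0 < inner ℝ (A.p x - A.p y) (A.p z - A.p y)
    · exact T.sec_mem_of_inner_pos I h hα hβ hs
    · have e : A.p y - A.p z = -(A.p z - A.p y) := by abel
      have e' : A.p x - A.p z = (A.p x - A.p y) - (A.p z - A.p y) := by abel
      have h' : 0 < inner ℝ (A.p y - A.p z) (A.p x - A.p z) := by
        rw [e, e', inner_neg_left, inner_sub_right, real_inner_self_eq_norm_sq, real_inner_comm]
        have : 0 < ‖A.p z - A.p y‖ := norm_pos_iff.2 (sub_ne_zero.2 T.sz.1.symm)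
        have : 0 < ‖A.p z - A.p y‖ ^ 2 := by positivity
        linarith
      have := T.rot.sec_mem_of_inner_pos I h' (q := (1 - α - β, α)) (by simp only; linarith) hα
        (by simp only; linarith)
      rw [sec_rot] at this
      convert this using 2
      exact Prod.ext rfl (by simp only; ring)

end Dom

/-- Nonnegative combinations grow when inner products grow. -/
theorem norm_sum_le_of_inner_le {V W ι : Type*} [NormedAddCommGroup V] [InnerProductSpace ℝ V]
    [NormedAddCommGroup W] [InnerProductSpace ℝ W] [Fintype ι] {v : ι → V} {w : ι → W}
    (h : ∀ i j, inner ℝ (v i) (v j) ≤ inner ℝ (w i) (w j)) {c : ι → ℝ} (hc : ∀ i, 0 ≤ c i) :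
    ‖∑ i, c i • v i‖ ≤ ‖∑ i, c i • w i‖ := by
  rw [← sq_le_sq₀ (norm_nonneg _) (norm_nonneg _), ← real_inner_self_eq_norm_sq,
    ← real_inner_self_eq_norm_sq]
  simp only [sum_inner, inner_sum, real_inner_smul_left, real_inner_smul_right]
  gcongr with i _ j _
  · exact hc i
  · exact hc j
  · exact h j i

namespace Dom
variable {X : Type} [MetricSpace X] {A : Dom X} {x y z : X}

/-- Elements seen from a vertex in the same direction agree. -/
theorem Sees.eq_of_smul_eq [CompleteSpace X] {u v : X} (hu : u ∈ A.Bd) (hv : v ∈ A.Bd)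
    (su : A.Sees y u) (sv : A.Sees y v) {s t : ℝ} (hs : 0 < s) (ht : 0 < t)
    (e : s • (A.p u - A.p y) = t • (A.p v - A.p y)) : u = v := by
  have main : ∀ {u v : X} {s t : ℝ}, v ∈ A.Bd → A.Sees y u → A.Sees y v → 0 < s → 0 < t →
      s • (A.p u - A.p y) = t • (A.p v - A.p y) → s ≤ t → u = v := by
    intro u v s t hv su sv hs ht e hle
    have pv : A.p v = AffineMap.lineMap (A.p y) (A.p u) (s / t) := by
      have : A.p v - A.p y = (s / t) • (A.p u - A.p y) := by
        rw [div_eq_inv_mul, mul_smul, e, inv_smul_smul₀ ht.ne']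
      rw [AffineMap.lineMap_apply, vsub_eq_sub, vadd_eq_add, ← this, sub_add_cancel]
    rcases hle.lt_or_eq with hlt | rfl
    · refine absurd (su.2 _ ?_).1 hv
      rw [openSegment_eq_image_lineMap, pv]
      exact ⟨s / t, ⟨by positivity, (div_lt_one ht).2 hlt⟩, rfl⟩
    · rw [div_self ht.ne', AffineMap.lineMap_apply_one] at pv
      exact su.unique sv pv.symm
  rcases le_total s t with h | h
  · exact main hv su sv hs ht e h
  · exact (main hu sv su ht hs e.symm h).symm

/-- Hits depend continuously on their directions. -/
theorem Hit.dist_near (h : A.Angle x y z) {t : ℝ} {u₀ : X} (hu₀ : A.Hit x y z t u₀) {ε : ℝ}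
    (hε : 0 < ε) : ∃ δ > 0, ∀ τ u, A.Hit x y z τ u → |τ - t| < δ → dist u₀ u < ε := by
  set R := ‖A.p x - A.p y‖ + ‖A.p z - A.p y‖ with hR
  have hR0 : 0 ≤ R := by positivity
  set κ := ε / (5 * (R + 1)) with hκ
  have hκ0 : 0 < κ := by positivity
  have hκR : κ * (5 * (R + 1)) = ε := by rw [hκ]; field_simp
  obtain ⟨δ₁, hδ₁, hcont⟩ := Metric.continuousOn_iff.1 h.obst.continuousOn t hu₀.mem.1 κ hκ0
  set W := hullW (A.obs x y z) with hW
  refine ⟨min δ₁ κ, by positivity, fun τ u hu hd => ?_⟩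
  have hd1 := hd.trans_le (min_le_left _ _)
  have hd2 := hd.trans_le (min_le_right _ _)
  have hτ := hu.mem.1
  have ht := hu₀.mem.1
  have w0 : 1 ≤ W t := h.obst.one_le_hullW ht
  have w1 : 1 ≤ W τ := h.obst.one_le_hullW hτ
  have hWτ := abs_lt.1 (hcont τ hτ hd1)
  have hval : ∀ σ : ℝ, (1 - σ) * (W t + κ) + σ * (W t + κ) = W t + κ := fun σ => by ring
  have hD := hu₀.dist_le h hu (l := (W t + κ, W t + κ)) fun σ hσ => by
    simp only [hval]
    have := abs_lt.1 (hcont σ ((ordConnected_Icc).uIcc_subset ht hτ hσ) (by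
      rw [uIcc_comm] at hσ
      rw [Real.dist_eq, abs_sub_comm σ]
      refine (abs_sub_right_of_mem_uIcc hσ).trans_lt ?_
      rwa [abs_sub_comm]))
    linarith
  have e1 : dist (A.p u₀) (A.ln x y z (W t + κ, W t + κ) t) ≤ κ * R := by
    rw [hu₀.p_eq, ln]
    simp only [hval]
    refine (dist_sec_dirPt_le ht w0 (by linarith)).trans ?_
    rw [← hR]
    gcongr
    rw [sub_self, abs_zero, zero_add, abs_sub_comm, abs_of_nonneg] <;> linarith
  have e2 : dist (A.ln x y z (W t + κ, W t + κ) t) (A.ln x y z (W t + κ, W t + κ) τ) ≤ κ * R := by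
    rw [ln, ln]
    simp only [hval]
    refine (dist_sec_dirPt_le hτ (by linarith) (by linarith)).trans ?_
    rw [← hR]
    gcongr
    rw [sub_self, abs_zero, add_zero, abs_sub_comm]
    exact hd2.le
  have e3 : dist (A.ln x y z (W t + κ, W t + κ) τ) (A.p u) ≤ 2 * κ * R := by
    rw [hu.p_eq, ln]
    simp only [hval]
    refine (dist_sec_dirPt_le hτ (by linarith) w1).trans ?_
    rw [← hR]
    gcongr
    rw [sub_self, abs_zero, zero_add, abs_le]
    constructor <;> linarith
  nlinarith

variable {Y : Type} [MetricSpace Y] {B : Dom Y} [CompleteSpace X] [CompleteSpace Y]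

theorem Hit.inner_le (h : A.Angle x y z) (I : BdIso A B) {τ₁ τ₂ : ℝ} {u v : X}
    (hu : A.Hit x y z τ₁ u) (hv : A.Hit x y z τ₂ v) :
    inner ℝ (A.p u - A.p y) (A.p v - A.p y) ≤
      inner ℝ (B.p (I.F u) - B.p (I.F y)) (B.p (I.F v) - B.p (I.F y)) := by
  rcases lt_trichotomy τ₁ τ₂ with hlt | rfl | hlt
  · exact (hu.angle h hv hlt).inner_le I
  · obtain rfl : u = v := hu.sees.unique hv.sees (by rw [hu.p_eq, hv.p_eq])
    rw [real_inner_self_eq_norm_sq, real_inner_self_eq_norm_sq, I.norm_sub h.hy hu.bd hu.sees]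
  · rw [real_inner_comm, real_inner_comm (B.p (I.F v) - B.p (I.F y))]
    exact (hv.angle h hu hlt).inner_le I

/-- The images of the hits satisfy no nontrivial nonnegative relations, uniformly. -/
theorem Angle.exists_le_norm_sum (h : A.Angle x y z) (I : BdIso A B) : ∃ k : ℝ, 0 < k ∧
    ∀ (c τ : Fin 4 → ℝ) (u : Fin 4 → X), (∀ i, 0 ≤ c i) → (∀ i, A.Hit x y z (τ i) (u i)) →
      k * ∑ i, c i ≤ ‖∑ i, c i • (B.p (I.F (u i)) - B.p (I.F y))‖ := by
  obtain ⟨M, hM1, hM⟩ := h.obst.exists_const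
  have hΓ := gram_pos h.li
  set a := A.p x - A.p y with ha
  set b := A.p z - A.p y with hb
  set Γ := ‖a‖ ^ 2 * ‖b‖ ^ 2 - inner ℝ a b ^ 2 with hΓd
  have hane : 0 < ‖a‖ := norm_pos_iff.2 (sub_ne_zero.2 h.sx.1.symm)
  set R := ‖a‖ + ‖b‖ with hR
  have hR0 : 0 < R := by positivity
  refine ⟨√Γ / (M * R), by positivity, fun c τ u hc hu => ?_⟩
  refine le_trans ?_ (norm_sum_le_of_inner_le (v := fun i => A.p (u i) - A.p y)
    (fun i j => (hu i).inner_le h I (hu j)) hc)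
  have low : ∀ s t : ℝ, 0 ≤ s → 0 ≤ t → √Γ * (s + t) ≤ R * ‖s • a + t • b‖ := by
    intro s t hs ht
    rcases (add_nonneg hs ht).lt_or_eq with h0 | h0
    · have l := Real.sqrt_le_sqrt (le_norm_lineMap (a := a) (b := b) (t / (s + t)))
      rw [Real.sqrt_sq (by positivity)] at l
      have e : s • a + t • b = (s + t) • ((1 - t / (s + t)) • a + (t / (s + t)) • b) := by
        have e1 : 1 - t / (s + t) = s / (s + t) := by field_simp; ring
        rw [e1, smul_add, smul_smul, smul_smul, mul_div_cancel₀ _ h0.ne', mul_div_cancel₀ _ h0.ne']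
      rw [e, norm_smul, Real.norm_of_nonneg h0.le]
      nlinarith
    · rw [← h0, mul_zero]; positivity
  have W1 : ∀ i, 1 ≤ hullW (A.obs x y z) (τ i) := fun i => h.obst.one_le_hullW (hu i).mem.1
  have WM : ∀ i, hullW (A.obs x y z) (τ i) ≤ M := fun i =>
    (h.obst.hullW_le hM (hu i).mem.1).trans (by simp only; linarith)
  have e : ∑ i, c i • (A.p (u i) - A.p y) =
      (∑ i, c i * ((1 - τ i) / hullW (A.obs x y z) (τ i))) • a +
        (∑ i, c i * (τ i / hullW (A.obs x y z) (τ i))) • b := by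
    rw [Finset.sum_smul, Finset.sum_smul, ← Finset.sum_add_distrib]
    refine Finset.sum_congr rfl fun i _ => ?_
    rw [(hu i).sub_eq', smul_add, smul_smul, smul_smul]
  have n1 : ∀ i, 0 ≤ c i * ((1 - τ i) / hullW (A.obs x y z) (τ i)) := fun i =>
    mul_nonneg (hc i) (div_nonneg (by linarith [(hu i).mem.1.2]) (by linarith [W1 i]))
  have n2 : ∀ i, 0 ≤ c i * (τ i / hullW (A.obs x y z) (τ i)) := fun i =>
    mul_nonneg (hc i) (div_nonneg (hu i).mem.1.1 (by linarith [W1 i]))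
  have := low _ _ (Finset.sum_nonneg (s := .univ) fun i _ => n1 i)
    (Finset.sum_nonneg (s := .univ) fun i _ => n2 i)
  rw [← e, ← Finset.sum_add_distrib] at this
  have g : (∑ i, c i) / M ≤ ∑ i, (c i * ((1 - τ i) / hullW (A.obs x y z) (τ i)) +
      c i * (τ i / hullW (A.obs x y z) (τ i))) := by
    rw [Finset.sum_div]
    refine Finset.sum_le_sum fun i _ => ?_
    rw [← mul_add, ← add_div, sub_add_cancel, mul_one_div]
    exact div_le_div_of_nonneg_left (hc i) (by linarith [W1 i]) (WM i)
  have g' := mul_le_mul_of_nonneg_left g (Real.sqrt_nonneg Γ)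
  rw [div_mul_eq_mul_div, div_le_iff₀ (by positivity)]
  rw [← mul_div_assoc, div_le_iff₀ (by positivity)] at g'
  nlinarith [norm_nonneg (∑ i, c i • (A.p (u i) - A.p y)), mul_le_mul_of_nonneg_right this (by positivity : 0 ≤ M)]

end Dom

/-- A sign change on the contact directions takes place at a contact direction or across a gap. -/
theorem Obst.exists_between {S : Set (ℝ × ℝ)} (h : Obst S) {d : ℝ → ℝ}
    (hd : ContinuousOn d (hullE S)) (h0 : 0 ≤ d 0) (h1 : d 1 ≤ 0) :
    (∃ τ ∈ hullE S, d τ = 0) ∨ ∃ τ₁ ∈ hullE S, ∃ τ₂ ∈ hullE S, τ₁ < τ₂ ∧ 0 ≤ d τ₁ ∧ d τ₂ ≤ 0 ∧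
      ∃ l ∈ suppFun S,
      hullW S τ₁ = (1 - τ₁) * l.1 + τ₁ * l.2 ∧ hullW S τ₂ = (1 - τ₂) * l.1 + τ₂ * l.2 ∧
      ∀ t ∈ Ioo τ₁ τ₂, hullW S t = (1 - t) * l.1 + t * l.2 ∧ t ∉ hullE S := by
  have hE : IsCompact (hullE S) :=
    isCompact_Icc.of_isClosed_subset h.isClosed_hullE fun τ hτ => hτ.1
  have k1 : IsCompact (hullE S ∩ d ⁻¹' Ici 0) := hE.of_isClosed_subset
    (hd.preimage_isClosed_of_isClosed h.isClosed_hullE isClosed_Ici) inter_subset_left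
  obtain ⟨τ₁, ⟨e1, p1⟩, m1⟩ := k1.exists_isGreatest ⟨0, h.zero_mem, h0⟩
  have k2 : IsCompact ((hullE S ∩ d ⁻¹' Iic 0) ∩ Ici τ₁) := (hE.of_isClosed_subset
    (hd.preimage_isClosed_of_isClosed h.isClosed_hullE isClosed_Iic) inter_subset_left).inter_right
    isClosed_Ici
  obtain ⟨τ₂, ⟨⟨e2, p2⟩, l2⟩, m2⟩ := k2.exists_isLeast ⟨1, ⟨h.one_mem, h1⟩, e1.1.2⟩
  have p1' : 0 ≤ d τ₁ := p1
  have p2' : d τ₂ ≤ 0 := p2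
  rcases (show τ₁ ≤ τ₂ from l2).eq_or_lt with rfl | hlt
  · exact Or.inl ⟨τ₁, e1, le_antisymm p2' p1'⟩
  · right
    have hno : ∀ t ∈ hullE S, t ≤ τ₁ ∨ τ₂ ≤ t := fun t ht => by
      rcases le_total 0 (d t) with g | g
      · exact Or.inl (m1 ⟨ht, g⟩)
      · rcases le_total t τ₁ with g' | g'
        · exact Or.inl g'
        · exact Or.inr (m2 ⟨⟨ht, g⟩, g'⟩)
    have b1 := e1.1.1
    have b2 := e2.1.2
    obtain ⟨σ₁, s1, σ₂, s2, g1, g2, l, hl, w1, w2, hg⟩ := h.exists_gap (τ := (τ₁ + τ₂) / 2)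
      ⟨by linarith, by linarith⟩ fun hm => by
        rcases hno _ hm with g | g <;> linarith
    have f1 : σ₁ = τ₁ := by
      rcases hno _ s1 with g | g
      · refine le_antisymm g (le_of_not_gt fun g' => (hg τ₁ ⟨g', by linarith⟩).2 e1)
      · linarith
    have f2 : σ₂ = τ₂ := by
      rcases hno _ s2 with g | g
      · linarith
      · refine le_antisymm (le_of_not_gt fun g' => (hg τ₂ ⟨by linarith, g'⟩).2 e2) g
    subst f1 f2
    exact ⟨σ₁, e1, σ₂, e2, hlt, p1', p2', l, hl, w1, w2, hg⟩

namespace Dom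
variable {X : Type} [MetricSpace X] {A : Dom X} {x y z : X}
variable {Y : Type} [MetricSpace Y] {B : Dom Y} [CompleteSpace X] [CompleteSpace Y]

/-- The image of an angle spans a nondegenerate triangle. -/
theorem Angle.map_li (h : A.Angle x y z) (I : BdIso A B) (s t : ℝ)
    (e : s • (B.p (I.F x) - B.p (I.F y)) + t • (B.p (I.F z) - B.p (I.F y)) = 0) :
    s = 0 ∧ t = 0 := by
  have sx := I.sees h.hy h.hx h.sx
  have sz := I.sees h.hy h.hz h.sz
  have hne : x ≠ z := fun he => by
    have := (h.li 1 (-1) (by rw [he]; module)).1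
    linarith
  have hFne : I.F x ≠ I.F z := fun he => hne (by rw [← I.GF x h.hx, he, I.GF z h.hz])
  have key : ∀ s t : ℝ, 0 < s → t < 0 →
      s • (B.p (I.F x) - B.p (I.F y)) + t • (B.p (I.F z) - B.p (I.F y)) = 0 → False := by
    intro s t hs ht e
    refine hFne (Sees.eq_of_smul_eq (I.F_mem x h.hx) (I.F_mem z h.hz) sx sz hs (neg_pos.2 ht) ?_)
    rw [neg_smul]
    exact eq_neg_of_add_eq_zero_left e
  obtain ⟨k, hk, hN⟩ := h.exists_le_norm_sum I
  have pos : ∀ s t : ℝ, 0 ≤ s → 0 ≤ t →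
      s • (B.p (I.F x) - B.p (I.F y)) + t • (B.p (I.F z) - B.p (I.F y)) = 0 → s = 0 ∧ t = 0 := by
    intro s t hs ht e
    have := hN ![s, t, 0, 0] ![0, 1, 0, 0] ![x, z, x, x]
      (by intro i; fin_cases i <;> simp [hs, ht])
      (by intro i; fin_cases i <;> first | exact h.hit_zero | exact h.hit_one)
    simp only [Fin.sum_univ_four, Matrix.cons_val_zero, Matrix.cons_val_one, Matrix.cons_val,
      zero_smul, add_zero, e, norm_zero] at this
    have : s + t ≤ 0 := by
      by_contra! hlt
      nlinarith
    constructor <;> linarith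
  have en : (-s) • (B.p (I.F x) - B.p (I.F y)) + (-t) • (B.p (I.F z) - B.p (I.F y)) = 0 := by
    rw [neg_smul, neg_smul, ← neg_add, e, neg_zero]
  rcases le_total 0 s with hs | hs <;> rcases le_total 0 t with ht | ht
  · exact pos s t hs ht e
  · rcases hs.eq_or_lt with rfl | hs
    · simpa using pos (-0) (-t) (by simp) (by linarith) en
    · rcases ht.eq_or_lt with rfl | ht
      · exact pos s _ hs.le le_rfl e
      · exact (key s t hs ht e).elim
  · rcases hs.eq_or_lt with rfl | hs
    · exact pos 0 t le_rfl ht e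
    · rcases ht.eq_or_lt with rfl | ht
      · simpa using pos (-s) (-0) (by linarith) (by simp) en
      · exact (key (-s) (-t) (by linarith) (by linarith) en).elim
  · simpa using pos (-s) (-t) (by linarith) (by linarith) en

/-- A small vector in the image sector is a small combination of the images of the ends of a gap,
or of the image of a single contact. -/
theorem Angle.exists_comb (h : A.Angle x y z) (I : BdIso A B) {α β : ℝ} (hα : 0 ≤ α) (hβ : 0 ≤ β)
    (h0 : 0 < α + β) : (∃ τ u, A.Hit x y z τ u ∧ ∃ c : ℝ, 0 < c ∧
      α • (B.p (I.F x) - B.p (I.F y)) + β • (B.p (I.F z) - B.p (I.F y)) =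
        c • (B.p (I.F u) - B.p (I.F y))) ∨
    ∃ τ₁ u τ₂ v, A.Hit x y z τ₁ u ∧ A.Hit x y z τ₂ v ∧ A.Tri u y v ∧ ∃ s t : ℝ, 0 ≤ s ∧ 0 ≤ t ∧
      α • (B.p (I.F x) - B.p (I.F y)) + β • (B.p (I.F z) - B.p (I.F y)) =
        s • (B.p (I.F u) - B.p (I.F y)) + t • (B.p (I.F v) - B.p (I.F y)) := by
  have li := h.map_li I
  obtain ⟨cf, hcf, cf1, cf2⟩ := exists_coord (A := B) li
  obtain ⟨k, hk, hN⟩ := h.exists_le_norm_sum I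
  set a := B.p (I.F x) - B.p (I.F y) with ha
  set b := B.p (I.F z) - B.p (I.F y) with hb
  have hex : ∀ τ, ∃ u, τ ∈ hullE (A.obs x y z) → A.Hit x y z τ u := fun τ => by
    by_cases hτ : τ ∈ hullE (A.obs x y z)
    · obtain ⟨u, hu⟩ := h.exists_hit hτ
      exact ⟨u, fun _ => hu⟩
    · exact ⟨x, fun h' => absurd h' hτ⟩
  choose g hg using hex
  have g0 : g 0 = x := (hg 0 h.obst.zero_mem).sees.unique h.sx
    (by rw [(hg 0 h.obst.zero_mem).p_eq, h.hit_zero.p_eq])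
  have g1 : g 1 = z := (hg 1 h.obst.one_mem).sees.unique h.sz
    (by rw [(hg 1 h.obst.one_mem).p_eq, h.hit_one.p_eq])
  have gcont : ContinuousOn (fun τ => cf (B.p (I.F (g τ)))) (hullE (A.obs x y z)) := by
    refine hcf.comp_continuousOn (B.continuous_p.comp_continuousOn ?_)
    refine Metric.continuousOn_iff.2 fun t ht ε hε => ?_
    obtain ⟨δ, hδ, hnear⟩ := (hg t ht).dist_near h hε
    refine ⟨δ, hδ, fun τ hτ hd => ?_⟩
    rw [I.dist_F _ (hg τ hτ).bd _ (hg t ht).bd, dist_comm]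
    exact hnear τ _ (hg τ hτ) hd
  have vec : ∀ u, B.p (I.F u) - B.p (I.F y) = (cf (B.p (I.F u))).1 • a + (cf (B.p (I.F u))).2 • b :=
    fun u => by
      have := cf1 (B.p (I.F u))
      rw [sec] at this
      rw [← ha, ← hb] at this
      rw [sub_eq_iff_eq_add', this]
  have c0 : cf (B.p (I.F x)) = (1, 0) := by
    rw [← cf2 (1, 0), sec_one_zero]
  have c1 : cf (B.p (I.F z)) = (0, 1) := by
    rw [← cf2 (0, 1), sec_zero_one]
  have N3 : ∀ {s τ : ℝ} {u : X}, 0 ≤ s → A.Hit x y z τ u →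
      α • a + β • b + s • (B.p (I.F u) - B.p (I.F y)) ≠ 0 := fun {s τ u} hs hu e => by
    have := hN ![α, β, s, 0] ![0, 1, τ, 0] ![x, z, u, x]
      (by intro i; fin_cases i <;> simp [hs, hα, hβ])
      (by intro i; fin_cases i <;> first | exact h.hit_zero | exact h.hit_one | exact hu)
    simp only [Fin.sum_univ_four, Matrix.cons_val_zero, Matrix.cons_val_one, Matrix.cons_val,
      zero_smul, add_zero, ← ha, ← hb, e, norm_zero] at this
    nlinarith
  rcases h.obst.exists_between (d := fun τ => (cf (B.p (I.F (g τ)))).1 * β -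
      (cf (B.p (I.F (g τ)))).2 * α) ((gcont.fst.mul continuousOn_const).sub
      (gcont.snd.mul continuousOn_const)) (by simp only [g0, c0]; linarith)
      (by simp only [g1, c1]; linarith) with ⟨τ, hτ, hd⟩ | ⟨τ₁, e1, τ₂, e2, hlt, d1, d2, l, hl, w1, w2, hgap⟩
  · left
    have hu := hg τ hτ
    refine ⟨τ, g τ, hu, ?_⟩
    have hv := vec (g τ)
    set q := cf (B.p (I.F (g τ))) with hq
    have hc : ∃ c : ℝ, c * q.1 = α ∧ c * q.2 = β := by
      by_cases hq1 : q.1 = 0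
      · have hq2 : q.2 ≠ 0 := fun hq2 => by
          rw [hq1, hq2, zero_smul, zero_smul, add_zero, sub_eq_zero] at hv
          exact (I.sees h.hy hu.bd hu.sees).1 hv.symm
        rw [hq1, zero_mul, zero_sub, neg_eq_zero] at hd
        have := (mul_eq_zero.1 hd).resolve_left hq2
        exact ⟨β / q.2, by rw [hq1, this, mul_zero], div_mul_cancel₀ _ hq2⟩
      · refine ⟨α / q.1, div_mul_cancel₀ _ hq1, ?_⟩
        rw [div_mul_eq_mul_div, div_eq_iff hq1]
        linarith
    obtain ⟨c, hc1, hc2⟩ := hc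
    have hcv : α • a + β • b = c • (B.p (I.F (g τ)) - B.p (I.F y)) := by
      rw [hv, ← hc1, ← hc2]; module
    refine ⟨c, ?_, hcv⟩
    by_contra! hc0
    refine N3 (neg_nonneg.2 hc0) hu ?_
    rw [hcv, neg_smul, add_neg_cancel]
  · right
    have hu := hg τ₁ e1
    have hv := hg τ₂ e2
    have T := hu.tri h hv hlt hl w1 w2 hgap
    refine ⟨τ₁, g τ₁, τ₂, g τ₂, hu, hv, T, ?_⟩
    have li' := (T.map I).li
    obtain ⟨cf', -, cf1', -⟩ := exists_coord (A := B) li'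
    have hP := cf1' (B.p (I.F y) + (α • a + β • b))
    rw [sec, add_right_inj] at hP
    generalize cf' (B.p (I.F y) + (α • a + β • b)) = st at hP
    obtain ⟨s, t⟩ := st
    simp only at hP
    have vu := vec (g τ₁)
    have vv := vec (g τ₂)
    set q := cf (B.p (I.F (g τ₁))) with hq
    set q' := cf (B.p (I.F (g τ₂))) with hq'
    rw [vu, vv] at li'
    have hlin := hP
    rw [vu, vv] at hlin
    obtain ⟨f1, f2⟩ := li (s * q.1 + t * q'.1 - α) (s * q.2 + t * q'.2 - β) (by
      rw [← sub_eq_zero] at hlin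
      rw [← hlin]; module)
    have D1 : 0 ≤ t * (q.1 * q'.2 - q.2 * q'.1) := by
      have : t * (q.1 * q'.2 - q.2 * q'.1) = q.1 * β - q.2 * α := by
        linear_combination q.1 * (-f2) * (-1) - q.2 * f1
      rw [this]; exact d1
    have D2 : 0 ≤ s * (q.1 * q'.2 - q.2 * q'.1) := by
      have : s * (q.1 * q'.2 - q.2 * q'.1) = -(q'.1 * β - q'.2 * α) := by
        linear_combination q'.2 * f1 - q'.1 * f2
      rw [this]; linarith
    have hD : q.1 * q'.2 - q.2 * q'.1 ≠ 0 := fun hD => by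
      have r1 := li' q'.1 (-q.1) (by
        have : q'.1 • (q.1 • a + q.2 • b) + (-q.1) • (q'.1 • a + q'.2 • b) =
          (-(q.1 * q'.2 - q.2 * q'.1)) • b := by module
        rw [this, hD, neg_zero, zero_smul])
      have r2 := li' q'.2 (-q.2) (by
        have : q'.2 • (q.1 • a + q.2 • b) + (-q.2) • (q'.1 • a + q'.2 • b) =
          (q.1 * q'.2 - q.2 * q'.1) • a := by module
        rw [this, hD, zero_smul])
      have r3 := li' 1 0 (by
        rw [neg_eq_zero.1 r1.2, neg_eq_zero.1 r2.2]; simp)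
      linarith [r3.1]
    rcases lt_or_gt_of_ne hD with hD | hD
    · exfalso
      have hs : s ≤ 0 := by by_contra! hs; nlinarith
      have ht : t ≤ 0 := by by_contra! ht; nlinarith
      have := hN ![α, β, -s, -t] ![0, 1, τ₁, τ₂] ![x, z, g τ₁, g τ₂]
        (by intro i; fin_cases i <;> simp [hs, ht, hα, hβ])
        (by intro i; fin_cases i <;> first | exact h.hit_zero | exact h.hit_one | exact hu | exact hv)
      have e : α • a + β • b + (-s) • (B.p (I.F (g τ₁)) - B.p (I.F y)) +
          (-t) • (B.p (I.F (g τ₂)) - B.p (I.F y)) = 0 := by rw [← hP]; module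
      simp only [Fin.sum_univ_four, Matrix.cons_val_zero, Matrix.cons_val_one, Matrix.cons_val,
        ← ha, ← hb, e, norm_zero] at this
      nlinarith
    · exact ⟨s, t, nonneg_of_mul_nonneg_left D2 hD, nonneg_of_mul_nonneg_left D1 hD, hP.symm⟩

/-- The image of an angle is an angle. -/
theorem Angle.map (h : A.Angle x y z) (I : BdIso A B) : B.Angle (I.F x) (I.F y) (I.F z) where
  hx := I.F_mem x h.hx
  hy := I.F_mem y h.hy
  hz := I.F_mem z h.hz
  sx := I.sees h.hy h.hx h.sx
  sz := I.sees h.hy h.hz h.sz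
  li := h.map_li I
  clean := by
    obtain ⟨k, hk, hN⟩ := h.exists_le_norm_sum I
    set a := B.p (I.F x) - B.p (I.F y) with ha
    set b := B.p (I.F z) - B.p (I.F y) with hb
    set R := ‖a‖ + ‖b‖ with hR
    have hR0 : 0 ≤ R := by positivity
    refine ⟨k / (2 * (R + 1)), by positivity, fun α β hα hβ h0 hle => ?_⟩
    rw [le_div_iff₀ (by positivity)] at hle
    have hsmall : ‖α • a + β • b‖ < k := by
      refine (norm_add_le _ _).trans_lt ?_
      rw [norm_smul, norm_smul, Real.norm_of_nonneg hα, Real.norm_of_nonneg hβ]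
      nlinarith [norm_nonneg a, norm_nonneg b]
    have N2 : ∀ {s t τ₁ τ₂ : ℝ} {u v : X}, 0 ≤ s → 0 ≤ t → A.Hit x y z τ₁ u → A.Hit x y z τ₂ v →
        α • a + β • b = s • (B.p (I.F u) - B.p (I.F y)) + t • (B.p (I.F v) - B.p (I.F y)) →
        s + t < 1 := fun {s t τ₁ τ₂ u v} hs ht hu hv e => by
      have := hN ![s, t, 0, 0] ![τ₁, τ₂, 0, 0] ![u, v, x, x]
        (by intro i; fin_cases i <;> simp [hs, ht])
        (by intro i; fin_cases i <;> first | exact hu | exact hv | exact h.hit_zero)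
      simp only [Fin.sum_univ_four, Matrix.cons_val_zero, Matrix.cons_val_one, Matrix.cons_val,
        zero_smul, add_zero, ← e] at this
      nlinarith
    rcases h.exists_comb I hα hβ h0 with ⟨τ, u, hu, c, hc, e⟩ |
      ⟨τ₁, u, τ₂, v, hu, hv, T, s, t, hs, ht, e⟩
    · have hc1 := N2 hc.le le_rfl hu hu (by rw [zero_smul, add_zero]; exact e)
      rw [e]
      refine ((I.sees h.hy hu.bd hu.sees).2 _ ?_).1
      rw [openSegment_eq_image_lineMap]
      refine ⟨c, ⟨hc, by linarith⟩, ?_⟩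
      rw [AffineMap.lineMap_apply, vsub_eq_sub, vadd_eq_add, add_comm]
    · have hst := N2 hs ht hu hv e
      rw [e]
      refine (T.map I).sec_mem (q := (s, t)) hs ht hst.le ?_ ?_ ?_
      · by_contra! h0'
        simp only at h0'
        have hs0 : s = 0 := by linarith
        have ht0 : t = 0 := by linarith
        rw [hs0, ht0, zero_smul, zero_smul, add_zero] at e
        have := h.map_li I α β e
        linarith [this.1, this.2]
      · simp only; linarith
      · simp only; linarith

theorem Angle.dist_map (h : A.Angle x y z) (I : BdIso A B) :
    dist (B.p (I.F x)) (B.p (I.F z)) = dist (A.p x) (A.p z) := by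
  refine le_antisymm (h.dist_le I) ?_
  have := (h.map I).dist_le I.symm
  simpa only [BdIso.symm, I.GF x h.hx, I.GF z h.hz] using this

end Dom

namespace Dom
variable {X : Type} [MetricSpace X] {A : Dom X}

/-- Distances along the far side of a clean sector, from distances along the near side. -/
theorem dist_eq_of_clean {a : X} {P Q : Euc 2} {r : ℝ} (hr : 0 < r)
    (hP : ∀ R ∈ openSegment ℝ P (A.p a), dist a (A.pt R) = dist (A.p a) R)
    (hQ : openSegment ℝ (A.p a) Q ⊆ A.U)
    (clean : ∀ α β : ℝ, 0 ≤ α → 0 ≤ β → 0 < α + β → α + β ≤ r →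
      A.p a + (α • (P - A.p a) + β • (Q - A.p a)) ∈ A.U)
    {R : Euc 2} (hR : R ∈ openSegment ℝ (A.p a) Q) : dist a (A.pt R) = dist (A.p a) R := by
  refine le_antisymm (le_of_forall_pos_le_add fun ε hε => ?_) (A.dist_p_le (hQ hR))
  set y := A.p a with hy
  have hmem : ∀ c : ℝ, 0 < c → c < 1 → y + c • (Q - y) ∈ openSegment ℝ y Q := fun c h0 h1 => by
    rw [openSegment_eq_image']
    exact ⟨c, ⟨h0, h1⟩, rfl⟩
  have hconv := convex_openSegment (𝕜 := ℝ) y Q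
  obtain ⟨c, ⟨c0, c1⟩, rfl⟩ := (openSegment_eq_image' ℝ y Q).subset hR
  simp only at hR ⊢
  obtain ⟨e, e0, he⟩ := exists_between (show 0 < min (min r c) (ε / (dist P y + dist P Q + 1)) from
    lt_min (lt_min hr c0) (by positivity))
  obtain ⟨he1, he3⟩ := lt_min_iff.1 he
  obtain ⟨her, hec⟩ := lt_min_iff.1 he1
  rw [lt_div_iff₀ (by positivity)] at he3
  have hPe : y + e • (P - y) ∈ openSegment ℝ P y := by
    rw [openSegment_symm, openSegment_eq_image']
    exact ⟨e, ⟨e0, hec.trans c1⟩, rfl⟩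
  have d1 : dist a (A.pt (y + e • (P - y))) = e * dist P y := by
    rw [hP _ hPe, dist_self_add_right, norm_smul, Real.norm_of_nonneg e0.le, dist_eq_norm]
  have d2 : dist (A.pt (y + e • (P - y))) (A.pt (y + e • (Q - y))) ≤ e * dist P Q := by
    refine (A.pt_seg _ _ ?_).trans_eq ?_
    · rw [segment_eq_image']
      rintro _ ⟨t, ⟨t0, t1⟩, rfl⟩
      have := clean (e * (1 - t)) (e * t) (mul_nonneg e0.le (by linarith)) (mul_nonneg e0.le t0)
        (by nlinarith) (by nlinarith)
      convert this using 1
      simp only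
      module
    · rw [dist_add_left, dist_smul₀, Real.norm_of_nonneg e0.le, dist_sub_right]
  have d3 : dist (A.pt (y + e • (Q - y))) (A.pt (y + c • (Q - y))) ≤ (c - e) * dist y Q := by
    refine (A.pt_seg _ _ ((hconv.segment_subset (hmem e e0 (hec.trans c1)) hR).trans hQ)).trans_eq ?_
    rw [dist_add_left, dist_eq_norm, ← sub_smul, norm_smul, norm_sub_rev Q y, Real.norm_eq_abs,
      abs_sub_comm, abs_of_pos (sub_pos.2 hec), dist_eq_norm]
  have d4 : dist y (y + c • (Q - y)) = c * dist y Q := by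
    rw [dist_self_add_right, norm_smul, Real.norm_of_nonneg c0.le, dist_eq_norm, norm_sub_rev]
  have t1 := dist_triangle4 a (A.pt (y + e • (P - y))) (A.pt (y + e • (Q - y)))
    (A.pt (y + c • (Q - y)))
  rw [d4]
  nlinarith [dist_nonneg (x := y) (y := Q)]

theorem mem_frontier_of_mem_Bd {a : X} (ha : a ∈ A.Bd) : A.p a ∈ frontier A.U := by
  rw [A.isOpen.frontier_eq]
  refine ⟨Metric.mem_closure_iff.2 fun ε hε => ?_, ha⟩
  obtain ⟨P, hP, hd⟩ := A.dense a ε hε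
  exact ⟨P, hP, (A.dist_p_le hP).trans_lt hd⟩

end Dom

theorem not_collinear_iff_smul {x y z : Euc 2} : ¬ Collinear ℝ {x, y, z} ↔
    ∀ s t : ℝ, s • (x - y) + t • (z - y) = 0 → s = 0 ∧ t = 0 := by
  rw [collinear_iff_of_mem (p₀ := y) (by simp)]
  constructor
  · intro h s t e
    by_contra hne
    apply h
    by_cases hs : s = 0
    · subst hs
      have ht : t ≠ 0 := fun ht => hne ⟨rfl, ht⟩
      rw [zero_smul, zero_add, smul_eq_zero_iff_right ht, sub_eq_zero] at e
      refine ⟨x - y, ?_⟩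
      rintro _ (rfl | rfl | rfl)
      · exact ⟨1, by simp⟩
      · exact ⟨0, by simp⟩
      · exact ⟨0, by simp [e]⟩
    · refine ⟨z - y, ?_⟩
      rintro _ (rfl | rfl | rfl)
      · refine ⟨-(t / s), ?_⟩
        rw [vadd_eq_add, ← sub_eq_iff_eq_add]
        refine smul_right_injective _ hs ?_
        simp only [smul_smul]
        rw [eq_neg_of_add_eq_zero_left e, mul_neg, mul_div_cancel₀ _ hs, neg_smul]
      · exact ⟨0, by simp⟩
      · exact ⟨1, by simp⟩
  · rintro h ⟨v, hv⟩
    obtain ⟨r, hr⟩ := hv x (by simp)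
    obtain ⟨r', hr'⟩ := hv z (by simp)
    have hx : x - y = r • v := by rw [hr]; simp
    have hz : z - y = r' • v := by rw [hr']; simp
    have h1 := h r' (-r) (by rw [hx, hz]; module)
    have h2 := h 1 0 (by rw [hx, neg_eq_zero.1 h1.2]; simp)
    exact one_ne_zero h2.1

section Transfer
variable {U V : Set (Euc 2)} (hU : IsEucDomain U)

/-- A boundary angle, seen in the completion. -/
theorem IsBoundaryAngle.angle {x y z : Euc 2} (h : IsBoundaryAngle U x y z)
    {xt yt zt : HausdorffBoundary U} (hxt : GeneratesEndpoint U x y xt)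
    (hyt : GeneratesEndpoint U y x yt) (hzt : GeneratesEndpoint U z y zt) :
    (domOf hU).Angle (hbComp hU xt) (hbComp hU yt) (hbComp hU zt) := by
  obtain ⟨hcol, -, -, -, hxy, hyz, r, hr, hclean⟩ := h
  have li := not_collinear_iff_smul.1 hcol
  have px := hxt.support_eq hU
  have py := hyt.support_eq hU
  have pz := hzt.support_eq hU
  have hyx : openSegment ℝ y x ⊆ U := by rwa [openSegment_symm]
  have hzy : openSegment ℝ z y ⊆ U := by rwa [openSegment_symm]
  have nx : y ≠ x := fun e => one_ne_zero (li 1 0 (by rw [e]; simp)).1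
  have nz : y ≠ z := fun e => one_ne_zero (li 0 1 (by rw [e]; simp)).2
  have clean : ∃ r : ℝ, 0 < r ∧ ∀ α β : ℝ, 0 ≤ α → 0 ≤ β → 0 < α + β → α + β ≤ r →
      y + (α • (x - y) + β • (z - y)) ∈ U := by
    refine ⟨r / (‖x - y‖ + ‖z - y‖ + 1), by positivity, fun α β hα hβ h0 hle => ?_⟩
    rw [le_div_iff₀ (by positivity)] at hle
    refine hclean ⟨⟨?_, α, β, hα, hβ, by abel⟩, fun e => ?_⟩
    · rw [mem_ball, dist_self_add_left]
      refine (norm_add_le _ _).trans_lt ?_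
      rw [norm_smul, norm_smul, Real.norm_of_nonneg hα, Real.norm_of_nonneg hβ]
      nlinarith [norm_nonneg (x - y), norm_nonneg (z - y)]
    · obtain ⟨h1, h2⟩ := li α β (by simpa using e)
      linarith
  obtain ⟨ρ, hρ, hcl⟩ := clean
  refine ⟨hbComp_mem hU _, hbComp_mem hU _, hbComp_mem hU _, ⟨?_, ?_⟩, ⟨?_, ?_⟩, ?_, ?_⟩
  · rwa [py, px]
  · rw [py, px]
    exact fun R hR => ⟨hyx hR, hyt.dist_eq hU hyx hR,
      hxt.dist_eq hU hxy (by rwa [openSegment_symm])⟩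
  · rwa [py, pz]
  · rw [py, pz]
    refine fun R hR => ⟨hyz hR, ?_, hzt.dist_eq hU hzy (by rwa [openSegment_symm])⟩
    have := (domOf hU).dist_eq_of_clean (a := hbComp hU yt) (P := x) (Q := z) (R := R) hρ
    rw [py] at this
    exact this (fun R hR => hyt.dist_eq hU hyx (by rwa [openSegment_symm])) hyz hcl hR
  · rwa [px, py, pz]
  · rw [px, py, pz]
    exact ⟨ρ, hρ, hcl⟩

theorem Dom.Angle.isBoundaryAngle {X : Type} [MetricSpace X] {A : Dom X} {x y z : X}
    (h : A.Angle x y z) : IsBoundaryAngle A.U (A.p x) (A.p y) (A.p z) := by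
  refine ⟨not_collinear_iff_smul.2 h.li, mem_frontier_of_mem_Bd h.hx, mem_frontier_of_mem_Bd h.hy,
    mem_frontier_of_mem_Bd h.hz, fun R hR => (h.sx.symm.2 R hR).1, fun R hR => (h.sz.2 R hR).1, ?_⟩
  obtain ⟨r, hr, hcl⟩ := h.clean
  obtain ⟨cf, hcf, -, cf2⟩ := exists_coord h.li
  have c0 : cf (A.p y) = (0, 0) := by
    rw [← cf2 (0, 0)]
    simp [sec]
  obtain ⟨ρ, hρ, hd⟩ := Metric.continuous_iff.1 hcf (A.p y) (r / 2) (by positivity)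
  refine ⟨ρ, hρ, ?_⟩
  rintro _ ⟨⟨hb, t, s, ht, hs, rfl⟩, hne⟩
  have hq := hd _ hb
  rw [add_assoc] at hne hq ⊢
  rw [show A.p y + (t • (A.p x - A.p y) + s • (A.p z - A.p y)) = A.sec x y z (t, s) from rfl, cf2,
    c0, Prod.dist_eq, max_lt_iff] at hq
  simp only [Real.dist_0_eq_abs, abs_of_nonneg ht, abs_of_nonneg hs] at hq
  refine hcl t s ht hs ?_ (by linarith [hq.1, hq.2])
  by_contra! h0
  refine hne ?_
  rw [show t = 0 by linarith, show s = 0 by linarith]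
  simp

/-- The isometry of the boundaries of the completions given by an isometry of Hausdorff
boundaries. -/
def IsHBIsometry.bdIso (hV : IsEucDomain V) {f : HausdorffBoundary U → HausdorffBoundary V}
    (hf : IsHBIsometry f) [Nonempty (HausdorffBoundary U)] [Nonempty (HausdorffBoundary V)] :
    BdIso (domOf hU) (domOf hV) where
  F a := hbComp hV (f (Function.invFun (hbComp hU) a))
  G b := hbComp hU ((Equiv.ofBijective f hf.1).symm (Function.invFun (hbComp hV) b))
  F_mem _ _ := hbComp_mem hV _
  G_mem _ _ := hbComp_mem hU _
  GF a ha := by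
    obtain ⟨b, rfl⟩ := exists_hbComp hU ha
    rw [Function.leftInverse_invFun (hbComp_injective hU),
      Function.leftInverse_invFun (hbComp_injective hV), Equiv.ofBijective_symm_apply_apply]
  FG a ha := by
    obtain ⟨b, rfl⟩ := exists_hbComp hV ha
    rw [Function.leftInverse_invFun (hbComp_injective hU),
      Function.leftInverse_invFun (hbComp_injective hV)]
    exact congrArg _ (Equiv.ofBijective_apply_symm_apply f hf.1 b)
  dist_F a ha b hb := by
    obtain ⟨a, rfl⟩ := exists_hbComp hU ha
    obtain ⟨b, rfl⟩ := exists_hbComp hU hb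
    rw [Function.leftInverse_invFun (hbComp_injective hU),
      Function.leftInverse_invFun (hbComp_injective hU), dist_edist, dist_edist,
      ← hbDist_eq, ← hbDist_eq, hf.2]

theorem IsHBIsometry.bdIso_apply (hV : IsEucDomain V)
    {f : HausdorffBoundary U → HausdorffBoundary V} (hf : IsHBIsometry f)
    [Nonempty (HausdorffBoundary U)] [Nonempty (HausdorffBoundary V)] (a : HausdorffBoundary U) :
    (hf.bdIso hU hV).F (hbComp hU a) = hbComp hV (f a) := by
  simp only [bdIso]
  rw [Function.leftInverse_invFun (hbComp_injective hU)]

end Transfer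

/-- Lemma 2.9: an isometry of Hausdorff boundaries in the relative metrics takes
boundary angles into equal boundary angles. -/
theorem boundary_angle_invariance
    (U V : Set (Euc 2))
    (hU : IsEucDomain U) (hV : IsEucDomain V) (hU' : U ≠ univ) (hV' : V ≠ univ)
    (f : HausdorffBoundary U → HausdorffBoundary V) (hf : IsHBIsometry f)
    (x y z : Euc 2) (hxyz : IsBoundaryAngle U x y z)
    (xt yt zt : HausdorffBoundary U)
    (hxt : GeneratesEndpoint U x y xt) (hyt : GeneratesEndpoint U y x yt)
    (hzt : GeneratesEndpoint U z y zt) :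
    IsBoundaryAngle V (hbSupport (f xt)) (hbSupport (f yt)) (hbSupport (f zt)) ∧
      dist (hbSupport (f xt)) (hbSupport (f yt)) = dist x y ∧
      dist (hbSupport (f zt)) (hbSupport (f yt)) = dist z y ∧
      dist (hbSupport (f xt)) (hbSupport (f zt)) = dist x z := by
  have : Nonempty (HausdorffBoundary U) := ⟨xt⟩
  have : Nonempty (HausdorffBoundary V) := ⟨f xt⟩
  have h := hxyz.angle hU hxt hyt hzt
  set I := hf.bdIso hU hV with hI
  have h' := h.map I
  have dx := I.dist_p h.hx h.hy h.sx.symm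
  have dz := I.dist_p h.hz h.hy h.sz.symm
  have dxz := h.dist_map I
  rw [hI, hf.bdIso_apply, hf.bdIso_apply, hf.bdIso_apply] at h'
  rw [hI, hf.bdIso_apply, hf.bdIso_apply, hxt.support_eq hU, hyt.support_eq hU] at dx
  rw [hI, hf.bdIso_apply, hf.bdIso_apply, hzt.support_eq hU, hyt.support_eq hU] at dz
  rw [hI, hf.bdIso_apply, hf.bdIso_apply, hxt.support_eq hU, hzt.support_eq hU] at dxz
  rw [hbSupport_eq hV, hbSupport_eq hV, hbSupport_eq hV]
  exact ⟨h'.isBoundaryAngle, dx, dz, dxz⟩
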